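/- arXiv:2407.12372 — 2 statements merged into one kernel-verified Lean document; each statement's English description precedes it below -/
import Mathlib

section
/- Let f : ℝⁿ → ℝ be a real-valued function that is semi-algebraic, upper semicontinuous, and bounded on every compact subset of ℝⁿ. Then there exist m ∈ ℕ, polynomials P, Q : ℝⁿ × ℝᵐ → ℝ, and a bounded box 𝒴 = [a₁,b₁] × … × [aₘ,bₘ] ⊆ ℝᵐ (all aᵢ, bᵢ real) such that the pessimistic value function φ_p of the associated bilevel problem satisfies φ_p = f. -/
open Set

noncomputable section

/-- The lower-level argmin set `Θ(x) = {y ∈ 𝒴 : ∀ y' ∈ 𝒴, Q(x,y) ≤ Q(x,y')}`. -/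
def argminSet {n m : ℕ} (Q : (Fin n → ℝ) → (Fin m → ℝ) → ℝ) (Y : Set (Fin m → ℝ))
    (x : Fin n → ℝ) : Set (Fin m → ℝ) :=
  {y | y ∈ Y ∧ ∀ y' ∈ Y, Q x y ≤ Q x y'}

/-- Optimistic value function `φ_o(x) = inf_{y ∈ Θ(x)} P(x,y)`,
with the convention `inf ∅ = +∞`. -/
def valOpt {n m : ℕ} (P Q : (Fin n → ℝ) → (Fin m → ℝ) → ℝ) (Y : Set (Fin m → ℝ))
    (x : Fin n → ℝ) : EReal :=
  ⨅ y ∈ argminSet Q Y x, ((P x y : ℝ) : EReal)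

/-- Pessimistic value function `φ_p(x) = sup_{y ∈ Θ(x)} P(x,y)`,
with the convention `sup ∅ = -∞`. -/
def valPess {n m : ℕ} (P Q : (Fin n → ℝ) → (Fin m → ℝ) → ℝ) (Y : Set (Fin m → ℝ))
    (x : Fin n → ℝ) : EReal :=
  ⨆ y ∈ argminSet Q Y x, ((P x y : ℝ) : EReal)

/-- `P (x, y)` is a real polynomial in the joint variables `(x, y)`. -/
def IsPolyMap {n m : ℕ} (P : (Fin n → ℝ) → (Fin m → ℝ) → ℝ) : Prop :=
  ∃ p : MvPolynomial (Fin n ⊕ Fin m) ℝ,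
    ∀ x y, P x y = MvPolynomial.eval (Sum.elim x y) p

/-- Basic semi-algebraic subset of `ℝ^ι`. -/
def IsBasicSemialgebraic {ι : Type} [Fintype ι] (S : Set (ι → ℝ)) : Prop :=
  ∃ (p : MvPolynomial ι ℝ) (k : ℕ) (q : Fin k → MvPolynomial ι ℝ),
    S = {x | MvPolynomial.eval x p = 0 ∧ ∀ j, 0 < MvPolynomial.eval x (q j)}

/-- Semi-algebraic set: a finite union of basic semi-algebraic sets. -/
def IsSemialgebraic {ι : Type} [Fintype ι] (S : Set (ι → ℝ)) : Prop :=
  ∃ (N : ℕ) (T : Fin N → Set (ι → ℝ)),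
    (∀ i, IsBasicSemialgebraic (T i)) ∧ S = ⋃ i, T i

/-- Semi-algebraic real-valued function: its graph (inside `ℝ^{ι} × ℝ ≅ ℝ^{ι ⊕ Unit}`)
is semi-algebraic. -/
def IsSemialgebraicFun {ι : Type} [Fintype ι] (f : (ι → ℝ) → ℝ) : Prop :=
  IsSemialgebraic {z : (ι ⊕ Unit) → ℝ | f (z ∘ Sum.inl) = z (Sum.inr ())}

/-- Extended-real-valued semi-algebraic function: the sets where it is finite, `+∞`, `-∞`
are semi-algebraic, and the graph of its restriction to its (finite) domain is
semi-algebraic. -/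
def IsERealSemialgebraicFun {ι : Type} [Fintype ι] (h : (ι → ℝ) → EReal) : Prop :=
  IsSemialgebraic {x | ∃ r : ℝ, h x = (r : EReal)} ∧
  IsSemialgebraic {x | h x = ⊤} ∧
  IsSemialgebraic {x | h x = ⊥} ∧
  IsSemialgebraic {z : (ι ⊕ Unit) → ℝ | h (z ∘ Sum.inl) = ((z (Sum.inr ()) : ℝ) : EReal)}

/-- A (possibly unbounded) box `[a₁,b₁] × ⋯ × [aₘ,bₘ]` in `ℝ^m`, with
endpoints in `ℝ ∪ {±∞}`. -/
def IsBox {m : ℕ} (Y : Set (Fin m → ℝ)) : Prop :=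
  ∃ a b : Fin m → EReal,
    Y = {y | ∀ i, a i ≤ (y i : EReal) ∧ (y i : EReal) ≤ b i}

/-- The bounded box `[a₁,b₁] × ⋯ × [aₘ,bₘ]` with real endpoints. -/
def boundedBox {m : ℕ} (a b : Fin m → ℝ) : Set (Fin m → ℝ) :=
  {y | ∀ i, y i ∈ Set.Icc (a i) (b i)}

/-- Piecewise polynomial function: there is a finite partition of `ℝ^n` into pairwise
disjoint semi-algebraic sets on each of which `f` coincides with a polynomial. -/
def IsPiecewisePolynomial {n : ℕ} (f : (Fin n → ℝ) → ℝ) : Prop :=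
  ∃ (N : ℕ) (S : Fin N → Set (Fin n → ℝ)) (p : Fin N → MvPolynomial (Fin n) ℝ),
    (∀ i, IsSemialgebraic (S i)) ∧
    (∀ i j, i ≠ j → Disjoint (S i) (S j)) ∧
    (⋃ i, S i) = Set.univ ∧
    (∀ i, ∀ x ∈ S i, f x = MvPolynomial.eval x (p i))

namespace SemialgebraicAux

open Polynomial Filter Topology

/-- The index of the cell containing `t` in the decomposition of the line by the points of `Z`. -/
def cellIndex (Z : Finset ℝ) (t : ℝ) : ℕ :=
  (Z.filter (· < t)).card + (Z.filter (· ≤ t)).card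

lemma cellIndex_mono (Z : Finset ℝ) : Monotone (cellIndex Z) := by
  intro s t hst
  unfold cellIndex
  gcongr ?_ + ?_
  · exact Finset.card_le_card (Finset.monotone_filter_right _ fun z _ hz => lt_of_lt_of_le hz hst)
  · exact Finset.card_le_card (Finset.monotone_filter_right _ fun z _ hz => le_trans hz hst)

lemma cellIndex_lt {Z : Finset ℝ} {s t z : ℝ} (hz : z ∈ Z) (hst : s < t) (hsz : s ≤ z)
    (hzt : z ≤ t) : cellIndex Z s < cellIndex Z t := by
  have h1 : (Z.filter (· < s)).card ≤ (Z.filter (· < t)).card :=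
    Finset.card_le_card (Finset.monotone_filter_right _ fun z _ hz => lt_trans hz hst)
  have h2 : (Z.filter (· ≤ s)).card ≤ (Z.filter (· ≤ t)).card :=
    Finset.card_le_card (Finset.monotone_filter_right _ fun z _ hz => le_trans hz hst.le)
  unfold cellIndex
  rcases hsz.eq_or_lt with rfl | hsz
  · have : (Z.filter (· < s)).card < (Z.filter (· < t)).card := by
      refine Finset.card_lt_card ⟨Finset.monotone_filter_right _ fun z _ hz => lt_trans hz hst, ?_⟩
      intro h
      have := h (Finset.mem_filter.2 ⟨hz, hst⟩)
      simp at this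
    omega
  · have : (Z.filter (· ≤ s)).card < (Z.filter (· ≤ t)).card := by
      refine Finset.card_lt_card
        ⟨Finset.monotone_filter_right _ fun z _ hz => le_trans hz hst.le, ?_⟩
      intro h
      have := h (Finset.mem_filter.2 ⟨hz, hzt⟩)
      simp only [Finset.mem_filter] at this
      linarith [this.2]
    omega

lemma cellIndex_eq {Z : Finset ℝ} {s t : ℝ} (hst : s ≤ t)
    (h : ∀ z ∈ Z, s ≤ z → z ≤ t → False) : cellIndex Z s = cellIndex Z t := by
  unfold cellIndex
  congr 2
  · refine Finset.filter_congr fun z hz => ⟨fun h1 => lt_of_lt_of_le h1 hst, fun h1 => ?_⟩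
    by_contra h2
    exact h z hz (not_lt.1 h2) h1.le
  · refine Finset.filter_congr fun z hz => ⟨fun h1 => le_trans h1 hst, fun h1 => ?_⟩
    by_contra h2
    exact h z hz (not_le.1 h2).le h1

lemma cellIndex_eq_of_between {Z : Finset ℝ} {s t u : ℝ} (h : cellIndex Z s = cellIndex Z t)
    (hsu : s ≤ u) (hut : u ≤ t) : cellIndex Z u = cellIndex Z t :=
  le_antisymm (cellIndex_mono Z hut) (h ▸ cellIndex_mono Z hsu)

lemma eq_of_cellIndex_eq {Z : Finset ℝ} {s t : ℝ} (h : cellIndex Z s = cellIndex Z t)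
    (hs : s ∈ Z) : s = t := by
  rcases lt_trichotomy s t with hst | hst | hst
  · exact absurd h (cellIndex_lt hs hst le_rfl hst.le).ne
  · exact hst
  · exact absurd h (cellIndex_lt hs hst hst.le le_rfl).ne'

lemma eventually_cellIndex_eq {Z : Finset ℝ} {t : ℝ} (ht : t ∉ Z) :
    ∀ᶠ s in 𝓝 t, cellIndex Z s = cellIndex Z t := by
  have h : ∀ᶠ s in 𝓝 t, ∀ z ∈ Z, (z < t → z < s) ∧ (t < z → s < z) := by
    rw [Filter.eventually_all_finset]
    intro z hz
    refine Filter.Eventually.and ?_ ?_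
    · by_cases h : z < t
      · filter_upwards [lt_mem_nhds h] with s hs _ using hs
      · exact Eventually.of_forall fun s h' => absurd h' h
    · by_cases h : t < z
      · filter_upwards [gt_mem_nhds h] with s hs _ using hs
      · exact Eventually.of_forall fun s h' => absurd h' h
  filter_upwards [h] with s hs
  rcases le_total s t with hst | hst
  · refine cellIndex_eq hst fun z hz h1 h2 => ?_
    have : z < t := lt_of_le_of_ne h2 fun h => ht (h ▸ hz)
    linarith [(hs z hz).1 this]
  · refine (cellIndex_eq hst fun z hz h1 h2 => ?_).symm
    have : t < z := lt_of_le_of_ne h1 fun h => ht (h ▸ hz)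
    linarith [(hs z hz).2 this]

lemma sign_eval_eq_of_no_root {q : ℝ[X]} {s t : ℝ} (hst : s ≤ t)
    (h : ∀ u, s ≤ u → u ≤ t → q.eval u ≠ 0) :
    SignType.sign (q.eval s) = SignType.sign (q.eval t) := by
  have hc : ContinuousOn (fun u => q.eval u) (Icc s t) := q.continuous.continuousOn
  rcases lt_or_gt_of_ne (h s le_rfl hst) with h1 | h1 <;>
    rcases lt_or_gt_of_ne (h t hst le_rfl) with h2 | h2
  · rw [sign_neg h1, sign_neg h2]
  · obtain ⟨u, hu, hu0⟩ := intermediate_value_Icc hst hc ⟨h1.le, h2.le⟩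
    exact absurd hu0 (h u hu.1 hu.2)
  · obtain ⟨u, hu, hu0⟩ := intermediate_value_Icc' hst hc ⟨h2.le, h1.le⟩
    exact absurd hu0 (h u hu.1 hu.2)
  · rw [sign_pos h1, sign_pos h2]

lemma eval_strictMonoOn_Icc {q : ℝ[X]} {s t : ℝ}
    (h : ∀ u, s < u → u < t → 0 < q.derivative.eval u) :
    StrictMonoOn (fun u => q.eval u) (Icc s t) := by
  refine strictMonoOn_of_deriv_pos (convex_Icc s t) q.continuous.continuousOn fun u hu => ?_
  rw [interior_Icc] at hu
  simpa using h u hu.1 hu.2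

lemma exists_pos_right {q : ℝ[X]} {Z : Finset ℝ} {t : ℝ} (ht : t ∉ Z)
    (hq : ∀ u, t ≤ u → cellIndex Z u = cellIndex Z t → 0 < q.derivative.eval u)
    (hend : ∀ z ∈ Z, t < z → (∀ w ∈ Z, t < w → z ≤ w) → 0 < q.eval z) :
    ∃ u, cellIndex Z u = cellIndex Z t ∧ 0 < q.eval u := by
  by_cases hne : (Z.filter (t < ·)).Nonempty
  · set z := (Z.filter (t < ·)).min' hne with hz
    obtain ⟨hzZ, htz⟩ := Finset.mem_filter.1 ((Z.filter (t < ·)).min'_mem hne)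
    have hmin : ∀ w ∈ Z, t < w → z ≤ w := fun w hw htw =>
      Finset.min'_le _ _ (Finset.mem_filter.2 ⟨hw, htw⟩)
    have hpos := hend z hzZ htz hmin
    have h1 : ∀ᶠ u in 𝓝[<] z, 0 < q.eval u :=
      (q.continuous.continuousAt.eventually (lt_mem_nhds hpos)).filter_mono nhdsWithin_le_nhds
    have h2 : ∀ᶠ u in 𝓝[<] z, t < u := (lt_mem_nhds htz).filter_mono nhdsWithin_le_nhds
    obtain ⟨u, ⟨hu1, hu2⟩, hu3⟩ := ((h1.and h2).and self_mem_nhdsWithin).exists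
    refine ⟨u, (cellIndex_eq hu2.le fun w hw h1 h2 => ?_).symm, hu1⟩
    have : t < w := lt_of_le_of_ne h1 fun h => ht (h ▸ hw)
    have := hmin w hw this
    have hu3 : u < z := hu3
    linarith
  · have hno : ∀ u, t ≤ u → cellIndex Z u = cellIndex Z t := fun u hu =>
      (cellIndex_eq hu fun w hw h1 h2 => hne ⟨w, Finset.mem_filter.2
        ⟨hw, lt_of_le_of_ne h1 fun h => ht (h ▸ hw)⟩⟩).symm
    have hdeg : 0 < q.degree := by
      by_contra h
      rw [eq_C_of_degree_le_zero (not_lt.1 h)] at hq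
      simpa using hq t le_rfl rfl
    obtain ⟨u, hu, htu⟩ := (((abs_tendsto_atTop q hdeg).eventually_gt_atTop |q.eval t|).and
      (eventually_gt_atTop t)).exists
    refine ⟨u, hno u htu.le, ?_⟩
    have hm := eval_strictMonoOn_Icc (q := q) (s := t) (t := u)
      (fun v h1 _ => hq v h1.le (hno v h1.le)) ⟨le_rfl, htu.le⟩ ⟨htu.le, le_rfl⟩ htu
    simp only at hm
    by_contra hneg
    rw [abs_of_nonpos (not_lt.1 hneg)] at hu
    linarith [neg_abs_le (q.eval t)]

lemma exists_pos_left {q : ℝ[X]} {Z : Finset ℝ} {t : ℝ} (ht : t ∉ Z)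
    (hq : ∀ u, u ≤ t → cellIndex Z u = cellIndex Z t → q.derivative.eval u < 0)
    (hend : ∀ z ∈ Z, z < t → (∀ w ∈ Z, w < t → w ≤ z) → 0 < q.eval z) :
    ∃ u, cellIndex Z u = cellIndex Z t ∧ 0 < q.eval u := by
  by_cases hne : (Z.filter (· < t)).Nonempty
  · set z := (Z.filter (· < t)).max' hne with hz
    obtain ⟨hzZ, htz⟩ := Finset.mem_filter.1 ((Z.filter (· < t)).max'_mem hne)
    have hmax : ∀ w ∈ Z, w < t → w ≤ z := fun w hw htw =>
      Finset.le_max' _ _ (Finset.mem_filter.2 ⟨hw, htw⟩)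
    have hpos := hend z hzZ htz hmax
    have h1 : ∀ᶠ u in 𝓝[>] z, 0 < q.eval u :=
      (q.continuous.continuousAt.eventually (lt_mem_nhds hpos)).filter_mono nhdsWithin_le_nhds
    have h2 : ∀ᶠ u in 𝓝[>] z, u < t := (gt_mem_nhds htz).filter_mono nhdsWithin_le_nhds
    obtain ⟨u, ⟨hu1, hu2⟩, hu3⟩ := ((h1.and h2).and self_mem_nhdsWithin).exists
    refine ⟨u, cellIndex_eq hu2.le fun w hw h1 h2 => ?_, hu1⟩
    have : w < t := lt_of_le_of_ne h2 fun h => ht (h ▸ hw)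
    have := hmax w hw this
    have hu3 : z < u := hu3
    linarith
  · have hno : ∀ u, u ≤ t → cellIndex Z u = cellIndex Z t := fun u hu =>
      cellIndex_eq hu fun w hw h1 h2 => hne ⟨w, Finset.mem_filter.2
        ⟨hw, lt_of_le_of_ne h2 fun h => ht (h ▸ hw)⟩⟩
    have hdeg : 0 < (q.comp (-X)).degree := by
      by_contra h
      have h1 := congrArg (fun r => r.comp (-X)) (eq_C_of_degree_le_zero (not_lt.1 h))
      simp only [comp_assoc, neg_comp, X_comp, neg_neg, comp_X, C_comp] at h1
      rw [h1] at hq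
      simpa using hq t le_rfl rfl
    obtain ⟨u, hu, htu⟩ := (((abs_tendsto_atTop _ hdeg).eventually_gt_atTop |q.eval t|).and
      (eventually_gt_atTop (-t))).exists
    have htu' : -u < t := by linarith
    simp only [eval_comp, eval_neg, eval_X] at hu
    refine ⟨-u, hno _ htu'.le, ?_⟩
    have hm := eval_strictMonoOn_Icc (q := -q) (s := -u) (t := t)
      (fun v _ h2 => by
        have := hq v h2.le (hno v h2.le)
        simp only [derivative_neg, eval_neg]; linarith)
      ⟨le_rfl, htu'.le⟩ ⟨htu'.le, le_rfl⟩ htu'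
    simp only [eval_neg] at hm
    by_contra hneg
    rw [abs_of_nonpos (not_lt.1 hneg)] at hu
    linarith [neg_abs_le (q.eval t)]

lemma exists_pos_of_cellIndex_eq {p p' : ℝ[X]} {Z Z' : Finset ℝ} {φ : ℝ → ℝ}
    (hφ : ∀ t, cellIndex Z' (φ t) = cellIndex Z t) (hmem : ∀ t ∈ Z, φ t ∈ Z')
    (hsurj : ∀ z' ∈ Z', ∃ z ∈ Z, φ z = z')
    (hd : ∀ t t', cellIndex Z' t' = cellIndex Z t →
      SignType.sign (p.derivative.eval t) = SignType.sign (p'.derivative.eval t'))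
    (hdZ : ∀ t, p.derivative.eval t = 0 → t ∈ Z)
    (hroot : ∀ z ∈ Z, SignType.sign (p.eval z) = SignType.sign (p'.eval (φ z)))
    {t : ℝ} (ht : 0 < p.eval t) :
    ∃ t', cellIndex Z' t' = cellIndex Z t ∧ 0 < p'.eval t' := by
  by_cases htZ : t ∈ Z
  · refine ⟨φ t, hφ t, ?_⟩
    rw [← sign_eq_one_iff, ← hroot t htZ, sign_pos ht]
  have htZ' : φ t ∉ Z' := fun h => by
    obtain ⟨z, hz, hzt⟩ := hsurj _ h
    have : cellIndex Z z = cellIndex Z t := by rw [← hφ, ← hφ, hzt]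
    exact htZ (eq_of_cellIndex_eq this hz ▸ hz)
  have hlt : ∀ {u v}, cellIndex Z u < cellIndex Z v → φ u < φ v := fun {u v} h => by
    by_contra h'
    have := cellIndex_mono Z' (not_lt.1 h')
    rw [hφ, hφ] at this
    omega
  have hlt' : ∀ {u v}, u ∈ Z → φ u < φ v → u < v := fun {u v} hu h => by
    by_contra h'
    have h1 := cellIndex_mono Z (not_lt.1 h')
    have h2 := cellIndex_lt (hmem u hu) h le_rfl h.le
    rw [hφ, hφ] at h2
    omega
  have hgt' : ∀ {u v}, u ∈ Z → φ v < φ u → v < u := fun {u v} hu h => by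
    by_contra h'
    have h1 := cellIndex_mono Z (not_lt.1 h')
    have h2 := cellIndex_lt (hmem u hu) h h.le le_rfl
    rw [hφ, hφ] at h2
    omega
  rcases lt_or_gt_of_ne (fun h => htZ (hdZ t h)) with hneg | hpos
  · obtain ⟨u, hu, hu'⟩ := exists_pos_left (q := p') htZ' (fun u _ h => by
      rw [← sign_eq_neg_one_iff, ← hd t u (h.trans (hφ t)), sign_neg hneg]) (by
      intro z' hz' hzt hmax
      obtain ⟨z, hz, rfl⟩ := hsurj z' hz'
      have hzt' : z < t := hlt' hz hzt
      rw [← sign_eq_one_iff, ← hroot z hz, sign_eq_one_iff]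
      have hm := eval_strictMonoOn_Icc (q := -p) (s := z) (t := t) (fun v h1 h2 => by
        have hv : cellIndex Z v = cellIndex Z t := cellIndex_eq h2.le fun w hw h3 h4 => by
          have hwt : w < t := lt_of_le_of_ne h4 fun h => htZ (h ▸ hw)
          have h5 := hlt (cellIndex_lt hw hwt le_rfl hwt.le)
          have h6 := hlt (cellIndex_lt hz (h1.trans_le h3) le_rfl (h1.trans_le h3).le)
          linarith [hmax _ (hmem w hw) h5]
        have : p.derivative.eval v < 0 := by
          rw [← sign_eq_neg_one_iff, hd v (φ t) ((hφ t).trans hv.symm), ← hd t (φ t) (hφ t),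
            sign_neg hneg]
        simp only [derivative_neg, eval_neg]; linarith)
        ⟨le_rfl, hzt'.le⟩ ⟨hzt'.le, le_rfl⟩ hzt'
      simp only [eval_neg] at hm
      linarith)
    exact ⟨u, hu.trans (hφ t), hu'⟩
  · obtain ⟨u, hu, hu'⟩ := exists_pos_right (q := p') htZ' (fun u _ h => by
      rw [← sign_eq_one_iff, ← hd t u (h.trans (hφ t)), sign_pos hpos]) (by
      intro z' hz' hzt hmin
      obtain ⟨z, hz, rfl⟩ := hsurj z' hz'
      have hzt' : t < z := hgt' hz hzt
      rw [← sign_eq_one_iff, ← hroot z hz, sign_eq_one_iff]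
      have hm := eval_strictMonoOn_Icc (q := p) (s := t) (t := z) (fun v h1 h2 => by
        have hv : cellIndex Z t = cellIndex Z v := cellIndex_eq h1.le fun w hw h3 h4 => by
          have hwt : t < w := lt_of_le_of_ne h3 fun h => htZ (h ▸ hw)
          have h5 := hlt (cellIndex_lt hw hwt hwt.le le_rfl)
          have h6 := hlt (cellIndex_lt hz (h4.trans_lt h2) (h4.trans_lt h2).le le_rfl)
          linarith [hmin _ (hmem w hw) h5]
        rw [← sign_eq_one_iff, hd v (φ t) ((hφ t).trans hv), ← hd t (φ t) (hφ t),
            sign_pos hpos])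
        ⟨le_rfl, hzt'.le⟩ ⟨hzt'.le, le_rfl⟩ hzt'
      simp only at hm
      linarith)
    exact ⟨u, hu.trans (hφ t), hu'⟩

lemma exists_sign_eq_of_cellIndex_eq {p p' : ℝ[X]} {Z Z' : Finset ℝ} {φ : ℝ → ℝ}
    (hφ : ∀ t, cellIndex Z' (φ t) = cellIndex Z t) (hmem : ∀ t ∈ Z, φ t ∈ Z')
    (hsurj : ∀ z' ∈ Z', ∃ z ∈ Z, φ z = z')
    (hd : ∀ t t', cellIndex Z' t' = cellIndex Z t →
      SignType.sign (p.derivative.eval t) = SignType.sign (p'.derivative.eval t'))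
    (hdZ : ∀ t, p.derivative.eval t = 0 → t ∈ Z)
    (hroot : ∀ z ∈ Z, SignType.sign (p.eval z) = SignType.sign (p'.eval (φ z))) (t : ℝ) :
    ∃ t', cellIndex Z' t' = cellIndex Z t ∧
      SignType.sign (p'.eval t') = SignType.sign (p.eval t) := by
  have hP : ∀ t, 0 < p.eval t → ∃ t', cellIndex Z' t' = cellIndex Z t ∧ 0 < p'.eval t' :=
    fun t ht => exists_pos_of_cellIndex_eq hφ hmem hsurj hd hdZ hroot ht
  have hN : ∀ t, p.eval t < 0 → ∃ t', cellIndex Z' t' = cellIndex Z t ∧ p'.eval t' < 0 := by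
    intro t ht
    obtain ⟨t', h1, h2⟩ := exists_pos_of_cellIndex_eq (p := -p) (p' := -p') (t := t) hφ hmem hsurj
      (by simpa [Left.sign_neg] using hd) (by simpa using hdZ)
      (by simpa [Left.sign_neg] using hroot) (by simpa using ht)
    exact ⟨t', h1, by simpa using h2⟩
  rcases lt_trichotomy (p.eval t) 0 with h | h | h
  · obtain ⟨t', h1, h2⟩ := hN t h
    exact ⟨t', h1, by rw [sign_neg h, sign_neg h2]⟩
  · by_cases htZ : t ∈ Z
    · exact ⟨φ t, hφ t, (hroot t htZ).symm⟩
    have hne : p.derivative.eval t ≠ 0 := fun h => htZ (hdZ t h)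
    have hex1 : ∃ s, cellIndex Z s = cellIndex Z t ∧ 0 < p.eval s := by
      by_contra hcon
      push Not at hcon
      refine hne ?_
      have : IsLocalMax (fun s => p.eval s) t := by
        filter_upwards [eventually_cellIndex_eq htZ] with s hs
        rw [h]; exact hcon s hs
      simpa using this.deriv_eq_zero
    have hex2 : ∃ s, cellIndex Z s = cellIndex Z t ∧ p.eval s < 0 := by
      by_contra hcon
      push Not at hcon
      refine hne ?_
      have : IsLocalMin (fun s => p.eval s) t := by
        filter_upwards [eventually_cellIndex_eq htZ] with s hs
        rw [h]; exact hcon s hs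
      simpa using this.deriv_eq_zero
    obtain ⟨s1, hs1, hs1'⟩ := hex1
    obtain ⟨s2, hs2, hs2'⟩ := hex2
    obtain ⟨t1, ht1, ht1'⟩ := hP s1 hs1'
    obtain ⟨t2, ht2, ht2'⟩ := hN s2 hs2'
    rw [hs1] at ht1
    rw [hs2] at ht2
    rcases le_total t1 t2 with hle | hle
    · obtain ⟨u, hu, hu0⟩ := intermediate_value_Icc' hle
        (f := fun s => p'.eval s) p'.continuous.continuousOn ⟨ht2'.le, ht1'.le⟩
      refine ⟨u, (cellIndex_eq_of_between (ht1.trans ht2.symm) hu.1 hu.2).trans ht2, ?_⟩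
      simp only at hu0
      rw [hu0, h]
    · obtain ⟨u, hu, hu0⟩ := intermediate_value_Icc hle
        (f := fun s => p'.eval s) p'.continuous.continuousOn ⟨ht2'.le, ht1'.le⟩
      refine ⟨u, (cellIndex_eq_of_between (ht2.trans ht1.symm) hu.1 hu.2).trans ht1, ?_⟩
      simp only at hu0
      rw [hu0, h]
  · obtain ⟨t', h1, h2⟩ := hP t h
    exact ⟨t', h1, by rw [sign_pos h, sign_pos h2]⟩

lemma exists_monotone_of_cellIndex_eq {p p' : ℝ[X]} {Z Z' : Finset ℝ} {φ : ℝ → ℝ}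
    (hφ : ∀ t, cellIndex Z' (φ t) = cellIndex Z t) (hmem : ∀ t ∈ Z, φ t ∈ Z')
    (hsurj : ∀ z' ∈ Z', ∃ z ∈ Z, φ z = z')
    (hd : ∀ t t', cellIndex Z' t' = cellIndex Z t →
      SignType.sign (p.derivative.eval t) = SignType.sign (p'.derivative.eval t'))
    (hdZ : ∀ t, p.derivative.eval t = 0 → t ∈ Z)
    (hroot : ∀ z ∈ Z, SignType.sign (p.eval z) = SignType.sign (p'.eval (φ z))) :
    ∃ χ : ℝ → ℝ, Monotone χ ∧ ∀ t, cellIndex Z' (χ t) = cellIndex Z t ∧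
      SignType.sign (p'.eval (χ t)) = SignType.sign (p.eval t) := by
  classical
  have hex := exists_sign_eq_of_cellIndex_eq hφ hmem hsurj hd hdZ hroot
  let g : ℕ → SignType → ℝ := fun c σ =>
    if h : ∃ t', cellIndex Z' t' = c ∧ SignType.sign (p'.eval t') = σ then h.choose else 0
  have hg : ∀ t, cellIndex Z' (g (cellIndex Z t) (SignType.sign (p.eval t))) = cellIndex Z t ∧
      SignType.sign (p'.eval (g (cellIndex Z t) (SignType.sign (p.eval t)))) =
        SignType.sign (p.eval t) := by
    intro t
    simp only [g, dif_pos (hex t)]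
    exact (hex t).choose_spec
  set χ : ℝ → ℝ := fun t => g (cellIndex Z t) (SignType.sign (p.eval t)) with hχ
  have hχe : ∀ s t, cellIndex Z s = cellIndex Z t →
      SignType.sign (p.eval s) = SignType.sign (p.eval t) → χ s = χ t := by
    intro s t h1 h2
    simp only [hχ, h1, h2]
  refine ⟨χ, ?_, hg⟩
  intro s t hst
  rcases (cellIndex_mono Z hst).lt_or_eq with h | h
  · by_contra h'
    have := cellIndex_mono Z' (not_le.1 h').le
    rw [(hg s).1, (hg t).1] at this
    omega
  by_contra h'
  have h' : χ t < χ s := not_le.1 h'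
  have hst' : s < t := lt_of_le_of_ne hst fun h => by rw [h] at h'; exact lt_irrefl _ h'
  have hcell : cellIndex Z' (χ t) = cellIndex Z' (χ s) := by rw [(hg s).1, (hg t).1, h]
  have hin : ∀ v, s < v → v < t → cellIndex Z v = cellIndex Z t := fun v h1 h2 =>
    cellIndex_eq_of_between h h1.le h2.le
  have hin' : ∀ v, χ t < v → v < χ s → cellIndex Z' v = cellIndex Z t := fun v h1 h2 =>
    (cellIndex_eq_of_between hcell h1.le h2.le).trans ((hg s).1.trans h)
  rcases lt_trichotomy (p.derivative.eval t) 0 with hneg | h0 | hpos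
  · have h1 := (eval_strictMonoOn_Icc (q := -p) (s := s) (t := t) (fun v h1 h2 => by
      have : p.derivative.eval v < 0 := by
        rw [← sign_eq_neg_one_iff, hd v (χ t) ((hg t).1.trans (hin v h1 h2).symm),
          ← hd t (χ t) (hg t).1, sign_neg hneg]
      simp only [derivative_neg, eval_neg]; linarith)) ⟨le_rfl, hst⟩ ⟨hst, le_rfl⟩ hst'
    have h2 := (eval_strictMonoOn_Icc (q := -p') (s := χ t) (t := χ s) (fun v h1 h2 => by
      have : p'.derivative.eval v < 0 := by
        rw [← sign_eq_neg_one_iff, ← hd t v (hin' v h1 h2), sign_neg hneg]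
      simp only [derivative_neg, eval_neg]; linarith)) ⟨le_rfl, h'.le⟩ ⟨h'.le, le_rfl⟩ h'
    simp only [eval_neg, neg_lt_neg_iff] at h1 h2
    have h3 := SignType.sign.monotone h1.le
    have h4 := SignType.sign.monotone h2.le
    rw [(hg s).2, (hg t).2] at h4
    exact h'.ne (hχe t s h.symm (le_antisymm h3 h4))
  · exact hst'.ne' (eq_of_cellIndex_eq h.symm (hdZ t h0))
  · have h1 := (eval_strictMonoOn_Icc (q := p) (s := s) (t := t) (fun v h1 h2 => by
      rw [← sign_eq_one_iff, hd v (χ t) ((hg t).1.trans (hin v h1 h2).symm),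
          ← hd t (χ t) (hg t).1, sign_pos hpos])) ⟨le_rfl, hst⟩ ⟨hst, le_rfl⟩ hst'
    have h2 := (eval_strictMonoOn_Icc (q := p') (s := χ t) (t := χ s) (fun v h1 h2 => by
      rw [← sign_eq_one_iff, ← hd t v (hin' v h1 h2), sign_pos hpos]))
      ⟨le_rfl, h'.le⟩ ⟨h'.le, le_rfl⟩ h'
    simp only at h1 h2
    have h3 := SignType.sign.monotone h1.le
    have h4 := SignType.sign.monotone h2.le
    rw [(hg s).2, (hg t).2] at h4
    exact h'.ne (hχe t s h.symm (le_antisymm h4 h3))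

lemma lt_of_monotone_of_mem_iff {Z Z' : Finset ℝ} {φ : ℝ → ℝ} (hφ : Monotone φ)
    (hmem : ∀ t, t ∈ Z ↔ φ t ∈ Z') {s t : ℝ} (hst : s < t) (h : s ∈ Z ∨ t ∈ Z) : φ s < φ t := by
  obtain ⟨u, hu, huZ⟩ := ((Ioo_infinite hst).sdiff Z.finite_toSet).nonempty
  have huZ' : φ u ∉ Z' := fun h => huZ ((hmem u).2 h)
  rcases h with h | h
  · have : φ s ≠ φ u := fun he => huZ' (he ▸ (hmem s).1 h)
    exact (lt_of_le_of_ne (hφ hu.1.le) this).trans_le (hφ hu.2.le)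
  · have : φ u ≠ φ t := fun he => huZ' (he ▸ (hmem t).1 h)
    exact (hφ hu.1.le).trans_lt (lt_of_le_of_ne (hφ hu.2.le) this)

lemma card_le_of_monotone_of_mem_iff {Z Z' : Finset ℝ} {φ : ℝ → ℝ} (hφ : Monotone φ)
    (hmem : ∀ t, t ∈ Z ↔ φ t ∈ Z') : Z.card ≤ Z'.card := by
  refine Finset.card_le_card_of_injOn φ (fun t ht => (hmem t).1 ht) fun s hs t ht hst => ?_
  by_contra hne
  rcases lt_or_gt_of_ne hne with h | h
  · exact (lt_of_monotone_of_mem_iff hφ hmem h (Or.inl hs)).ne hst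
  · exact (lt_of_monotone_of_mem_iff hφ hmem h (Or.inl ht)).ne hst.symm

lemma cellIndex_comp_eq {Z Z' : Finset ℝ} {φ ψ : ℝ → ℝ} (hφ : Monotone φ) (hψ : Monotone ψ)
    (hmem : ∀ t, t ∈ Z ↔ φ t ∈ Z') (hmem' : ∀ t, t ∈ Z' ↔ ψ t ∈ Z) :
    (∀ z' ∈ Z', ∃ z ∈ Z, φ z = z') ∧ ∀ t, cellIndex Z' (φ t) = cellIndex Z t := by
  classical
  have hinj : Set.InjOn φ Z := fun s hs t ht hst => by
    by_contra hne
    rcases lt_or_gt_of_ne hne with h | h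
    · exact (lt_of_monotone_of_mem_iff hφ hmem h (Or.inl hs)).ne hst
    · exact (lt_of_monotone_of_mem_iff hφ hmem h (Or.inl ht)).ne hst.symm
  have himg : Z.image φ = Z' := by
    refine Finset.eq_of_subset_of_card_le (fun z' hz' => ?_) ?_
    · obtain ⟨z, hz, rfl⟩ := Finset.mem_image.1 hz'
      exact (hmem z).1 hz
    · rw [Finset.card_image_of_injOn hinj]
      exact card_le_of_monotone_of_mem_iff hψ hmem'
  refine ⟨fun z' hz' => by rw [← himg] at hz'; simpa using hz', fun t => ?_⟩
  unfold cellIndex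
  rw [← himg, Finset.filter_image, Finset.filter_image,
    Finset.card_image_of_injOn (hinj.mono (Finset.coe_subset.2 (Finset.filter_subset _ _))),
    Finset.card_image_of_injOn (hinj.mono (Finset.coe_subset.2 (Finset.filter_subset _ _)))]
  congr 2
  · refine Finset.filter_congr fun z hz => ⟨fun h => ?_, fun h =>
      lt_of_monotone_of_mem_iff hφ hmem h (Or.inl hz)⟩
    by_contra h'
    exact absurd (hφ (not_lt.1 h')) (not_le.2 h)
  · refine Finset.filter_congr fun z hz => ⟨fun h => ?_, fun h => hφ h⟩
    by_contra h'
    exact absurd (lt_of_monotone_of_mem_iff hφ hmem (not_le.1 h') (Or.inr hz)) (not_lt.2 h)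

lemma sign_eq_of_cellIndex_eq {q : ℝ[X]} {Z : Finset ℝ} (hZ : ∀ t, q.eval t = 0 → t ∈ Z) {s t : ℝ}
    (h : cellIndex Z s = cellIndex Z t) :
    SignType.sign (q.eval s) = SignType.sign (q.eval t) := by
  rcases lt_trichotomy s t with hst | rfl | hst
  · exact sign_eval_eq_of_no_root hst.le fun u h1 h2 h0 =>
      (cellIndex_lt (hZ u h0) hst h1 h2).ne h
  · rfl
  · exact (sign_eval_eq_of_no_root hst.le fun u h1 h2 h0 =>
      (cellIndex_lt (hZ u h0) hst h1 h2).ne' h).symm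

lemma exists_monotone_refinement {ι : Type*} [Finite ι] {a b : ι → ℝ[X]} (ha : ∀ i, a i ≠ 0)
    (hb : ∀ i, b i ≠ 0) {p p' : ℝ[X]} {i₀ : ι} (hpa : a i₀ = p.derivative)
    (hpb : b i₀ = p'.derivative) {φ ψ : ℝ → ℝ} (hφ : Monotone φ) (hψ : Monotone ψ)
    (hab : ∀ i t, SignType.sign ((a i).eval t) = SignType.sign ((b i).eval (φ t)))
    (hba : ∀ i t, SignType.sign ((b i).eval t) = SignType.sign ((a i).eval (ψ t)))
    (hroot : ∀ i t, (a i).eval t = 0 →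
      SignType.sign (p.eval t) = SignType.sign (p'.eval (φ t))) :
    ∃ χ : ℝ → ℝ, Monotone χ ∧
      (∀ i t, SignType.sign ((a i).eval t) = SignType.sign ((b i).eval (χ t))) ∧
      ∀ t, SignType.sign (p.eval t) = SignType.sign (p'.eval (χ t)) := by
  classical
  have hfin : ∀ c : ι → ℝ[X], (∀ i, c i ≠ 0) →
      ∃ Z : Finset ℝ, ∀ t, t ∈ Z ↔ ∃ i, (c i).eval t = 0 := by
    intro c hc
    have : (⋃ i, {t | (c i).eval t = 0}).Finite := Set.finite_iUnion fun i => by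
      refine (c i).roots.toFinset.finite_toSet.subset fun t ht => ?_
      simpa [hc i] using ht
    exact ⟨this.toFinset, fun t => by simp⟩
  obtain ⟨Z, hZ⟩ := hfin a ha
  obtain ⟨Z', hZ'⟩ := hfin b hb
  have hmem : ∀ t, t ∈ Z ↔ φ t ∈ Z' := fun t => by
    rw [hZ, hZ']
    refine exists_congr fun i => ?_
    rw [← sign_eq_zero_iff, hab i t, sign_eq_zero_iff]
  have hmem' : ∀ t, t ∈ Z' ↔ ψ t ∈ Z := fun t => by
    rw [hZ, hZ']
    refine exists_congr fun i => ?_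
    rw [← sign_eq_zero_iff, hba i t, sign_eq_zero_iff]
  obtain ⟨hsurj, hidx⟩ := cellIndex_comp_eq hφ hψ hmem hmem'
  have hsign : ∀ i t t', cellIndex Z' t' = cellIndex Z t →
      SignType.sign ((a i).eval t) = SignType.sign ((b i).eval t') := fun i t t' h => by
    rw [hab i t]
    exact sign_eq_of_cellIndex_eq (fun u hu => (hZ' u).2 ⟨i, hu⟩) ((hidx t).trans h.symm)
  obtain ⟨χ, hχ, hχ'⟩ := exists_monotone_of_cellIndex_eq (p := p) (p' := p') hidx
    (fun t ht => (hmem t).1 ht) hsurj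
    (by rw [← hpa, ← hpb]; exact hsign i₀) (fun t ht => (hZ t).2 ⟨i₀, by rw [hpa, ht]⟩)
    (fun z hz => by obtain ⟨i, hi⟩ := (hZ z).1 hz; exact hroot i z hi)
  exact ⟨χ, hχ, fun i t => hsign i t _ (hχ' t).1, fun t => (hχ' t).2.symm⟩

lemma sign_eq_at_root {R : Type*} [CommRing R] {x y : R →+* ℝ} {p q r s : R[X]} {c : R}
    (hr : r = C c * p - s * q) (hx : x c ≠ 0) (hxy : SignType.sign (x c) = SignType.sign (y c))
    {t t' : ℝ} (hq : (q.map x).eval t = 0)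
    (hqq : SignType.sign ((q.map x).eval t) = SignType.sign ((q.map y).eval t'))
    (hrr : SignType.sign ((r.map x).eval t) = SignType.sign ((r.map y).eval t')) :
    SignType.sign ((p.map x).eval t) = SignType.sign ((p.map y).eval t') := by
  have hq' : (q.map y).eval t' = 0 := by
    rw [← sign_eq_zero_iff, ← hqq, sign_eq_zero_iff, hq]
  subst hr
  simp only [Polynomial.map_sub, Polynomial.map_mul, map_C, eval_sub, eval_mul, eval_C, hq, hq',
    mul_zero, sub_zero, sign_mul, ← hxy] at hrr
  have : SignType.sign (x c) ≠ 0 := by rwa [Ne, sign_eq_zero_iff]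
  exact mul_left_cancel₀ this hrr

lemma natDegree_sub_lt_of_cancel {R : Type*} [CommRing R] [IsDomain R] {p q : R[X]}
    (hp : 0 < p.natDegree) (hq : q ≠ 0) (hqp : q.natDegree ≤ p.natDegree) :
    (C q.leadingCoeff * p - C p.leadingCoeff * X ^ (p.natDegree - q.natDegree) * q).natDegree <
      p.natDegree := by
  have hp0 : p ≠ 0 := by rintro rfl; simp at hp
  have hlc : q.leadingCoeff ≠ 0 := leadingCoeff_ne_zero.2 hq
  have hlcp : p.leadingCoeff ≠ 0 := leadingCoeff_ne_zero.2 hp0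
  have hnd : (C q.leadingCoeff * p).natDegree = p.natDegree := natDegree_C_mul hlc
  have h1 : C q.leadingCoeff * p ≠ 0 := mul_ne_zero (C_ne_zero.2 hlc) hp0
  have h2 : C p.leadingCoeff * X ^ (p.natDegree - q.natDegree) * q ≠ 0 :=
    mul_ne_zero (mul_ne_zero (C_ne_zero.2 hlcp) (pow_ne_zero _ X_ne_zero)) hq
  have hdeg : (C q.leadingCoeff * p).degree =
      (C p.leadingCoeff * X ^ (p.natDegree - q.natDegree) * q).degree := by
    rw [degree_eq_natDegree h1, degree_eq_natDegree h2, hnd, natDegree_mul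
      (mul_ne_zero (C_ne_zero.2 hlcp) (pow_ne_zero _ X_ne_zero)) hq,
      natDegree_C_mul_X_pow _ _ hlcp, Nat.sub_add_cancel hqp]
  have hlt := degree_sub_lt_left hdeg h1 (by
    rw [leadingCoeff_mul, leadingCoeff_C, leadingCoeff_mul, leadingCoeff_C_mul_X_pow, mul_comm])
  set r := C q.leadingCoeff * p - C p.leadingCoeff * X ^ (p.natDegree - q.natDegree) * q
  by_cases hr : r = 0
  · rw [hr, natDegree_zero]; exact hp
  · rw [← hnd]; exact natDegree_lt_natDegree hr hlt

/-- `x` and `y` realise the sign patterns of the univariate polynomials of `L` in the same order: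
some monotone self-map of the line carries the signs at `x` to the signs at `y`. -/
def SignSimilar {R : Type*} [CommRing R] (L : Multiset R[X]) (x y : R →+* ℝ) : Prop :=
  ∃ φ : ℝ → ℝ, Monotone φ ∧ ∀ q ∈ L, ∀ t,
    SignType.sign ((q.map x).eval t) = SignType.sign ((q.map y).eval (φ t))

lemma SignSimilar.cons {R : Type*} [CommRing R] [IsDomain R] [CharZero R] {L : Multiset R[X]}
    {p : R[X]} {x y : R →+* ℝ} (hp : 0 < p.natDegree)
    (hdeg : ∀ q ∈ L, q.natDegree ≤ p.natDegree)
    (hpx : x p.leadingCoeff ≠ 0) (hpy : y p.leadingCoeff ≠ 0)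
    (hx : ∀ q ∈ L, x q.leadingCoeff ≠ 0)
    (hxy : ∀ q ∈ L, SignType.sign (x q.leadingCoeff) = SignType.sign (y q.leadingCoeff))
    {M : Multiset R[X]}
    (hM : M = derivative p ::ₘ (C (p.natDegree : R) * p - X * derivative p) ::ₘ
      (L + L.map fun q =>
        C q.leadingCoeff * p - C p.leadingCoeff * X ^ (p.natDegree - q.natDegree) * q))
    (h : SignSimilar M x y) (h' : SignSimilar M y x) : SignSimilar (p ::ₘ L) x y := by
  classical
  obtain ⟨φ, hφ, hφs⟩ := h
  obtain ⟨ψ, hψ, hψs⟩ := h'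
  have hy : ∀ q ∈ L, y q.leadingCoeff ≠ 0 := fun q hq => by
    rw [Ne, ← sign_eq_zero_iff, ← hxy q hq, sign_eq_zero_iff]; exact hx q hq
  let ι := {q : R[X] // q ∈ (derivative p ::ₘ L).toFinset}
  have hmapL : ∀ z : R →+* ℝ, z p.leadingCoeff ≠ 0 → (∀ q ∈ L, z q.leadingCoeff ≠ 0) →
      ∀ i : ι, i.1.map z ≠ 0 := by
    rintro z hz hzL ⟨q, hq⟩
    rw [Multiset.mem_toFinset, Multiset.mem_cons] at hq
    rcases hq with rfl | hq
    · intro h0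
      simp only [← derivative_map] at h0
      have := derivative_eq_zero.1 h0
      rw [natDegree_map_of_leadingCoeff_ne_zero _ hz] at this
      omega
    · intro h0
      have := congrArg (fun r => r.coeff q.natDegree) h0
      simp only [coeff_map, coeff_natDegree, coeff_zero] at this
      exact hzL q hq this
  have hιM : ∀ i : ι, i.1 ∈ M := by
    rintro ⟨q, hq⟩
    rw [Multiset.mem_toFinset, Multiset.mem_cons] at hq
    rw [hM]
    rcases hq with rfl | hq <;> simp [*]
  obtain ⟨χ, hχ, hχ1, hχ2⟩ := exists_monotone_refinement (ι := ι)
    (a := fun i => i.1.map x) (b := fun i => i.1.map y) (p := p.map x) (p' := p.map y)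
    (i₀ := ⟨derivative p, by simp⟩) (hmapL x hpx hx) (hmapL y hpy hy)
    (by simp [derivative_map]) (by simp [derivative_map]) hφ hψ
    (fun i t => hφs _ (hιM i) t) (fun i t => hψs _ (hιM i) t) (by
      rintro ⟨q, hq⟩ t h0
      have hqM := hφs _ (hιM ⟨q, hq⟩) t
      rw [Multiset.mem_toFinset, Multiset.mem_cons] at hq
      rcases hq with rfl | hq
      · refine sign_eq_at_root (c := (p.natDegree : R)) rfl ?_ ?_ h0 hqM (hφs
          (C (p.natDegree : R) * p - X * derivative p) (by rw [hM]; simp) t)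
        · rw [map_natCast x]; exact_mod_cast hp.ne'
        · rw [map_natCast x, map_natCast y]
      · refine sign_eq_at_root (c := q.leadingCoeff) rfl (hx q hq) (hxy q hq) h0 hqM (hφs
          (C q.leadingCoeff * p - C p.leadingCoeff * X ^ (p.natDegree - q.natDegree) * q)
          (by
            rw [hM]
            exact Multiset.mem_cons_of_mem (Multiset.mem_cons_of_mem (Multiset.mem_add.2
              (Or.inr (Multiset.mem_map_of_mem _ hq))))) t))
  refine ⟨χ, hχ, fun q hq t => ?_⟩
  rcases Multiset.mem_cons.1 hq with rfl | hq
  · exact hχ2 t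
  · exact hχ1 ⟨q, by simp [hq]⟩ t

theorem exists_finset_signSimilar {R : Type*} [CommRing R] [IsDomain R] [CharZero R]
    (L : Multiset R[X]) : ∃ F : Finset R, ∀ x y : R →+* ℝ,
      (∀ r ∈ F, SignType.sign (x r) = SignType.sign (y r)) → SignSimilar L x y := by
  classical
  induction L using (InvImage.wf (fun L : Multiset R[X] => L.map natDegree)
    (Multiset.wellFounded_isDershowitzMannaLT (α := ℕ))).induction with
  | _ L ih =>
  by_cases hconst : ∃ q ∈ L, q.natDegree = 0
  · obtain ⟨q, hq, hq0⟩ := hconst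
    obtain ⟨L, rfl⟩ := Multiset.exists_cons_of_mem hq
    obtain ⟨F, hF⟩ := ih L ⟨L.map natDegree, 0, {q.natDegree}, by simp, by simp,
      (Multiset.map_cons _ _ _).trans (by rw [add_comm, Multiset.singleton_add]), by simp⟩
    refine ⟨insert (q.coeff 0) F, fun x y hxy => ?_⟩
    obtain ⟨φ, hφ, hφs⟩ := hF x y fun r hr => hxy r (Finset.mem_insert_of_mem hr)
    refine ⟨φ, hφ, fun r hr t => ?_⟩
    rcases Multiset.mem_cons.1 hr with rfl | hr
    · have := hxy _ (Finset.mem_insert_self _ _)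
      rw [eq_C_of_natDegree_eq_zero hq0]
      simpa using this
    · exact hφs r hr t
  have hpos : ∀ q ∈ L, 0 < q.natDegree := fun q hq =>
    Nat.pos_of_ne_zero fun h => hconst ⟨q, hq, h⟩
  rcases eq_or_ne L 0 with rfl | hL
  · exact ⟨∅, fun x y _ => ⟨id, monotone_id, by simp⟩⟩
  obtain ⟨p, hpL, hpmax⟩ := Finset.exists_max_image L.toFinset natDegree
    (by simpa [Finset.nonempty_iff_ne_empty] using hL)
  have hpL' : p ∈ L := by simpa using hpL
  have herase : ∀ q : L.toFinset, ∃ F : Finset R, ∀ x y : R →+* ℝ,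
      (∀ r ∈ F, SignType.sign (x r) = SignType.sign (y r)) →
        SignSimilar (q.1.eraseLead ::ₘ L.erase q.1) x y := by
    rintro ⟨q, hq⟩
    have hq : q ∈ L := by simpa using hq
    refine ih _ ⟨(L.erase q).map natDegree, {q.eraseLead.natDegree}, {q.natDegree}, by simp,
      (Multiset.map_cons _ _ _).trans (by rw [add_comm, Multiset.singleton_add]), ?_, ?_⟩
    · rw [add_comm, Multiset.singleton_add, ← Multiset.map_cons, Multiset.cons_erase hq]
    · have := q.eraseLead_natDegree_le
      have := hpos q hq
      simp only [Multiset.mem_singleton, forall_eq, exists_eq_left]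
      omega
  choose G hG using herase
  obtain ⟨L, rfl⟩ := Multiset.exists_cons_of_mem hpL'
  have hdeg : ∀ q ∈ L, q.natDegree ≤ p.natDegree := fun q hq => hpmax q (by simp [hq])
  have hp := hpos p hpL'
  obtain ⟨F, hF⟩ := ih (derivative p ::ₘ (C (p.natDegree : R) * p - X * derivative p) ::ₘ
      (L + L.map fun q =>
        C q.leadingCoeff * p - C p.leadingCoeff * X ^ (p.natDegree - q.natDegree) * q))
    ⟨L.map natDegree, (derivative p).natDegree ::ₘ
      (C (p.natDegree : R) * p - X * derivative p).natDegree ::ₘ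
      (L.map fun q => C q.leadingCoeff * p -
        C p.leadingCoeff * X ^ (p.natDegree - q.natDegree) * q).map natDegree,
      {p.natDegree}, by simp, by simp,
      (Multiset.map_cons _ _ _).trans (by rw [add_comm, Multiset.singleton_add]), by
      have hder := natDegree_derivative_lt hp.ne'
      intro n hn
      simp only [Multiset.mem_singleton, exists_eq_left]
      rw [Multiset.mem_cons, Multiset.mem_cons] at hn
      rcases hn with rfl | rfl | hn
      · exact hder
      · have hp0 : derivative p ≠ 0 := fun h0 => by
          have := derivative_eq_zero.1 h0
          omega
        have h1 : (C (p.natDegree : R) * p).natDegree = p.natDegree :=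
          natDegree_C_mul (Nat.cast_ne_zero.2 hp.ne')
        refine lt_of_le_of_ne ((natDegree_sub_le_of_le h1.le ?_).trans (max_self _).le) fun heq => ?_
        · rw [natDegree_X_mul hp0]; omega
        · have h2 : (C (p.natDegree : R) * p - X * derivative p).coeff p.natDegree = 0 := by
            obtain ⟨k, hk⟩ := Nat.exists_eq_succ_of_ne_zero hp.ne'
            rw [coeff_sub, coeff_C_mul, hk, Nat.succ_eq_add_one, coeff_X_mul, coeff_derivative]
            push_cast
            ring
          have h3 := leadingCoeff_eq_zero.1
            ((congrArg (C (p.natDegree : R) * p - X * derivative p).coeff heq).trans h2)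
          rw [h3, natDegree_zero] at heq
          omega
      · rw [Multiset.map_map, Multiset.mem_map] at hn
        obtain ⟨q, hq, rfl⟩ := hn
        refine natDegree_sub_lt_of_cancel hp ?_ (hdeg q hq)
        rintro rfl
        exact absurd (hpos 0 (by simp [hq])) (by simp)⟩
  refine ⟨F ∪ (p ::ₘ L).toFinset.attach.biUnion G ∪ (p ::ₘ L).toFinset.image leadingCoeff,
    fun x y hxy => ?_⟩
  have hlc : ∀ q ∈ p ::ₘ L,
      SignType.sign (x q.leadingCoeff) = SignType.sign (y q.leadingCoeff) := fun q hq =>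
    hxy _ (Finset.mem_union_right _ (Finset.mem_image_of_mem _ (by simpa using hq)))
  by_cases hzero : ∃ q ∈ p ::ₘ L, x q.leadingCoeff = 0
  · obtain ⟨q, hq, hqx⟩ := hzero
    have hqy : y q.leadingCoeff = 0 := by
      rw [← sign_eq_zero_iff, ← hlc q hq, hqx, sign_zero]
    have hmap : ∀ z : R →+* ℝ, z q.leadingCoeff = 0 → q.map z = q.eraseLead.map z := by
      intro z hz
      have h := congrArg (Polynomial.map z) (eraseLead_add_C_mul_X_pow q)
      rw [Polynomial.map_add, Polynomial.map_mul, map_C, hz] at h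
      simpa using h.symm
    obtain ⟨φ, hφ, hφs⟩ := hG ⟨q, by simpa using hq⟩ x y fun r hr => hxy r
      (Finset.mem_union_left _ (Finset.mem_union_right _ (Finset.mem_biUnion.2
        ⟨_, Finset.mem_attach _ _, hr⟩)))
    refine ⟨φ, hφ, fun r hr t => ?_⟩
    rw [← Multiset.cons_erase hq, Multiset.mem_cons] at hr
    rcases hr with rfl | hr
    · rw [hmap x hqx, hmap y hqy]
      exact hφs _ (Multiset.mem_cons_self _ _) t
    · exact hφs _ (Multiset.mem_cons_of_mem hr) t
  · push Not at hzero
    have hy : y p.leadingCoeff ≠ 0 := by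
      rw [Ne, ← sign_eq_zero_iff, ← hlc p hpL', sign_eq_zero_iff]; exact hzero p hpL'
    exact SignSimilar.cons hp hdeg (hzero p hpL') hy
      (fun q hq => hzero q (Multiset.mem_cons_of_mem hq))
      (fun q hq => hlc q (Multiset.mem_cons_of_mem hq)) rfl
      (hF x y fun r hr => hxy r (Finset.mem_union_left _ (Finset.mem_union_left _ hr)))
      (hF y x fun r hr => (hxy r (Finset.mem_union_left _ (Finset.mem_union_left _ hr))).symm)

/-- `g` is a polynomial function on `ℝ^ι`. -/
def PolyFn {ι : Type*} (g : (ι → ℝ) → ℝ) : Prop :=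
  ∃ p : MvPolynomial ι ℝ, ∀ x, g x = MvPolynomial.eval x p

namespace PolyFn

variable {ι κ : Type*} {g h : (ι → ℝ) → ℝ}

lemma eval (p : MvPolynomial ι ℝ) : PolyFn fun x => MvPolynomial.eval x p := ⟨p, fun _ => rfl⟩

lemma const (c : ℝ) : PolyFn fun _ : ι → ℝ => c := ⟨MvPolynomial.C c, by simp⟩

lemma coord (i : ι) : PolyFn fun x : ι → ℝ => x i := ⟨MvPolynomial.X i, by simp⟩

lemma add (hg : PolyFn g) (hh : PolyFn h) : PolyFn fun x => g x + h x := by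
  obtain ⟨p, hp⟩ := hg
  obtain ⟨q, hq⟩ := hh
  exact ⟨p + q, by simp [hp, hq]⟩

lemma sub (hg : PolyFn g) (hh : PolyFn h) : PolyFn fun x => g x - h x := by
  obtain ⟨p, hp⟩ := hg
  obtain ⟨q, hq⟩ := hh
  exact ⟨p - q, by simp [hp, hq]⟩

lemma mul (hg : PolyFn g) (hh : PolyFn h) : PolyFn fun x => g x * h x := by
  obtain ⟨p, hp⟩ := hg
  obtain ⟨q, hq⟩ := hh
  exact ⟨p * q, by simp [hp, hq]⟩

lemma pow (hg : PolyFn g) (n : ℕ) : PolyFn fun x => g x ^ n := by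
  obtain ⟨p, hp⟩ := hg
  exact ⟨p ^ n, by simp [hp]⟩

lemma sum {α : Type*} (s : Finset α) {g : α → (ι → ℝ) → ℝ} (hg : ∀ a ∈ s, PolyFn (g a)) :
    PolyFn fun x => ∑ a ∈ s, g a x := by
  classical
  induction s using Finset.induction_on with
  | empty => simpa using const 0
  | insert a s ha ih =>
    simp only [Finset.sum_insert ha]
    exact (hg a (by simp)).add (ih fun b hb => hg b (by simp [hb]))

lemma prod {α : Type*} (s : Finset α) {g : α → (ι → ℝ) → ℝ} (hg : ∀ a ∈ s, PolyFn (g a)) :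
    PolyFn fun x => ∏ a ∈ s, g a x := by
  classical
  induction s using Finset.induction_on with
  | empty => simpa using const 1
  | insert a s ha ih =>
    simp only [Finset.prod_insert ha]
    exact (hg a (by simp)).mul (ih fun b hb => hg b (by simp [hb]))

lemma comp (hg : PolyFn g) {φ : ι → (κ → ℝ) → ℝ} (hφ : ∀ i, PolyFn (φ i)) :
    PolyFn fun x => g fun i => φ i x := by
  obtain ⟨p, hp⟩ := hg
  choose q hq using hφ
  refine ⟨MvPolynomial.bind₁ q p, fun x => ?_⟩
  show g (fun i => φ i x) = _
  rw [hp, ← MvPolynomial.coe_aeval_eq_eval, ← MvPolynomial.coe_aeval_eq_eval]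
  simp only [RingHom.coe_coe, MvPolynomial.aeval_bind₁]
  congr 2
  funext i
  rw [hq, ← MvPolynomial.coe_aeval_eq_eval]
  rfl

lemma continuous (hg : PolyFn g) : Continuous g := by
  obtain ⟨p, hp⟩ := hg
  rw [show g = fun x => MvPolynomial.eval x p from funext hp]
  exact MvPolynomial.continuous_eval p

end PolyFn

/-- Membership in `S` is determined by the signs of finitely many polynomials. -/
def SignDet {ι : Type*} (S : Set (ι → ℝ)) : Prop :=
  ∃ F : Finset (MvPolynomial ι ℝ), ∀ x y : ι → ℝ,
    (∀ r ∈ F, SignType.sign (MvPolynomial.eval x r) = SignType.sign (MvPolynomial.eval y r)) →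
      x ∈ S → y ∈ S

namespace SignDet

variable {ι κ : Type*} {S T : Set (ι → ℝ)}

lemma compl (hS : SignDet S) : SignDet Sᶜ := by
  obtain ⟨F, hF⟩ := hS
  exact ⟨F, fun x y h hx hy => hx (hF y x (fun r hr => (h r hr).symm) hy)⟩

lemma inter (hS : SignDet S) (hT : SignDet T) : SignDet (S ∩ T) := by
  classical
  obtain ⟨F, hF⟩ := hS
  obtain ⟨G, hG⟩ := hT
  exact ⟨F ∪ G, fun x y h hx => ⟨hF x y (fun r hr => h r (Finset.mem_union_left _ hr)) hx.1,
    hG x y (fun r hr => h r (Finset.mem_union_right _ hr)) hx.2⟩⟩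

lemma iInter {α : Type*} [Finite α] {S : α → Set (ι → ℝ)} (hS : ∀ a, SignDet (S a)) :
    SignDet (⋂ a, S a) := by
  classical
  cases nonempty_fintype α
  choose F hF using hS
  refine ⟨Finset.univ.biUnion F, fun x y h hx => mem_iInter.2 fun a => hF a x y (fun r hr => h r
    (Finset.mem_biUnion.2 ⟨a, Finset.mem_univ _, hr⟩)) (mem_iInter.1 hx a)⟩

lemma iUnion {α : Type*} [Finite α] {S : α → Set (ι → ℝ)} (hS : ∀ a, SignDet (S a)) :
    SignDet (⋃ a, S a) := by
  rw [← compl_compl (⋃ a, S a), compl_iUnion]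
  exact (iInter fun a => (hS a).compl).compl

lemma union (hS : SignDet S) (hT : SignDet T) : SignDet (S ∪ T) := by
  rw [← compl_compl (S ∪ T), compl_union]
  exact (hS.compl.inter hT.compl).compl

lemma of_sign {g : (ι → ℝ) → ℝ} (hg : PolyFn g) (p : SignType → Prop) :
    SignDet {x | p (SignType.sign (g x))} := by
  obtain ⟨q, hq⟩ := hg
  refine ⟨{q}, fun x y h hx => ?_⟩
  have := h q (Finset.mem_singleton_self _)
  simp only [mem_ofPred_eq, hq] at hx ⊢
  rwa [← this]

lemma le {g h : (ι → ℝ) → ℝ} (hg : PolyFn g) (hh : PolyFn h) : SignDet {x | g x ≤ h x} := by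
  have := of_sign (hh.sub hg) fun s => 0 ≤ s
  simpa [sign_nonneg_iff] using this

lemma pos {g : (ι → ℝ) → ℝ} (hg : PolyFn g) : SignDet {x | 0 < g x} := by
  have := of_sign hg fun s => s = 1
  simpa [sign_eq_one_iff] using this

lemma eq_zero {g : (ι → ℝ) → ℝ} (hg : PolyFn g) : SignDet {x | g x = 0} := by
  have := of_sign hg fun s => s = 0
  simpa [sign_eq_zero_iff] using this

lemma comap (hS : SignDet S) {φ : ι → (κ → ℝ) → ℝ} (hφ : ∀ i, PolyFn (φ i)) :
    SignDet {x : κ → ℝ | (fun i => φ i x) ∈ S} := by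
  classical
  obtain ⟨F, hF⟩ := hS
  choose q hq using fun r : MvPolynomial ι ℝ => (PolyFn.eval r).comp hφ
  have hq' : ∀ r x, MvPolynomial.eval (fun i => φ i x) r = MvPolynomial.eval x (q r) := hq
  refine ⟨F.image q, fun x y h hx => hF _ _ (fun r hr => ?_) hx⟩
  rw [hq', hq']
  exact h _ (Finset.mem_image_of_mem _ hr)

lemma exists_polynomial_repr (p : MvPolynomial (Option ι) ℝ) :
    ∃ q : Polynomial (MvPolynomial ι ℝ), ∀ (x : ι → ℝ) (t : ℝ),
      MvPolynomial.eval (fun o : Option ι => o.elim t x) p =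
        (q.map (MvPolynomial.eval x)).eval t := by
  induction p using MvPolynomial.induction_on with
  | C a => exact ⟨Polynomial.C (MvPolynomial.C a), by simp⟩
  | add p q hp hq =>
    obtain ⟨p', hp⟩ := hp
    obtain ⟨q', hq⟩ := hq
    exact ⟨p' + q', by simp [hp, hq]⟩
  | mul_X p o hp =>
    obtain ⟨p', hp⟩ := hp
    cases o with
    | none => exact ⟨p' * Polynomial.X, by simp [hp]⟩
    | some i => exact ⟨p' * Polynomial.C (MvPolynomial.X i), by simp [hp]⟩

/-- The projection of a sign-determined set along one coordinate is sign-determined. -/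
lemma exists_option {S : Set (Option ι → ℝ)} (hS : SignDet S) :
    SignDet {x : ι → ℝ | ∃ t : ℝ, (fun o : Option ι => o.elim t x) ∈ S} := by
  obtain ⟨F, hF⟩ := hS
  choose q hq using exists_polynomial_repr (ι := ι)
  obtain ⟨G, hG⟩ := exists_finset_signSimilar (F.val.map q)
  refine ⟨G, fun x y h => ?_⟩
  rintro ⟨t, ht⟩
  obtain ⟨φ, -, hφ⟩ := hG (MvPolynomial.eval x) (MvPolynomial.eval y) h
  refine ⟨φ t, hF _ _ (fun r hr => ?_) ht⟩
  rw [hq, hq]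
  exact hφ _ (Multiset.mem_map_of_mem _ hr) t

/-- **Tarski–Seidenberg**: the projection of a sign-determined set is sign-determined. -/
lemma exists_sum {ι κ : Type} [Finite κ] {S : Set (ι ⊕ κ → ℝ)} (hS : SignDet S) :
    SignDet {x : ι → ℝ | ∃ w : κ → ℝ, Sum.elim x w ∈ S} := by
  suffices h : ∀ S : Set (ι ⊕ κ → ℝ), SignDet S →
      SignDet {x : ι → ℝ | ∃ w : κ → ℝ, Sum.elim x w ∈ S} from h S hS
  refine Finite.induction_empty_option (P := fun κ : Type => ∀ S : Set (ι ⊕ κ → ℝ), SignDet S →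
    SignDet {x : ι → ℝ | ∃ w : κ → ℝ, Sum.elim x w ∈ S}) ?_ ?_ ?_ κ
  · intro α β e ih S hS
    have := ih _ (hS.comap (κ := ι ⊕ α) (φ := fun s x => x (Sum.map id e.symm s))
      fun i => PolyFn.coord _)
    convert this using 4 with x
    constructor
    · rintro ⟨w, hw⟩
      refine ⟨w ∘ e, ?_⟩
      simp only [mem_ofPred_eq]
      convert hw using 1
      funext s
      cases s <;> simp
    · rintro ⟨w, hw⟩
      refine ⟨w ∘ e.symm, ?_⟩
      simp only [mem_ofPred_eq] at hw
      convert hw using 1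
      funext s
      cases s <;> simp
  · intro S hS
    have := hS.comap (κ := ι) (φ := fun s x => Sum.elim x PEmpty.elim s) (by
      rintro (i | i)
      · exact PolyFn.coord i
      · exact i.elim)
    convert this using 3 with x
    constructor
    · rintro ⟨w, hw⟩
      convert hw using 1
      funext s
      rcases s with i | i
      · rfl
      · exact i.elim
    · exact fun h => ⟨_, h⟩
  · intro α _ ih S hS
    have h1 := (hS.comap (κ := Option (ι ⊕ α))
      (φ := fun s x => Sum.elim (fun i => x (some (Sum.inl i)))
        (fun o : Option α => o.elim (x none) fun a => x (some (Sum.inr a))) s) (by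
      rintro (i | _ | a) <;> exact PolyFn.coord _)).exists_option
    have h2 := ih _ h1
    convert h2 using 3 with x
    constructor
    · rintro ⟨w, hw⟩
      refine ⟨fun a => w (some a), w none, ?_⟩
      simp only [mem_ofPred_eq]
      convert hw using 1
      funext s
      rcases s with i | _ | a <;> rfl
    · rintro ⟨w, t, hw⟩
      refine ⟨fun o => o.elim t w, ?_⟩
      simp only [mem_ofPred_eq] at hw
      convert hw using 1
      funext s
      rcases s with i | _ | a <;> rfl

lemma of_isSemialgebraic {ι : Type} [Fintype ι] {S : Set (ι → ℝ)} (hS : IsSemialgebraic S) :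
    SignDet S := by
  obtain ⟨N, T, hT, rfl⟩ := hS
  refine iUnion fun i => ?_
  obtain ⟨p, k, q, hpq⟩ := hT i
  rw [hpq, ofPred_and, ofPred_forall]
  exact (eq_zero (PolyFn.eval p)).inter (iInter fun j => pos (PolyFn.eval (q j)))

end SignDet

lemma exists_abs_eval_le (p : ℝ[X]) : ∃ C k, 0 ≤ C ∧ ∀ R : ℝ, 1 ≤ R → |p.eval R| ≤ C * R ^ k := by
  refine ⟨∑ i ∈ Finset.range (p.natDegree + 1), |p.coeff i|, p.natDegree,
    Finset.sum_nonneg fun _ _ => abs_nonneg _, fun R hR => ?_⟩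
  rw [eval_eq_sum_range, Finset.sum_mul]
  refine (Finset.abs_sum_le_sum_abs _ _).trans (Finset.sum_le_sum fun i hi => ?_)
  rw [abs_mul, abs_of_nonneg (pow_nonneg (zero_le_one.trans hR) i)]
  have : i ≤ p.natDegree := by simpa [Nat.lt_succ_iff] using hi
  gcongr

lemma exists_le_abs_eval {p : ℝ[X]} (hp : p ≠ 0) :
    ∃ c R₀, 0 < c ∧ ∀ R : ℝ, R₀ ≤ R → c ≤ |p.eval R| := by
  rcases le_or_gt p.degree 0 with h | h
  · rw [eq_C_of_degree_le_zero h] at hp ⊢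
    exact ⟨|p.coeff 0|, 0, by simpa using hp, by simp⟩
  · obtain ⟨R₀, hR₀⟩ := eventually_atTop.1 ((p.abs_tendsto_atTop h).eventually_ge_atTop 1)
    exact ⟨1, R₀, one_pos, hR₀⟩

lemma mul_pow_le_mul_pow {C C' R : ℝ} {k k' : ℕ} (hC : C ≤ C') (hC' : 0 ≤ C') (hk : k ≤ k')
    (hR : 1 ≤ R) : C * R ^ k ≤ C' * R ^ k' := by
  have := pow_le_pow_right₀ hR hk
  gcongr

/-- The coefficients of a bivariate polynomial are jointly polynomially bounded. -/
lemma exists_abs_coeff_le (q : ℝ[X][X]) :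
    ∃ C k, 0 ≤ C ∧ ∀ R : ℝ, 1 ≤ R → ∀ i, |(q.coeff i).eval R| ≤ C * R ^ k := by
  choose C k hC h using exists_abs_eval_le
  have hs : 0 ≤ ∑ i ∈ q.support, C (q.coeff i) := Finset.sum_nonneg fun _ _ => hC _
  refine ⟨∑ i ∈ q.support, C (q.coeff i), ∑ i ∈ q.support, k (q.coeff i), hs, fun R hR i => ?_⟩
  by_cases hi : i ∈ q.support
  · exact (h _ R hR).trans (mul_pow_le_mul_pow
      (Finset.single_le_sum (f := fun i => C (q.coeff i)) (fun _ _ => hC _) hi) hs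
      (Finset.single_le_sum (f := fun i => k (q.coeff i)) (fun _ _ => Nat.zero_le _) hi) hR)
  · rw [notMem_support_iff.1 hi, eval_zero, abs_zero]
    positivity

/-- The roots of a parametrized real polynomial grow at most polynomially in the parameter. -/
lemma exists_root_bound {q : ℝ[X][X]} (hq : q ≠ 0) :
    ∃ C k R₀, ∀ R : ℝ, 1 ≤ R → R₀ ≤ R → ∀ t, C * R ^ k < t →
      (q.map (evalRingHom R)).eval t ≠ 0 := by
  obtain ⟨c, R₀, hc, hlead⟩ := exists_le_abs_eval (leadingCoeff_ne_zero.2 hq)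
  obtain ⟨C, k, hC, hcoeff⟩ := exists_abs_coeff_le q
  refine ⟨C / c + 1, k, R₀, fun R hR hR₀ t ht h0 => ?_⟩
  have hne : evalRingHom R q.leadingCoeff ≠ 0 := by
    rw [coe_evalRingHom, ← abs_pos]
    exact hc.trans_le (hlead R hR₀)
  have hp : q.map (evalRingHom R) ≠ 0 := by
    intro h
    apply hne
    rw [← leadingCoeff_map_of_leadingCoeff_ne_zero _ hne, h, leadingCoeff_zero]
  have hlt : |t| < (cauchyBound (q.map (evalRingHom R)) : ℝ) := by
    simpa using NNReal.coe_lt_coe.2 (IsRoot.norm_lt_cauchyBound hp h0)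
  have hsup : (((Finset.range (q.map (evalRingHom R)).natDegree).sup
      (‖(q.map (evalRingHom R)).coeff ·‖₊) : NNReal) : ℝ) ≤ C * R ^ k := by
    have h1 : 0 ≤ C * R ^ k := by positivity
    rw [← Real.coe_toNNReal _ h1, NNReal.coe_le_coe]
    refine Finset.sup_le fun i _ => ?_
    rw [← NNReal.coe_le_coe, Real.coe_toNNReal _ h1]
    simpa using hcoeff R hR i
  rw [cauchyBound, leadingCoeff_map_of_leadingCoeff_ne_zero _ hne] at hlt
  push_cast at hlt
  rw [coe_evalRingHom, Real.norm_eq_abs] at hlt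
  have h1 : (1 : ℝ) ≤ R ^ k := one_le_pow₀ hR
  have h2 := div_le_div₀ (by positivity) hsup hc (hlead R hR₀)
  have h3 : C * R ^ k / c = C / c * R ^ k := by ring
  linarith [le_abs_self t]

lemma exists_sign_const_bound (q : ℝ[X][X]) :
    ∃ C k R₀, ∀ R : ℝ, 1 ≤ R → R₀ ≤ R → ∀ s t, C * R ^ k < s → s ≤ t →
      SignType.sign ((q.map (evalRingHom R)).eval s) =
        SignType.sign ((q.map (evalRingHom R)).eval t) := by
  rcases eq_or_ne q 0 with rfl | hq
  · exact ⟨0, 0, 0, by simp⟩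
  · obtain ⟨C, k, R₀, h⟩ := exists_root_bound hq
    exact ⟨C, k, R₀, fun R hR hR₀ s t hs hst => sign_eval_eq_of_no_root hst
      fun u hu _ => h R hR hR₀ u (hs.trans_le hu)⟩

lemma exists_bivariate_repr (p : MvPolynomial (Fin 2) ℝ) :
    ∃ q : ℝ[X][X], ∀ R t : ℝ,
      MvPolynomial.eval ![R, t] p = (q.map (evalRingHom R)).eval t := by
  induction p using MvPolynomial.induction_on with
  | C a => exact ⟨C (C a), by simp⟩
  | add p q hp hq =>
    obtain ⟨p', hp⟩ := hp
    obtain ⟨q', hq⟩ := hq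
    exact ⟨p' + q', by simp [hp, hq]⟩
  | mul_X p i hp =>
    obtain ⟨p', hp⟩ := hp
    fin_cases i
    · exact ⟨p' * C X, by simp [hp]⟩
    · exact ⟨p' * X, by simp [hp]⟩

lemma exists_sign_const_bound_finset (F : Finset (MvPolynomial (Fin 2) ℝ)) :
    ∃ C k R₀, ∀ R : ℝ, 1 ≤ R → R₀ ≤ R → ∀ s t, C * R ^ k < s → s ≤ t → ∀ r ∈ F,
      SignType.sign (MvPolynomial.eval ![R, s] r) =
        SignType.sign (MvPolynomial.eval ![R, t] r) := by
  classical
  induction F using Finset.induction_on with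
  | empty => exact ⟨0, 0, 0, by simp⟩
  | insert r F _ ih =>
    obtain ⟨C, k, R₀, h⟩ := ih
    obtain ⟨q, hq⟩ := exists_bivariate_repr r
    obtain ⟨C', k', R₀', h'⟩ := exists_sign_const_bound q
    refine ⟨max 0 (max C C'), max k k', max R₀ R₀', fun R hR hR₀ s t hs hst r' hr' => ?_⟩
    have h0 : 0 ≤ max 0 (max C C') := le_max_left _ _
    rcases Finset.mem_insert.1 hr' with rfl | hr'
    · rw [hq, hq]
      exact h' R hR ((le_max_right _ _).trans hR₀) s t ((mul_pow_le_mul_pow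
        ((le_max_right _ _).trans (le_max_right _ _)) h0 (le_max_right _ _) hR).trans_lt hs) hst
    · exact h R hR ((le_max_left _ _).trans hR₀) s t ((mul_pow_le_mul_pow
        ((le_max_left _ _).trans (le_max_right _ _)) h0 (le_max_left _ _) hR).trans_lt hs) hst r' hr'

/-- A semialgebraic family of upper bounded subsets of the line that increases with the parameter
is bounded above by a power of the parameter. -/
theorem exists_growth_bound {D : ℝ → ℝ → Prop} (hD : SignDet {v : Fin 2 → ℝ | D (v 0) (v 1)})
    (hmono : ∀ R R' t, R ≤ R' → D R t → D R' t) (hbdd : ∀ R, ∃ K, ∀ t, D R t → t ≤ K) :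
    ∃ C k, 0 < C ∧ ∀ R t : ℝ, 1 ≤ R → D R t → t ≤ C * R ^ k := by
  obtain ⟨F, hF⟩ := hD
  obtain ⟨C, k, R₀, h⟩ := exists_sign_const_bound_finset F
  have key : ∀ R t, 1 ≤ R → R₀ ≤ R → D R t → t ≤ C * R ^ k := by
    intro R t hR hR₀ ht
    by_contra! hlt
    obtain ⟨K, hK⟩ := hbdd R
    have := hF ![R, t] ![R, max t (K + 1)]
      (h R hR hR₀ t _ hlt (le_max_left _ _)) (by simpa using ht)
    have := hK _ (show D R (max t (K + 1)) by simpa using this)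
    linarith [le_max_right t (K + 1)]
  obtain ⟨K, hK⟩ := hbdd R₀
  have h0 : 0 < max 1 (max C K) := one_pos.trans_le (le_max_left _ _)
  refine ⟨max 1 (max C K), k, h0, fun R t hR ht => ?_⟩
  rcases le_total R₀ R with hle | hle
  · exact (key R t hR hle ht).trans (mul_pow_le_mul_pow
      ((le_max_left _ _).trans (le_max_right _ _)) h0.le le_rfl hR)
  · refine (hK t (hmono R R₀ t hle ht)).trans ?_
    simpa using mul_pow_le_mul_pow (k := 0) (k' := k)
      ((le_max_right _ _).trans (le_max_right _ _) : K ≤ max 1 (max C K)) h0.le (Nat.zero_le k) hR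

section Separation

variable {κ : Type} [Fintype κ]

lemma isCompact_inter_sum_sq_le {H : Set (κ → ℝ)} (hH : IsClosed H) (R : ℝ) :
    IsCompact {z | z ∈ H ∧ ∑ i, z i ^ 2 ≤ R} := by
  have hsub : {z : κ → ℝ | z ∈ H ∧ ∑ i, z i ^ 2 ≤ R} ⊆ Metric.closedBall 0 (1 + R) := by
    rintro z ⟨-, hz⟩
    have hR : 0 ≤ R := (Finset.sum_nonneg fun i _ => sq_nonneg (z i)).trans hz
    rw [mem_closedBall_zero_iff, pi_norm_le_iff_of_nonneg (by linarith)]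
    intro i
    have h1 : z i ^ 2 ≤ R :=
      (Finset.single_le_sum (f := fun i => z i ^ 2) (fun i _ => sq_nonneg (z i))
        (Finset.mem_univ i)).trans hz
    rw [Real.norm_eq_abs]
    exact abs_le_of_sq_le_sq (by nlinarith) (by linarith)
  refine (isCompact_closedBall 0 (1 + R)).of_isClosed_subset (hH.inter ?_) hsub
  exact isClosed_le (continuous_finsetSum _ fun i _ => (continuous_apply i).pow 2) continuous_const

/-- A Łojasiewicz-type separation: a closed semialgebraic set `H` disjoint from the set where `p`
vanishes and all `q ∈ Q` are positive is avoided by finitely many polynomial inequalities that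
hold on that set. -/
lemma exists_separating_finset {H : Set (κ → ℝ)} (hH : IsClosed H) (hS : SignDet H)
    (p : MvPolynomial κ ℝ) (Q : Finset (MvPolynomial κ ℝ))
    (hdisj : ∀ z ∈ H, (∀ q ∈ Q, 0 < MvPolynomial.eval z q) → MvPolynomial.eval z p ≠ 0) :
    ∃ G : Finset (MvPolynomial κ ℝ), (∀ z ∈ H, ∃ g ∈ G, MvPolynomial.eval z g ≤ 0) ∧
      ∀ z, MvPolynomial.eval z p = 0 → (∀ q ∈ Q, 0 < MvPolynomial.eval z q) →
        ∀ g ∈ G, 0 < MvPolynomial.eval z g := by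
  classical
  set π : MvPolynomial κ ℝ := ∏ q ∈ Q, q with hπ
  have hπe : ∀ z, MvPolynomial.eval z π = ∏ q ∈ Q, MvPolynomial.eval z q := fun z => by
    rw [hπ, map_prod]
  let D : ℝ → ℝ → Prop := fun R t => ∃ z : κ → ℝ, (z ∈ H ∧ ∑ i, z i ^ 2 ≤ R) ∧
    (∀ q : Q, 0 ≤ MvPolynomial.eval z q.1) ∧ 1 ≤ R * MvPolynomial.eval z π ∧
      t * MvPolynomial.eval z p ^ 2 ≤ 1
  have hπ0 : ∀ z, (∀ q : Q, 0 ≤ MvPolynomial.eval z q.1) → 0 ≤ MvPolynomial.eval z π :=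
    fun z hz => (hπe z).symm ▸ Finset.prod_nonneg fun q hq => hz ⟨q, hq⟩
  have hD : SignDet {v : Fin 2 → ℝ | D (v 0) (v 1)} := by
    have hev : ∀ r : MvPolynomial κ ℝ,
        PolyFn fun u : Fin 2 ⊕ κ → ℝ => MvPolynomial.eval (fun i => u (Sum.inr i)) r :=
      fun r => (PolyFn.eval r).comp fun i => PolyFn.coord _
    have h1 := hS.comap (κ := Fin 2 ⊕ κ) (φ := fun i u => u (Sum.inr i)) fun i => PolyFn.coord _
    have h2 := SignDet.le (ι := Fin 2 ⊕ κ)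
      (PolyFn.sum Finset.univ (g := fun i u => u (Sum.inr i) ^ 2) fun i _ => (PolyFn.coord _).pow 2)
      (PolyFn.coord (Sum.inl 0))
    have h3 := SignDet.iInter fun q : Q => SignDet.le (PolyFn.const 0) (hev q.1)
    have h4 := SignDet.le (PolyFn.const 1) ((PolyFn.coord (Sum.inl 0)).mul (hev π))
    have h5 := SignDet.le ((PolyFn.coord (Sum.inl 1)).mul ((hev p).pow 2)) (PolyFn.const 1)
    have h := ((h1.inter h2).inter (h3.inter (h4.inter h5))).exists_sum
    simpa only [mem_inter_iff, mem_iInter, mem_ofPred_eq, Sum.elim_inl, Sum.elim_inr] using h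
  have hmono : ∀ R R' t, R ≤ R' → D R t → D R' t := by
    rintro R R' t hR ⟨z, ⟨h1, h2⟩, h3, h4, h5⟩
    exact ⟨z, ⟨h1, h2.trans hR⟩, h3, h4.trans (mul_le_mul_of_nonneg_right hR (hπ0 z h3)), h5⟩
  have hbdd : ∀ R, ∃ K, ∀ t, D R t → t ≤ K := by
    intro R
    set S : Set (κ → ℝ) := {z | z ∈ H ∧ ∑ i, z i ^ 2 ≤ R} ∩
      ((⋂ q : Q, {z | 0 ≤ MvPolynomial.eval z q.1}) ∩ {z | 1 ≤ R * MvPolynomial.eval z π}) with hSd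
    have hc : ∀ r : MvPolynomial κ ℝ, Continuous fun z : κ → ℝ => MvPolynomial.eval z r :=
      fun r => MvPolynomial.continuous_eval r
    have hcomp : IsCompact S := (isCompact_inter_sum_sq_le hH R).inter_right
      ((isClosed_iInter fun q => isClosed_le continuous_const (hc _)).inter
        (isClosed_le continuous_const (continuous_const.mul (hc _))))
    rcases S.eq_empty_or_nonempty with he | hne
    · refine ⟨0, fun t ⟨z, h1, h3, h4, h5⟩ => ?_⟩
      have : z ∈ S := ⟨h1, mem_iInter.2 h3, h4⟩
      simp [he] at this
    · obtain ⟨z₀, hz₀, hmin⟩ := hcomp.exists_isMinOn hne ((hc p).pow 2).continuousOn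
      have hpos : 0 < MvPolynomial.eval z₀ p ^ 2 := by
        obtain ⟨⟨h1, -⟩, h3, h4⟩ := hz₀
        refine sq_pos_of_ne_zero (hdisj z₀ h1 fun q hq => ?_)
        refine lt_of_le_of_ne (mem_iInter.1 h3 ⟨q, hq⟩) fun h0 => ?_
        have h4' : (1 : ℝ) ≤ R * MvPolynomial.eval z₀ π := h4
        rw [hπe, Finset.prod_eq_zero hq h0.symm] at h4'
        linarith
      refine ⟨1 / MvPolynomial.eval z₀ p ^ 2, fun t ⟨z, h1, h3, h4, h5⟩ => ?_⟩
      have hle : MvPolynomial.eval z₀ p ^ 2 ≤ MvPolynomial.eval z p ^ 2 :=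
        hmin (⟨h1, mem_iInter.2 h3, h4⟩ : z ∈ S)
      rw [le_div_iff₀ hpos]
      rcases le_total t 0 with ht | ht
      · nlinarith
      · exact (mul_le_mul_of_nonneg_left hle ht).trans h5
  obtain ⟨C, k, hC, hgrow⟩ := exists_growth_bound hD hmono hbdd
  set h : MvPolynomial κ ℝ := π ^ k - MvPolynomial.C C *
    ((1 + ∑ i, MvPolynomial.X i ^ 2) * π + 1) ^ k * p ^ 2 with hh
  have hhe : ∀ z, MvPolynomial.eval z h = MvPolynomial.eval z π ^ k -
      C * ((1 + ∑ i, z i ^ 2) * MvPolynomial.eval z π + 1) ^ k * MvPolynomial.eval z p ^ 2 := by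
    intro z
    simp [hh]
  refine ⟨insert h Q, fun z hz => ?_, fun z hp hq g hg => ?_⟩
  · by_cases hq : ∀ q ∈ Q, 0 < MvPolynomial.eval z q
    · refine ⟨h, Finset.mem_insert_self _ _, ?_⟩
      have hpi : 0 < MvPolynomial.eval z π := (hπe z).symm ▸ Finset.prod_pos hq
      have hp2 : 0 < MvPolynomial.eval z p ^ 2 := sq_pos_of_ne_zero (hdisj z hz hq)
      have hs : 0 ≤ ∑ i, z i ^ 2 := Finset.sum_nonneg fun i _ => sq_nonneg (z i)
      set R : ℝ := 1 + ∑ i, z i ^ 2 + 1 / MvPolynomial.eval z π with hR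
      have hi : 0 < 1 / MvPolynomial.eval z π := by positivity
      have hRπ : R * MvPolynomial.eval z π = (1 + ∑ i, z i ^ 2) * MvPolynomial.eval z π + 1 := by
        rw [hR]
        field_simp
      have := hgrow R (1 / MvPolynomial.eval z p ^ 2) (by linarith)
        ⟨z, ⟨hz, by linarith⟩, fun q => (hq q.1 q.2).le, by rw [hRπ]; nlinarith,
          (one_div_mul_cancel hp2.ne').le⟩
      rw [div_le_iff₀ hp2] at this
      rw [hhe, ← hRπ, mul_pow, sub_nonpos]
      have := mul_le_mul_of_nonneg_right this (pow_nonneg hpi.le k)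
      linarith
    · push Not at hq
      obtain ⟨q, hq, hle⟩ := hq
      exact ⟨q, Finset.mem_insert_of_mem hq, hle⟩
  · rcases Finset.mem_insert.1 hg with rfl | hg
    · rw [hhe, hp]
      have hpi : 0 < MvPolynomial.eval z π := (hπe z).symm ▸ Finset.prod_pos hq
      have := pow_pos hpi k
      simpa using this
    · exact hq g hg

/-- **Finiteness theorem**: a closed semialgebraic set is a finite intersection of finite unions
of sets defined by weak polynomial inequalities. -/
theorem exists_closed_description {H : Set (κ → ℝ)} (hH : IsClosed H) (hS : SignDet H) :
    ∃ (N : ℕ) (G : Fin N → Finset (MvPolynomial κ ℝ)),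
      ∀ z, z ∈ H ↔ ∀ i, ∃ g ∈ G i, MvPolynomial.eval z g ≤ 0 := by
  classical
  have ⟨F, hF⟩ := hS
  let sg : (κ → ℝ) → F → SignType := fun z r => SignType.sign (MvPolynomial.eval z r.1)
  have key : ∀ z₀, z₀ ∉ H → ∃ G : Finset (MvPolynomial κ ℝ),
      (∀ z ∈ H, ∃ g ∈ G, MvPolynomial.eval z g ≤ 0) ∧
        ∀ z, sg z = sg z₀ → ∀ g ∈ G, 0 < MvPolynomial.eval z g := by
    intro z₀ hz₀
    have hsq : ∀ z, MvPolynomial.eval z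
        (∑ r ∈ F with MvPolynomial.eval z₀ r = 0, r ^ 2) = 0 ↔
          ∀ r ∈ F, MvPolynomial.eval z₀ r = 0 → MvPolynomial.eval z r = 0 := by
      intro z
      rw [map_sum, Finset.sum_eq_zero_iff_of_nonneg (fun r _ => by rw [map_pow]; positivity)]
      simp
    have hmul : ∀ (r : MvPolynomial κ ℝ) z, MvPolynomial.eval z
        (MvPolynomial.C (MvPolynomial.eval z₀ r) * r) =
          MvPolynomial.eval z₀ r * MvPolynomial.eval z r := by simp
    obtain ⟨G, hG, hG'⟩ := exists_separating_finset hH hS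
      (∑ r ∈ F with MvPolynomial.eval z₀ r = 0, r ^ 2)
      ({r ∈ F | MvPolynomial.eval z₀ r ≠ 0}.image
        fun r => MvPolynomial.C (MvPolynomial.eval z₀ r) * r) (by
      intro z hz hq h0
      rw [hsq] at h0
      refine hz₀ (hF z z₀ (fun r hr => ?_) hz)
      by_cases hr0 : MvPolynomial.eval z₀ r = 0
      · rw [h0 r hr hr0, hr0]
      · have := hq _ (Finset.mem_image_of_mem _ (Finset.mem_filter.2 ⟨hr, hr0⟩))
        rw [hmul] at this
        rcases mul_pos_iff.1 this with ⟨h1, h2⟩ | ⟨h1, h2⟩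
        · rw [sign_pos h1, sign_pos h2]
        · rw [sign_neg h1, sign_neg h2])
    refine ⟨G, hG, fun z hz => hG' z ?_ ?_⟩
    · rw [hsq]
      intro r hr hr0
      have := congrFun hz ⟨r, hr⟩
      simpa [sg, hr0] using this
    · intro q hq
      obtain ⟨r, hr, rfl⟩ := Finset.mem_image.1 hq
      obtain ⟨hr, hr0⟩ := Finset.mem_filter.1 hr
      have hs : SignType.sign (MvPolynomial.eval z r) = SignType.sign (MvPolynomial.eval z₀ r) :=
        congrFun hz ⟨r, hr⟩
      rw [hmul, ← sign_eq_one_iff, sign_mul, hs, ← sign_mul, sign_eq_one_iff]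
      exact mul_self_pos.2 hr0
  let A := {σ : F → SignType // ∃ z, z ∉ H ∧ sg z = σ}
  have keyA : ∀ σ : A, ∃ G : Finset (MvPolynomial κ ℝ),
      (∀ z ∈ H, ∃ g ∈ G, MvPolynomial.eval z g ≤ 0) ∧
        ∀ z, sg z = σ.1 → ∀ g ∈ G, 0 < MvPolynomial.eval z g := by
    rintro ⟨_, z₀, hz₀, rfl⟩
    exact key z₀ hz₀
  choose G hG hG' using keyA
  let e := Finite.equivFin A
  refine ⟨Nat.card A, fun i => G (e.symm i), fun z => ⟨fun hz i => hG _ z hz, fun h => ?_⟩⟩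
  by_contra hz
  obtain ⟨g, hg, hle⟩ := h (e ⟨sg z, z, hz, rfl⟩)
  simp only [Equiv.symm_apply_apply] at hg
  exact (hG' _ z rfl g hg).not_ge hle

end Separation

section Growth

variable {n : ℕ} {f : (Fin n → ℝ) → ℝ}

/-- A semialgebraic function that is bounded on compact sets grows at most polynomially. -/
theorem exists_abs_le_mul_pow (hsa : IsSemialgebraicFun f)
    (hcb : ∀ C : Set (Fin n → ℝ), IsCompact C → ∃ K : ℝ, ∀ x ∈ C, |f x| ≤ K) :
    ∃ C k, 0 < C ∧ ∀ x, |f x| ≤ C * (1 + ∑ i, x i ^ 2) ^ k := by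
  let D : ℝ → ℝ → Prop := fun R t => ∃ w : Fin n ⊕ Unit → ℝ,
    f (w ∘ Sum.inl) = w (Sum.inr ()) ∧ ∑ i, w (Sum.inl i) ^ 2 ≤ R ∧ t ^ 2 ≤ w (Sum.inr ()) ^ 2
  have hD : SignDet {v : Fin 2 → ℝ | D (v 0) (v 1)} := by
    have h1 := (SignDet.of_isSemialgebraic hsa).comap (κ := Fin 2 ⊕ (Fin n ⊕ Unit))
      (φ := fun i u => u (Sum.inr i)) fun i => PolyFn.coord _
    have h2 := SignDet.le (ι := Fin 2 ⊕ (Fin n ⊕ Unit))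
      (PolyFn.sum Finset.univ (g := fun i u => u (Sum.inr (Sum.inl i)) ^ 2)
        fun i _ => (PolyFn.coord _).pow 2) (PolyFn.coord (Sum.inl 0))
    have h3 := SignDet.le (ι := Fin 2 ⊕ (Fin n ⊕ Unit)) ((PolyFn.coord (Sum.inl 1)).pow 2)
      ((PolyFn.coord (Sum.inr (Sum.inr ()))).pow 2)
    have h := (h1.inter (h2.inter h3)).exists_sum
    simpa only [mem_inter_iff, mem_ofPred_eq, Sum.elim_inl, Sum.elim_inr] using h
  obtain ⟨C, k, hC, h⟩ := exists_growth_bound hD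
    (by
      rintro R R' t hR ⟨w, h1, h2, h3⟩
      exact ⟨w, h1, h2.trans hR, h3⟩)
    (by
      intro R
      obtain ⟨K, hK⟩ := hcb _ (isCompact_inter_sum_sq_le isClosed_univ R)
      refine ⟨K, ?_⟩
      rintro t ⟨w, h1, h2, h3⟩
      rw [← h1] at h3
      exact (le_abs_self t).trans ((sq_le_sq.1 h3).trans (hK _ ⟨mem_univ _, h2⟩)))
  refine ⟨C, k, hC, fun x => h _ _ ?_ ⟨Sum.elim x fun _ => f x, rfl, ?_, ?_⟩⟩
  · linarith [Finset.sum_nonneg fun i (_ : i ∈ Finset.univ) => sq_nonneg (x i)]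
  · simp
  · simp

/-- The subgraph of a semialgebraic function rescaled by a polynomial is sign-determined. -/
lemma signDet_mul_le (hsa : IsSemialgebraicFun f) {W : (Fin n → ℝ) → ℝ} (hW : PolyFn W) :
    SignDet {z : Fin n ⊕ Unit → ℝ | W (z ∘ Sum.inl) * z (Sum.inr ()) ≤ f (z ∘ Sum.inl)} := by
  have h1 := (SignDet.of_isSemialgebraic hsa).comap (κ := (Fin n ⊕ Unit) ⊕ Unit)
    (φ := fun i u => Sum.elim (fun j => u (Sum.inl (Sum.inl j))) (fun _ => u (Sum.inr ())) i) (by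
      rintro (i | i) <;> exact PolyFn.coord _)
  have h2 := SignDet.le (ι := (Fin n ⊕ Unit) ⊕ Unit)
    ((hW.comp (φ := fun i u => u (Sum.inl (Sum.inl i))) fun i => PolyFn.coord _).mul
      (PolyFn.coord (Sum.inl (Sum.inr ())))) (PolyFn.coord (Sum.inr ()))
  have h := (h1.inter h2).exists_sum
  convert h using 3 with z
  constructor
  · intro hz
    exact ⟨fun _ => f (z ∘ Sum.inl), rfl, hz⟩
  · rintro ⟨w, hw1, hw2⟩
    exact le_of_le_of_eq hw2 hw1.symm

lemma isClosed_mul_le (husc : UpperSemicontinuous f) {W : (Fin n → ℝ) → ℝ} (hW : Continuous W) :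
    IsClosed {z : Fin n ⊕ Unit → ℝ | W (z ∘ Sum.inl) * z (Sum.inr ()) ≤ f (z ∘ Sum.inl)} := by
  have hc : Continuous fun z : Fin n ⊕ Unit → ℝ => z ∘ Sum.inl :=
    continuous_pi fun i => continuous_apply _
  have hW' : Continuous fun z : Fin n ⊕ Unit → ℝ => -(W (z ∘ Sum.inl) * z (Sum.inr ())) :=
    ((hW.comp hc).mul (continuous_apply _)).neg
  have := ((husc.comp hc).add hW'.upperSemicontinuous).isClosed_preimage 0
  convert this using 1
  ext z
  simp [← sub_eq_add_neg]

end Growth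

section Bilevel

variable {n m : ℕ}

lemma PolyFn.isPolyMap {P : (Fin n → ℝ) → (Fin m → ℝ) → ℝ}
    (h : PolyFn fun u : Fin n ⊕ Fin m → ℝ => P (fun i => u (Sum.inl i)) fun j => u (Sum.inr j)) :
    IsPolyMap P := by
  obtain ⟨p, hp⟩ := h
  exact ⟨p, fun x y => hp (Sum.elim x y)⟩

/-- The lower-level objective encoding membership in the set described by the families `G i`, with
one slack variable per family. -/
def slackObjective {N : ℕ} (G : Fin N → Finset (MvPolynomial (Fin n ⊕ Unit) ℝ))
    (x : Fin n → ℝ) (y : Fin (N + 1) → ℝ) : ℝ :=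
  ∑ i, (∏ g ∈ G i, (MvPolynomial.eval (Sum.elim x fun _ => y 0) g +
    (1 + MvPolynomial.eval (Sum.elim x fun _ => y 0) g ^ 2) * y i.succ ^ 2)) ^ 2

variable {N : ℕ} (G : Fin N → Finset (MvPolynomial (Fin n ⊕ Unit) ℝ))

lemma isPolyMap_slackObjective : IsPolyMap (slackObjective G) := by
  apply PolyFn.isPolyMap
  unfold slackObjective
  have hev : ∀ g : MvPolynomial (Fin n ⊕ Unit) ℝ,
      PolyFn fun u : Fin n ⊕ Fin (N + 1) → ℝ => MvPolynomial.eval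
        (fun s => Sum.elim (fun i => u (Sum.inl i)) (fun _ => u (Sum.inr 0)) s) g :=
    fun g => (PolyFn.eval g).comp (by rintro (i | i) <;> exact PolyFn.coord _)
  exact PolyFn.sum _ fun i _ => (PolyFn.prod _ fun g _ =>
    (hev g).add (((PolyFn.const 1).add ((hev g).pow 2)).mul ((PolyFn.coord _).pow 2))).pow 2

lemma slackObjective_nonneg (x : Fin n → ℝ) (y : Fin (N + 1) → ℝ) : 0 ≤ slackObjective G x y :=
  Finset.sum_nonneg fun _ _ => sq_nonneg _

lemma exists_eval_nonpos_of_slackObjective_eq_zero {x : Fin n → ℝ} {y : Fin (N + 1) → ℝ}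
    (h : slackObjective G x y = 0) (i : Fin N) :
    ∃ g ∈ G i, MvPolynomial.eval (Sum.elim x fun _ => y 0) g ≤ 0 := by
  have h1 := (Finset.sum_eq_zero_iff_of_nonneg fun _ _ => sq_nonneg _).1 h i (Finset.mem_univ i)
  obtain ⟨g, hg, h2⟩ := Finset.prod_eq_zero_iff.1 (pow_eq_zero_iff two_ne_zero |>.1 h1)
  refine ⟨g, hg, ?_⟩
  have : 0 ≤ (1 + MvPolynomial.eval (Sum.elim x fun _ => y 0) g ^ 2) * y i.succ ^ 2 := by positivity
  linarith

lemma exists_slack {a : ℝ} (ha : a ≤ 0) : ∃ s ∈ Icc (0 : ℝ) 1, a + (1 + a ^ 2) * s ^ 2 = 0 := by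
  have h0 : 0 < 1 + a ^ 2 := by positivity
  have h1 : 0 ≤ -a / (1 + a ^ 2) := div_nonneg (by linarith) h0.le
  refine ⟨√(-a / (1 + a ^ 2)), ⟨Real.sqrt_nonneg _, ?_⟩, ?_⟩
  · refine Real.sqrt_le_one.2 ((div_le_one h0).2 ?_)
    nlinarith
  · rw [Real.sq_sqrt h1]
    field_simp
    ring

lemma exists_slackObjective_eq_zero {x : Fin n → ℝ} {s : ℝ}
    (h : ∀ i, ∃ g ∈ G i, MvPolynomial.eval (Sum.elim x fun _ => s) g ≤ 0) :
    ∃ y : Fin (N + 1) → ℝ, y 0 = s ∧ (∀ i : Fin N, y i.succ ∈ Icc (0 : ℝ) 1) ∧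
      slackObjective G x y = 0 := by
  choose g hg hle using h
  choose t ht ht0 using fun i => exists_slack (hle i)
  refine ⟨Fin.cons s t, rfl, ht, Finset.sum_eq_zero fun i _ => ?_⟩
  rw [Finset.prod_eq_zero (hg i) (by simpa using ht0 i)]
  simp

end Bilevel

end SemialgebraicAux

/-- every semi-algebraic, upper semicontinuous function bounded on compact sets
is the pessimistic value function of a polynomial bilevel problem over a bounded box. -/
theorem sa_usc_cb_is_bounded_box_pessimistic_value (n : ℕ) (f : (Fin n → ℝ) → ℝ)
    (hsa : IsSemialgebraicFun f) (husc : UpperSemicontinuous f)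
    (hcb : ∀ C : Set (Fin n → ℝ), IsCompact C → ∃ K : ℝ, ∀ x ∈ C, |f x| ≤ K) :
    ∃ (m : ℕ) (P Q : (Fin n → ℝ) → (Fin m → ℝ) → ℝ) (a b : Fin m → ℝ),
      IsPolyMap P ∧ IsPolyMap Q ∧
      ∀ x, valPess P Q (boundedBox a b) x = ((f x : ℝ) : EReal) := by
  obtain ⟨C, k, hC, hf⟩ := SemialgebraicAux.exists_abs_le_mul_pow hsa hcb
  set W : (Fin n → ℝ) → ℝ := fun x => C * (1 + ∑ i, x i ^ 2) ^ k with hWd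
  have hW : SemialgebraicAux.PolyFn W := (SemialgebraicAux.PolyFn.const C).mul
    (((SemialgebraicAux.PolyFn.const 1).add (SemialgebraicAux.PolyFn.sum _ fun i _ =>
      (SemialgebraicAux.PolyFn.coord i).pow 2)).pow k)
  have hWpos : ∀ x, 0 < W x := fun x => by
    have : 0 ≤ ∑ i, x i ^ 2 := Finset.sum_nonneg fun i _ => sq_nonneg (x i)
    simp only [hWd]
    positivity
  obtain ⟨N, G, hG⟩ := SemialgebraicAux.exists_closed_description
    (SemialgebraicAux.isClosed_mul_le husc hW.continuous) (SemialgebraicAux.signDet_mul_le hsa hW)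
  refine ⟨N + 1, fun x y => W x * y 0, SemialgebraicAux.slackObjective G,
    Fin.cons (-1) fun _ => 0, fun _ => 1, ?_, SemialgebraicAux.isPolyMap_slackObjective G, ?_⟩
  · exact SemialgebraicAux.PolyFn.isPolyMap
      ((hW.comp fun i => SemialgebraicAux.PolyFn.coord (Sum.inl i)).mul
        (SemialgebraicAux.PolyFn.coord (Sum.inr 0)))
  intro x
  have hmul : W x * (f x / W x) = f x := mul_div_cancel₀ _ (hWpos x).ne'
  have habs : |f x / W x| ≤ 1 := by
    rw [abs_div, abs_of_pos (hWpos x), div_le_one (hWpos x)]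
    exact hf x
  obtain ⟨y, hy0, hys, hy⟩ := SemialgebraicAux.exists_slackObjective_eq_zero G (x := x)
    (s := f x / W x) ((hG (Sum.elim x fun _ => f x / W x)).1 hmul.le)
  have hybox : y ∈ boundedBox (Fin.cons (-1) fun _ => 0) fun _ => 1 := by
    intro i
    refine Fin.cases ?_ (fun j => ?_) i
    · rw [hy0]
      exact abs_le.1 habs
    · exact hys j
  apply le_antisymm
  · refine iSup₂_le fun y' hy' => EReal.coe_le_coe_iff.2 ?_
    have h0 := le_antisymm ((hy'.2 y hybox).trans hy.le)
      (SemialgebraicAux.slackObjective_nonneg G x y')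
    exact (hG (Sum.elim x fun _ => y' 0)).2
      (SemialgebraicAux.exists_eval_nonpos_of_slackObjective_eq_zero G h0)
  · refine le_iSup₂_of_le y ⟨hybox, fun y' _ => hy.trans_le
      (SemialgebraicAux.slackObjective_nonneg G x y')⟩ (EReal.coe_le_coe_iff.2 ?_)
    simp only [hy0, hmul, le_refl]
end
end

section
/- Let f : ℝⁿ → ℝ be a lower semicontinuous piecewise polynomial function. Then there exist m ∈ ℕ, polynomials P, Q : ℝⁿ × ℝᵐ → ℝ with Q(x,·) convex on ℝᵐ for every fixed x, and a bounded box 𝒴 = [a₁,b₁] × … × [aₘ,bₘ] ⊆ ℝᵐ (all aᵢ, bᵢ real), such that the optimistic value function φ_o of the associated bilevel problem satisfies φ_o = f. -/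
open Set

noncomputable section

/-- A sign `s` is a degeneration of a sign `σ` if it is zero or equal to `σ`. -/
def SignDegen (s σ : SignType) : Prop := s = 0 ∨ s = σ

open Polynomial in
theorem Polynomial.monotoneOn_or_antitoneOn (p : ℝ[X]) {a b : ℝ} {σ : SignType}
    (h : ∀ u ∈ Icc a b, SignDegen (SignType.sign ((derivative p).eval u)) σ) :
    MonotoneOn (fun u => p.eval u) (Icc a b) ∨ AntitoneOn (fun u => p.eval u) (Icc a b) := by
  by_cases hσ : 0 ≤ σ
  · left
    refine monotoneOn_of_deriv_nonneg (convex_Icc a b) p.continuous.continuousOn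
      p.differentiable.differentiableOn fun u hu => ?_
    rw [Polynomial.deriv, ← sign_nonneg_iff]
    rcases h u (interior_subset hu) with h | h <;> simp [h, hσ]
  · right
    refine antitoneOn_of_deriv_nonpos (convex_Icc a b) p.continuous.continuousOn
      p.differentiable.differentiableOn fun u hu => ?_
    rw [Polynomial.deriv, ← sign_nonpos_iff]
    rcases h u (interior_subset hu) with h | h
    · simp [h]
    · rw [h]; exact (not_le.1 hσ).le

theorem SignDegen.of_between {σ : SignType} {a b c : ℝ} (ha : SignDegen (SignType.sign a) σ)
    (hc : SignDegen (SignType.sign c) σ) (h : a ≤ b ∧ b ≤ c ∨ c ≤ b ∧ b ≤ a) :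
    SignDegen (SignType.sign b) σ := by
  unfold SignDegen at *
  rcases lt_trichotomy a 0 with h1 | h1 | h1 <;> rcases lt_trichotomy b 0 with h2 | h2 | h2 <;>
    rcases lt_trichotomy c 0 with h3 | h3 | h3 <;> simp_all [sign_pos, sign_neg] <;> grind

/-- Closure under differentiation for a family of real polynomials. -/
def DerivClosed {ι : Type*} (g : ι → Polynomial ℝ) : Prop :=
  ∀ i, (g i).natDegree = 0 ∨ ∃ j, g j = Polynomial.derivative (g i)

open Polynomial in
/-- **Thom's lemma**: relaxed sign conditions on a family of polynomials closed under
differentiation define an interval. -/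
theorem DerivClosed.signDegen_of_mem_Icc {ι : Type*} {g : ι → ℝ[X]} (hg : DerivClosed g)
    {σ : ι → SignType} {a b : ℝ}
    (ha : ∀ i, SignDegen (SignType.sign ((g i).eval a)) (σ i))
    (hb : ∀ i, SignDegen (SignType.sign ((g i).eval b)) (σ i)) (i : ι) :
    ∀ u ∈ Icc a b, SignDegen (SignType.sign ((g i).eval u)) (σ i) := by
  induction hd : (g i).natDegree using Nat.strong_induction_on generalizing i with
  | _ d ih =>
    intro u hu
    rcases hg i with h0 | ⟨j, hj⟩
    · rw [eq_C_of_natDegree_eq_zero h0, eval_C]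
      have := ha i
      rwa [eq_C_of_natDegree_eq_zero h0, eval_C] at this
    · by_cases h0 : (g i).natDegree = 0
      · rw [eq_C_of_natDegree_eq_zero h0, eval_C]
        have := ha i
        rwa [eq_C_of_natDegree_eq_zero h0, eval_C] at this
      have := ih (g j).natDegree (by rw [hj, ← hd]; exact natDegree_derivative_lt h0) j rfl
      rw [hj] at this
      have hab : a ≤ b := hu.1.trans hu.2
      refine (ha i).of_between (hb i) ?_
      rcases Polynomial.monotoneOn_or_antitoneOn _ this with hm | hm
      · exact Or.inl ⟨hm (left_mem_Icc.2 hab) hu hu.1, hm hu (right_mem_Icc.2 hab) hu.2⟩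
      · exact Or.inr ⟨hm hu (right_mem_Icc.2 hab) hu.2, hm (left_mem_Icc.2 hab) hu hu.1⟩

open Polynomial in
theorem DerivClosed.signDegen_of_mem_uIcc {ι : Type*} {g : ι → ℝ[X]} (hg : DerivClosed g)
    {σ : ι → SignType} {a b : ℝ}
    (ha : ∀ i, SignDegen (SignType.sign ((g i).eval a)) (σ i))
    (hb : ∀ i, SignDegen (SignType.sign ((g i).eval b)) (σ i)) (i : ι) :
    ∀ u ∈ uIcc a b, SignDegen (SignType.sign ((g i).eval u)) (σ i) := by
  rcases le_total a b with h | h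
  · rw [uIcc_of_le h]; exact hg.signDegen_of_mem_Icc ha hb i
  · rw [uIcc_of_ge h]; exact hg.signDegen_of_mem_Icc hb ha i

open Polynomial in
/-- Strict sign conditions on a family closed under differentiation define an interval. -/
theorem DerivClosed.sign_eq_of_mem_Icc {ι : Type*} {g : ι → ℝ[X]} (hg : DerivClosed g)
    {σ : ι → SignType} {a b : ℝ} (ha : ∀ i, SignType.sign ((g i).eval a) = σ i)
    (hb : ∀ i, SignType.sign ((g i).eval b) = σ i) (i : ι) :
    ∀ u ∈ Icc a b, SignType.sign ((g i).eval u) = σ i := by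
  intro u hu
  have hw := hg.signDegen_of_mem_Icc (fun i => Or.inr (ha i)) (fun i => Or.inr (hb i))
  have hab : a ≤ b := hu.1.trans hu.2
  have key : MonotoneOn (fun u => (g i).eval u) (Icc a b) ∨
      AntitoneOn (fun u => (g i).eval u) (Icc a b) := by
    rcases hg i with h0 | ⟨j, hj⟩
    · left
      rw [eq_C_of_natDegree_eq_zero h0]
      simp [monotoneOn_const]
    · exact Polynomial.monotoneOn_or_antitoneOn _ (hj ▸ hw j)
  have hbt : (g i).eval a ≤ (g i).eval u ∧ (g i).eval u ≤ (g i).eval b ∨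
      (g i).eval b ≤ (g i).eval u ∧ (g i).eval u ≤ (g i).eval a := by
    rcases key with hm | hm
    · exact Or.inl ⟨hm (left_mem_Icc.2 hab) hu hu.1, hm hu (right_mem_Icc.2 hab) hu.2⟩
    · exact Or.inr ⟨hm hu (right_mem_Icc.2 hab) hu.2, hm (left_mem_Icc.2 hab) hu hu.1⟩
  rcases hw i u hu with h0 | h0
  · rw [sign_eq_zero_iff] at h0
    rw [h0] at hbt
    rw [h0, ← ha i]
    have e : SignType.sign ((g i).eval a) = SignType.sign ((g i).eval b) := by rw [ha i, hb i]
    rcases hbt with ⟨h1, h2⟩ | ⟨h1, h2⟩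
    · rw [← sign_nonpos_iff] at h1
      rw [← sign_nonneg_iff, ← e] at h2
      simp [le_antisymm h1 h2]
    · rw [← sign_nonpos_iff, ← e] at h1
      rw [← sign_nonneg_iff] at h2
      simp [le_antisymm h1 h2]
  · exact h0

open Polynomial in
theorem Polynomial.exists_eval_sub_eq_segment (p : ℝ[X]) (a b : ℝ) :
    ∃ θ ∈ Ioo (0 : ℝ) 1,
      p.eval b - p.eval a = (b - a) * (derivative p).eval (a + θ * (b - a)) := by
  have key : ∀ θ : ℝ, HasDerivAt (fun θ => p.eval (a + θ * (b - a)))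
      ((derivative p).eval (a + θ * (b - a)) * (b - a)) θ := fun θ => by
    have := ((hasDerivAt_id θ).mul_const (b - a)).const_add a
    simp only [id, one_mul] at this
    exact (p.hasDerivAt (a + θ * (b - a))).comp θ this
  obtain ⟨θ, hθ, he⟩ := exists_hasDerivAt_eq_slope (fun θ => p.eval (a + θ * (b - a)))
    (fun θ => (derivative p).eval (a + θ * (b - a)) * (b - a)) zero_lt_one
    (fun x _ => (key x).continuousAt.continuousWithinAt) (fun x _ => key x)
  refine ⟨θ, hθ, ?_⟩
  rw [mul_comm, he]
  simp

theorem sign_eq_of_ne_zero_on_Icc {f : ℝ → ℝ} (hf : Continuous f) {a b : ℝ} (hab : a ≤ b)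
    (h : ∀ s ∈ Icc a b, f s ≠ 0) : SignType.sign (f a) = SignType.sign (f b) := by
  by_contra hne
  have h0 : (0 : ℝ) ∈ uIcc (f a) (f b) := by
    rw [mem_uIcc]
    have ha := h a (left_mem_Icc.2 hab)
    have hb := h b (right_mem_Icc.2 hab)
    rcases ha.lt_or_gt with ha | ha <;> rcases hb.lt_or_gt with hb | hb
    · simp [sign_neg ha, sign_neg hb] at hne
    · exact Or.inl ⟨ha.le, hb.le⟩
    · exact Or.inr ⟨hb.le, ha.le⟩
    · simp [sign_pos ha, sign_pos hb] at hne
  obtain ⟨s, hs, hs0⟩ := intermediate_value_uIcc (hf.continuousOn) h0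
  rw [uIcc_of_le hab] at hs
  exact h s hs hs0

/-- The first common zero after `0` of finitely many continuous functions. -/
theorem exists_first_zero {ι : Type*} [Finite ι] {g : ι → ℝ → ℝ} (hg : ∀ i, Continuous (g i))
    (h0 : ∀ i, g i 0 ≠ 0) {S : ℝ} (hS : 0 ≤ S) {i : ι} (hi : g i S = 0) :
    ∃ s, 0 < s ∧ (∃ i, g i s = 0) ∧ ∀ u, 0 ≤ u → u < s → ∀ i, g i u ≠ 0 := by
  have hc : IsCompact (Icc 0 S ∩ ⋃ i, {s | g i s = 0}) :=
    isCompact_Icc.inter_right (isClosed_iUnion_of_finite fun i =>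
      isClosed_eq (hg i) continuous_const)
  obtain ⟨s, ⟨hs, hs'⟩, hmin⟩ := hc.exists_isLeast ⟨S, ⟨hS, le_rfl⟩, mem_iUnion.2 ⟨i, hi⟩⟩
  obtain ⟨j, hj⟩ := mem_iUnion.1 hs'
  refine ⟨s, lt_of_le_of_ne hs.1 ?_, ⟨j, hj⟩, fun u hu hus k hk => ?_⟩
  · rintro rfl
    exact h0 j hj
  · exact hus.not_ge (hmin ⟨⟨hu, hus.le.trans hs.2⟩, mem_iUnion.2 ⟨k, hk⟩⟩)

/-- Two families of real polynomials, compatibly closed under differentiation and with the same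
vanishing members. -/
structure SpecPair {ι : Type*} (g h : ι → Polynomial ℝ) : Prop where
  deriv : ∀ i, ((g i).natDegree = 0 ∧ (h i).natDegree = 0) ∨
    ∃ j, g j = Polynomial.derivative (g i) ∧ h j = Polynomial.derivative (h i)
  zero_iff : ∀ i, g i = 0 ↔ h i = 0

/-- The points `t` and `t'` realize the same sign conditions on the families `g` and `h`. -/
def SameSigns {ι : Type*} (g h : ι → Polynomial ℝ) (t t' : ℝ) : Prop :=
  ∀ i, SignType.sign ((g i).eval t) = SignType.sign ((h i).eval t')

namespace SpecPair

open Polynomial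

variable {ι : Type*} {g h : ι → ℝ[X]}

theorem derivClosed_left (H : SpecPair g h) : DerivClosed g := fun i =>
  (H.deriv i).imp And.left fun ⟨j, hj, _⟩ => ⟨j, hj⟩

theorem derivClosed_right (H : SpecPair g h) : DerivClosed h := fun i =>
  (H.deriv i).imp And.right fun ⟨j, _, hj⟩ => ⟨j, hj⟩

theorem exists_sameSigns_pos [Finite ι] (H : SpecPair g h) {p q : ℝ[X]} {d : ι}
    (hp : g d = derivative p) (hq : h d = derivative q) (hd : g d ≠ 0)
    (hgh : ∀ t, ∃ t', SameSigns g h t t') (hhg : ∀ t', ∃ t, SameSigns g h t t')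
    (hroot : ∀ t t', SameSigns g h t t' → ∀ i, g i ≠ 0 → (g i).eval t = 0 →
      SignType.sign (p.eval t) = SignType.sign (q.eval t'))
    {t ε : ℝ} (ht : ∀ i, g i ≠ 0 → (g i).eval t ≠ 0) (hε : ε = 1 ∨ ε = -1)
    (hpos : 0 < ε * p.eval t) : ∃ t', SameSigns g h t t' ∧ 0 < ε * q.eval t' := by
  by_contra! Hc
  obtain ⟨t', htt'⟩ := hgh t
  have ht' : ∀ i, h i ≠ 0 → (h i).eval t' ≠ 0 := fun i hi h0 => by
    have := htt' i
    rw [h0, sign_zero, sign_eq_zero_iff] at this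
    exact ht i (fun h => hi ((H.zero_iff i).1 h)) this
  have hd' : h d ≠ 0 := fun h => hd ((H.zero_iff d).2 h)
  obtain ⟨η, hη, hηpos⟩ : ∃ η : ℝ, (η = 1 ∨ η = -1) ∧ 0 < ε * η * (h d).eval t' := by
    have h1 : ε * (h d).eval t' ≠ 0 := mul_ne_zero (by rcases hε with h | h <;> simp [h]) (ht' d hd')
    rcases h1.lt_or_gt with h1 | h1
    · exact ⟨-1, Or.inr rfl, by linarith⟩
    · exact ⟨1, Or.inl rfl, by linarith⟩
  have hcont : ∀ r : ℝ[X], Continuous fun s : ℝ => r.eval (t' + η * s) := fun r =>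
    r.continuous.comp (by fun_prop)
  have hsame : ∀ s, 0 ≤ s → (∀ u, 0 ≤ u → u ≤ s → ∀ i, h i ≠ 0 → (h i).eval (t' + η * u) ≠ 0) →
      ∀ i, SignType.sign ((h i).eval (t' + η * s)) = SignType.sign ((h i).eval t') := by
    intro s hs hu i
    by_cases hi : h i = 0
    · simp [hi]
    · have := sign_eq_of_ne_zero_on_Icc (hcont (h i)) hs fun u hu' => hu u hu'.1 hu'.2 i hi
      simpa using this.symm
  have hq_nonpos : ∀ s, 0 ≤ s →
      (∀ u, 0 ≤ u → u ≤ s → ∀ i, h i ≠ 0 → (h i).eval (t' + η * u) ≠ 0) →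
      ε * q.eval (t' + η * s) ≤ 0 := fun s hs hu =>
    Hc _ fun i => (htt' i).trans (hsame s hs hu i).symm
  by_cases hex : ∃ S, 0 ≤ S ∧ ∃ i, h i ≠ 0 ∧ (h i).eval (t' + η * S) = 0
  · obtain ⟨S, hS, i, hi, hiS⟩ := hex
    obtain ⟨s, hs, ⟨⟨k, hk⟩, hks⟩, hmin⟩ := exists_first_zero (ι := {i // h i ≠ 0})
      (g := fun i s => (h i).eval (t' + η * s)) (fun i => hcont _)
      (fun i => by simpa using ht' i i.2) hS (i := ⟨i, hi⟩) hiS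
    have hne : ∀ u, 0 ≤ u → u < s → ∀ i, h i ≠ 0 → (h i).eval (t' + η * u) ≠ 0 :=
      fun u hu hus i hi => hmin u hu hus ⟨i, hi⟩
    have hqb : ε * q.eval (t' + η * s) ≤ 0 := by
      have hcq : Continuous fun s : ℝ => ε * q.eval (t' + η * s) := (hcont q).const_mul ε |>.congr
        fun _ => rfl
      refine le_of_tendsto (hcq.continuousAt.tendsto.mono_left
        (nhdsWithin_le_nhds (s := Iio s))) ?_
      filter_upwards [Ioo_mem_nhdsLT hs] with u hu
      exact hq_nonpos u hu.1.le fun v hv hvu => hne v hv (hvu.trans_lt hu.2)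
    have hdegen : ∀ i, SignDegen (SignType.sign ((h i).eval (t' + η * s)))
        (SignType.sign ((h i).eval t')) := by
      intro i
      by_cases h0 : (h i).eval (t' + η * s) = 0
      · left; simp [h0]
      · right
        have := sign_eq_of_ne_zero_on_Icc (hcont (h i)) hs.le fun u hu => by
          rcases hu.2.lt_or_eq with hus | rfl
          · exact hne u hu.1 hus i (fun h => by simp [h] at h0)
          · exact h0
        simpa using this.symm
    obtain ⟨b, hb⟩ := hhg (t' + η * s)
    have hgk : g k ≠ 0 := fun h => hk ((H.zero_iff k).1 h)
    have hgkb : (g k).eval b = 0 := by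
      have := hb k
      rwa [hks, sign_zero, sign_eq_zero_iff] at this
    have hpb : ε * p.eval b ≤ 0 := by
      rw [← sign_nonpos_iff, sign_mul, hroot b _ hb k hgk hgkb, ← sign_mul, sign_nonpos_iff]
      exact hqb
    have hbdegen : ∀ i, SignDegen (SignType.sign ((g i).eval b))
        (SignType.sign ((g i).eval t)) := fun i => by
      rw [hb i, htt' i]; exact hdegen i
    have hmid : ∀ i, ∀ θ ∈ Ioo (0 : ℝ) 1, SignDegen
        (SignType.sign ((g i).eval (t + θ * (b - t)))) (SignType.sign ((g i).eval t)) := by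
      intro i θ hθ
      refine H.derivClosed_left.signDegen_of_mem_uIcc (fun i => Or.inr rfl) hbdegen i _ ?_
      rw [mem_uIcc]
      rcases le_total t b with h | h
      · left; constructor <;> nlinarith [hθ.1, hθ.2]
      · right; constructor <;> nlinarith [hθ.1, hθ.2]
    have hdir : 0 < η * (b - t) := by
      rcases H.deriv k with ⟨hk0, _⟩ | ⟨j, hj, hj'⟩
      · exfalso
        rw [eq_C_of_natDegree_eq_zero hk0, eval_C] at hgkb
        apply hgk
        rw [eq_C_of_natDegree_eq_zero hk0, hgkb, C_0]
      obtain ⟨θ, hθ, e⟩ := (h k).exists_eval_sub_eq_segment t' (t' + η * s)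
      obtain ⟨θ₂, hθ₂, e₂⟩ := (g k).exists_eval_sub_eq_segment t b
      rw [← hj', hks] at e
      rw [← hj, hgkb] at e₂
      have h1 : SignType.sign ((h j).eval (t' + θ * (t' + η * s - t'))) =
          SignType.sign ((h j).eval t') := by
        rw [show t' + θ * (t' + η * s - t') = t' + η * (θ * s) by ring]
        refine hsame _ (mul_nonneg hθ.1.le hs.le) (fun u hu hus => hne u hu ?_) j
        nlinarith [hθ.2]
      have h2 := hmid j θ₂ hθ₂
      have ht0 := ht k hgk
      have h2' : SignType.sign ((g j).eval (t + θ₂ * (b - t))) =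
          SignType.sign ((g j).eval t) := by
        rcases h2 with h2 | h2
        · rw [sign_eq_zero_iff] at h2
          rw [h2, mul_zero, zero_sub, neg_eq_zero] at e₂
          exact absurd e₂ ht0
        · exact h2
      have e3 : SignType.sign ((t' + η * s - t') * (h j).eval (t' + θ * (t' + η * s - t'))) =
          SignType.sign ((b - t) * (g j).eval (t + θ₂ * (b - t))) := by
        rw [← e, ← e₂, zero_sub, zero_sub, Left.sign_neg, Left.sign_neg, htt' k]
      rw [sign_mul, sign_mul, h1, h2', htt' j] at e3
      have hj0 : SignType.sign ((h j).eval t') ≠ 0 := by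
        rw [← htt' j, ← h2', Ne, sign_eq_zero_iff]
        intro h0
        rw [h0, mul_zero, zero_sub, neg_eq_zero] at e₂
        exact ht0 e₂
      have e4 := mul_right_cancel₀ hj0 e3
      rw [add_sub_cancel_left, sign_mul, sign_pos hs, mul_one] at e4
      rw [← sign_eq_one_iff, sign_mul, ← e4, ← sign_mul, sign_eq_one_iff]
      rcases hη with h | h <;> simp [h]
    obtain ⟨θ, hθ, e⟩ := p.exists_eval_sub_eq_segment t b
    have h3 : 0 ≤ ε * η * (g d).eval (t + θ * (b - t)) := by
      rw [← sign_nonneg_iff, sign_mul]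
      rcases hmid d θ hθ with h | h
      · simp [h]
      · rw [h, htt' d, ← sign_mul, sign_nonneg_iff]
        exact hηpos.le
    rw [← hp] at e
    have hηη : η * η = 1 := by rcases hη with h | h <;> simp [h]
    have : ε * (p.eval b - p.eval t) =
        (η * (b - t)) * (ε * η * (g d).eval (t + θ * (b - t))) := by
      rw [e]; linear_combination -(ε * (b - t) * (g d).eval (t + θ * (b - t))) * hηη
    nlinarith [mul_nonneg hdir.le h3]
  · push Not at hex
    have hne : ∀ u, 0 ≤ u → ∀ i, h i ≠ 0 → (h i).eval (t' + η * u) ≠ 0 := fun u hu i hi =>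
      hex u hu i hi
    set r : ℝ[X] := q.comp (C t' + C η * X) with hr
    have hreval : ∀ s, r.eval s = q.eval (t' + η * s) := fun s => by simp [hr]
    have hη0 : η ≠ 0 := by rcases hη with h | h <;> simp [h]
    have hq0 : 0 < q.natDegree := by
      rw [Nat.pos_iff_ne_zero]
      intro h0
      rw [hq, eq_C_of_natDegree_eq_zero h0, derivative_C] at hd'
      exact hd' rfl
    have hrdeg : 0 < r.degree := by
      rw [← natDegree_pos_iff_degree_pos, hr, natDegree_comp, add_comm, natDegree_add_C,
        natDegree_C_mul_X _ hη0]
      simpa using hq0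
    have hT := r.abs_tendsto_atTop hrdeg
    obtain ⟨s, hs0, hs⟩ := ((Filter.eventually_ge_atTop 0).and
      (hT.eventually_gt_atTop |q.eval t'|)).exists
    rw [hreval] at hs
    have h1 := hq_nonpos s hs0 fun u hu _ => hne u hu
    obtain ⟨θ, hθ, e⟩ := q.exists_eval_sub_eq_segment t' (t' + η * s)
    have h2 : SignType.sign ((h d).eval (t' + θ * (t' + η * s - t'))) =
          SignType.sign ((h d).eval t') := by
      rw [show t' + θ * (t' + η * s - t') = t' + η * (θ * s) by ring]
      exact hsame _ (mul_nonneg hθ.1.le hs0) (fun u hu _ => hne u hu) d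
    have h3 : 0 < ε * η * (h d).eval (t' + θ * (t' + η * s - t')) := by
      rw [← sign_eq_one_iff, sign_mul, h2, ← sign_mul, sign_eq_one_iff]
      exact hηpos
    rw [← hq] at e
    have h4 : ε * q.eval t' ≤ ε * q.eval (t' + η * s) := by
      have : ε * (q.eval (t' + η * s) - q.eval t') =
          s * (ε * η * (h d).eval (t' + θ * (t' + η * s - t'))) := by
        rw [e]; ring
      nlinarith [mul_nonneg hs0 h3.le]
    have hεa : ∀ x : ℝ, |x| = |ε * x| := fun x => by
      rcases hε with h | h <;> simp [h]
    rw [hεa (q.eval t'), hεa (q.eval _), abs_of_nonpos h1, abs_of_nonpos (h4.trans h1)] at hs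
    linarith

theorem exists_sameSigns_extend [Finite ι] (H : SpecPair g h) {p q : ℝ[X]} {d : ι}
    (hp : g d = derivative p) (hq : h d = derivative q) (hd : g d ≠ 0)
    (hgh : ∀ t, ∃ t', SameSigns g h t t') (hhg : ∀ t', ∃ t, SameSigns g h t t')
    (hroot : ∀ t t', SameSigns g h t t' → ∀ i, g i ≠ 0 → (g i).eval t = 0 →
      SignType.sign (p.eval t) = SignType.sign (q.eval t')) (t : ℝ) :
    ∃ t', SameSigns g h t t' ∧ SignType.sign (p.eval t) = SignType.sign (q.eval t') := by
  by_cases ht : ∀ i, g i ≠ 0 → (g i).eval t ≠ 0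
  swap
  · push Not at ht
    obtain ⟨i, hi, hi0⟩ := ht
    obtain ⟨t', ht'⟩ := hgh t
    exact ⟨t', ht', hroot t t' ht' i hi hi0⟩
  have key : ∀ (t ε : ℝ), (∀ i, g i ≠ 0 → (g i).eval t ≠ 0) → (ε = 1 ∨ ε = -1) →
      0 < ε * p.eval t → ∃ t', SameSigns g h t t' ∧ 0 < ε * q.eval t' := fun t ε ht hε hpos =>
    H.exists_sameSigns_pos hp hq hd hgh hhg hroot ht hε hpos
  rcases lt_trichotomy (p.eval t) 0 with h0 | h0 | h0
  · obtain ⟨t', h1, h2⟩ := key t (-1) ht (Or.inr rfl) (by linarith)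
    exact ⟨t', h1, by rw [sign_neg h0, sign_neg (by linarith)]⟩
  · have hnear : ∀ᶠ u in nhds t, ∀ i,
        SignType.sign ((g i).eval u) = SignType.sign ((g i).eval t) := by
      rw [Filter.eventually_all]
      intro i
      by_cases hi : g i = 0
      · simp [hi]
      · rcases (ht i hi).lt_or_gt with hs | hs
        · filter_upwards [(g i).continuous.continuousAt.eventually_lt_const hs] with u hu
          rw [sign_neg hs, sign_neg hu]
        · filter_upwards [(g i).continuous.continuousAt.eventually_const_lt hs] with u hu
          rw [sign_pos hs, sign_pos hu]
    obtain ⟨δ, hδ, hball⟩ := Metric.eventually_nhds_iff.1 hnear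
    have hside : ∀ ν : ℝ, (ν = 1 ∨ ν = -1) → ∃ t', SameSigns g h t t' ∧ 0 < ν * q.eval t' := by
      intro ν hν
      have hνν : ν * ν = 1 := by rcases hν with h | h <;> simp [h]
      obtain ⟨κ, hκ, hκpos⟩ : ∃ κ : ℝ, |κ| = 1 ∧ 0 < κ * ν * (g d).eval t := by
        have h1 : ν * (g d).eval t ≠ 0 := mul_ne_zero (fun h => by simp [h] at hνν) (ht d hd)
        rcases h1.lt_or_gt with h1 | h1
        · exact ⟨-1, by simp, by linarith⟩
        · exact ⟨1, by simp, by linarith⟩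
      have hu : ∀ θ ∈ Ioc (0 : ℝ) 1, ∀ i, SignType.sign ((g i).eval (t + θ * (κ * (δ / 2)))) =
          SignType.sign ((g i).eval t) := fun θ hθ => hball (by
        rw [Real.dist_eq, add_sub_cancel_left, abs_mul, abs_mul, hκ, one_mul, abs_of_pos hθ.1,
          abs_of_pos (half_pos hδ)]
        nlinarith [hθ.2])
      have hs1 := hu 1 (by simp)
      rw [one_mul] at hs1
      obtain ⟨θ, hθ, e⟩ := p.exists_eval_sub_eq_segment t (t + κ * (δ / 2))
      rw [add_sub_cancel_left, ← hp, h0, sub_zero] at e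
      have h2 : 0 < κ * ν * (g d).eval (t + θ * (κ * (δ / 2))) := by
        rw [← sign_eq_one_iff, sign_mul, hu θ ⟨hθ.1, hθ.2.le⟩, ← sign_mul, sign_eq_one_iff]
        exact hκpos
      obtain ⟨t', ht'1, ht'2⟩ := key (t + κ * (δ / 2)) ν (fun i hi hz => by
        have := hs1 i
        rw [hz, sign_zero] at this
        exact ht i hi (sign_eq_zero_iff.1 this.symm)) hν (by
        rw [e]
        nlinarith [mul_pos (half_pos hδ) h2])
      exact ⟨t', fun i => (hs1 i).symm.trans (ht'1 i), ht'2⟩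
    obtain ⟨a, ha, ha'⟩ := hside 1 (Or.inl rfl)
    obtain ⟨b, hb, hb'⟩ := hside (-1) (Or.inr rfl)
    obtain ⟨c, hc, hc0⟩ := intermediate_value_uIcc (a := a) (b := b)
      q.continuous.continuousOn (show (0 : ℝ) ∈ _ by rw [mem_uIcc]; right; constructor <;> linarith)
    refine ⟨c, fun i => ?_, by rw [h0, show q.eval c = 0 from hc0]⟩
    rcases le_total a b with hab | hab
    · rw [uIcc_of_le hab] at hc
      exact (H.derivClosed_right.sign_eq_of_mem_Icc (fun i => (ha i).symm)
        (fun i => (hb i).symm) i c hc).symm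
    · rw [uIcc_of_ge hab] at hc
      exact (H.derivClosed_right.sign_eq_of_mem_Icc (fun i => (hb i).symm)
        (fun i => (ha i).symm) i c hc).symm
  · obtain ⟨t', h1, h2⟩ := key t 1 ht (Or.inl rfl) (by linarith)
    exact ⟨t', h1, by rw [sign_pos h0, sign_pos (by linarith)]⟩

end SpecPair

section PseudoDivision

open Polynomial

variable {R : Type*} [CommRing R]

theorem Polynomial.exists_pseudoRem (p f : R[X]) (hf : 0 < f.natDegree) :
    ∃ (r q : R[X]) (k : ℕ), C (f.leadingCoeff ^ (2 * k)) * p = q * f + r ∧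
      r.natDegree < f.natDegree := by
  induction hd : p.natDegree using Nat.strong_induction_on generalizing p with
  | _ d ih =>
    by_cases h : p.natDegree < f.natDegree
    · exact ⟨p, 0, 0, by simp, h⟩
    push Not at h
    have hlt : (C f.leadingCoeff * p -
        C p.leadingCoeff * X ^ (p.natDegree - f.natDegree) * f).natDegree < p.natDegree := by
      suffices h' : _ ≤ p.natDegree - 1 from h'.trans_lt (by omega)
      refine natDegree_le_iff_coeff_eq_zero.2 fun m hm => ?_
      replace hm : p.natDegree ≤ m := by omega
      have e : (C p.leadingCoeff * X ^ (p.natDegree - f.natDegree) * f).coeff m =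
          p.leadingCoeff * f.coeff (m - (p.natDegree - f.natDegree)) := by
        rw [mul_assoc, coeff_C_mul, coeff_X_pow_mul', if_pos (by omega)]
      rw [coeff_sub, coeff_C_mul, e]
      rcases hm.lt_or_eq with hm' | rfl
      · rw [coeff_eq_zero_of_natDegree_lt hm', coeff_eq_zero_of_natDegree_lt (by omega)]
        simp
      · rw [show p.natDegree - (p.natDegree - f.natDegree) = f.natDegree by omega]
        simp [mul_comm]
    obtain ⟨r, q, k, e, hr⟩ := ih _ (hd ▸ hlt) _ rfl
    refine ⟨C f.leadingCoeff * r, C f.leadingCoeff * q + C (f.leadingCoeff ^ (2 * k + 1)) *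
      (C p.leadingCoeff * X ^ (p.natDegree - f.natDegree)), k + 1, ?_,
      (natDegree_C_mul_le _ _).trans_lt hr⟩
    rw [← hd] at e
    simp only [C_pow] at e ⊢
    linear_combination C f.leadingCoeff * e

/-- A pseudo-remainder of `p` modulo `f`. -/
def Polynomial.pseudoRem (p f : R[X]) : R[X] :=
  open Classical in if hf : 0 < f.natDegree then (p.exists_pseudoRem f hf).choose else 0

theorem Polynomial.pseudoRem_spec (p f : R[X]) (hf : 0 < f.natDegree) :
    (∃ (q : R[X]) (k : ℕ), C (f.leadingCoeff ^ (2 * k)) * p = q * f + p.pseudoRem f) ∧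
      (p.pseudoRem f).natDegree < f.natDegree := by
  obtain ⟨q, k, e, hr⟩ := (p.exists_pseudoRem f hf).choose_spec
  rw [pseudoRem, dif_pos hf]
  exact ⟨⟨q, k, e⟩, hr⟩

/-- The polynomials obtained from `p` and `f` by the operations used in eliminating the variable. -/
def elimOps (p f : R[X]) : Set R[X] :=
  {derivative f, f.eraseLead, C f.leadingCoeff, p.pseudoRem f}

theorem natDegree_lt_of_mem_elimOps {p f r : R[X]} (hf : 0 < f.natDegree)
    (hr : r ∈ elimOps p f) : r.natDegree < f.natDegree := by
  rcases hr with rfl | rfl | rfl | rfl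
  · exact natDegree_derivative_lt hf.ne'
  · exact (eraseLead_natDegree_le f).trans_lt (by omega)
  · simpa using hf
  · exact (p.pseudoRem_spec f hf).2

/-- A set of polynomials closed under the elimination operations. -/
def ElimClosed (A : Set R[X]) : Prop :=
  ∀ p ∈ A, ∀ f ∈ A, 0 < f.natDegree → f.natDegree ≤ p.natDegree → elimOps p f ⊆ A

theorem exists_finite_elimClosed {S : Set R[X]} (hS : S.Finite) :
    ∃ A, S ⊆ A ∧ A.Finite ∧ ElimClosed A := by
  obtain ⟨d, hd⟩ : ∃ d, ∀ p ∈ S, p.natDegree ≤ d := by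
    obtain ⟨d, hd⟩ := (hS.image natDegree).bddAbove
    exact ⟨d, fun p hp => hd ⟨p, hp, rfl⟩⟩
  have key : ∀ e, ∃ A, S ⊆ A ∧ A.Finite ∧ (∀ p ∈ A, p.natDegree ≤ d) ∧
      ∀ p ∈ A, ∀ f ∈ A, 0 < f.natDegree → f.natDegree ≤ p.natDegree →
        ∀ r ∈ elimOps p f, d ≤ r.natDegree + e → r ∈ A := by
    intro e
    induction e with
    | zero =>
      refine ⟨S, subset_rfl, hS, hd, fun p hp f hf h1 h2 r hr h3 => ?_⟩
      have := natDegree_lt_of_mem_elimOps h1 hr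
      have := hd f hf
      omega
    | succ e ih =>
      obtain ⟨A, hSA, hA, hAd, hcl⟩ := ih
      let N : Set R[X] := {r | r.natDegree + e < d ∧ ∃ p ∈ A, ∃ f ∈ A, r ∈ elimOps p f}
      have hN : N.Finite := by
        refine Finite.subset (hA.biUnion fun p _ => hA.biUnion fun f _ =>
          (show (elimOps p f).Finite from by simp [elimOps])) ?_
        rintro r ⟨-, p, hp, f, hf, hr⟩
        exact mem_biUnion hp (mem_biUnion hf hr)
      refine ⟨A ∪ N, hSA.trans subset_union_left, hA.union hN, ?_, ?_⟩
      · rintro p (hp | hp)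
        · exact hAd p hp
        · have := hp.1
          omega
      · intro p hp f hf h1 h2 r hr h3
        have hlt := natDegree_lt_of_mem_elimOps h1 hr
        have hfA : f ∈ A := hf.resolve_right fun h => by have := h.1; omega
        have hpA : p ∈ A := hp.resolve_right fun h => by have := h.1; omega
        by_cases h4 : d ≤ r.natDegree + e
        · exact Or.inl (hcl p hpA f hfA h1 h2 r hr h4)
        · exact Or.inr ⟨by omega, p, hpA, f, hfA, hr⟩
  obtain ⟨A, hSA, hA, hAd, hcl⟩ := key d
  exact ⟨A, hSA, hA, fun p hp f hf h1 h2 r hr => hcl p hp f hf h1 h2 r hr (by omega)⟩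

theorem Polynomial.map_eq_map_eraseLead {S : Type*} [CommRing S] {χ : R →+* S} {f : R[X]}
    (h : χ f.leadingCoeff = 0) : f.map χ = f.eraseLead.map χ := by
  conv_lhs => rw [← eraseLead_add_C_mul_X_pow f, Polynomial.map_add, Polynomial.map_mul,
    Polynomial.map_C, h, C_0, zero_mul, add_zero]

namespace ElimClosed

variable {B : Set R[X]} {φ ψ : R →+* ℝ}

theorem map_eq_zero (hB : ElimClosed B)
    (hc : ∀ c, C c ∈ B → SignType.sign (φ c) = SignType.sign (ψ c)) {f : R[X]} (hf : f ∈ B)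
    (h0 : f.map φ = 0) : f.map ψ = 0 := by
  induction hd : f.natDegree using Nat.strong_induction_on generalizing f with
  | _ d ih =>
    have hlc : φ f.leadingCoeff = 0 := by
      have := congrArg (fun g => coeff g f.natDegree) h0
      simpa using this
    by_cases hdeg : f.natDegree = 0
    · rw [eq_C_of_natDegree_eq_zero hdeg] at hf ⊢
      have h1 := hc _ hf
      rw [leadingCoeff, hdeg] at hlc
      rw [hlc, sign_zero, eq_comm, sign_eq_zero_iff] at h1
      simp [h1]
    · have hops := hB f hf f hf (Nat.pos_of_ne_zero hdeg) le_rfl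
      have hlt : f.eraseLead.natDegree < d :=
        hd ▸ natDegree_lt_of_mem_elimOps (p := f) (Nat.pos_of_ne_zero hdeg) (by simp [elimOps])
      have h1 := hc _ (hops (show C f.leadingCoeff ∈ _ by simp [elimOps]))
      rw [hlc, sign_zero, eq_comm, sign_eq_zero_iff] at h1
      rw [map_eq_map_eraseLead h1]
      exact ih _ hlt (hops (by simp [elimOps])) (by rw [← map_eq_map_eraseLead hlc, h0]) rfl

theorem specPair (hB : ElimClosed B)
    (hc : ∀ c, C c ∈ B → SignType.sign (φ c) = SignType.sign (ψ c)) :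
    SpecPair (fun i : B => (i : R[X]).map φ) (fun i : B => (i : R[X]).map ψ) where
  deriv := by
    rintro ⟨f, hf⟩
    by_cases hdeg : f.natDegree = 0
    · left
      constructor <;> exact Nat.eq_zero_of_le_zero (natDegree_map_le.trans hdeg.le)
    · right
      exact ⟨⟨derivative f, hB f hf f hf (Nat.pos_of_ne_zero hdeg) le_rfl (by simp [elimOps])⟩,
        (derivative_map _ _).symm, (derivative_map _ _).symm⟩
  zero_iff := fun ⟨f, hf⟩ =>
    ⟨hB.map_eq_zero hc hf, hB.map_eq_zero (fun c h => (hc c h).symm) hf⟩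

theorem sign_eq_of_root (hB : ElimClosed B) {p : R[X]}
    (hp : ∀ f ∈ B, 0 < f.natDegree → p.pseudoRem f ∈ B) {t t' : ℝ}
    (htt' : SameSigns (fun i : B => (i : R[X]).map φ) (fun i : B => (i : R[X]).map ψ) t t')
    {f : R[X]} (hf : f ∈ B) (hf0 : f.map φ ≠ 0) (hft : (f.map φ).eval t = 0) :
    SignType.sign ((p.map φ).eval t) = SignType.sign ((p.map ψ).eval t') := by
  induction hd : f.natDegree using Nat.strong_induction_on generalizing f with
  | _ d ih =>
    have hdeg : 0 < f.natDegree := by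
      by_contra h
      have h := Nat.eq_zero_of_not_pos h
      rw [eq_C_of_natDegree_eq_zero h] at hft hf0
      simp at hft
      simp [hft] at hf0
    have hops := hB f hf f hf hdeg le_rfl
    by_cases hlc : φ f.leadingCoeff = 0
    · have hE := map_eq_map_eraseLead hlc
      exact ih _ (hd ▸ natDegree_lt_of_mem_elimOps (p := f) hdeg (by simp [elimOps]))
        (hops (show f.eraseLead ∈ _ by simp [elimOps])) (hE ▸ hf0) (hE ▸ hft) rfl
    · obtain ⟨⟨q, k, e⟩, -⟩ := p.pseudoRem_spec f hdeg
      have h1 : SignType.sign (φ f.leadingCoeff) = SignType.sign (ψ f.leadingCoeff) := by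
        simpa using htt' ⟨C f.leadingCoeff, hops (by simp [elimOps])⟩
      have hlc' : ψ f.leadingCoeff ≠ 0 := fun h => hlc (by simpa [h] using h1)
      have hft' : (f.map ψ).eval t' = 0 := by simpa [hft] using (htt' ⟨f, hf⟩).symm
      have aux : ∀ (χ : R →+* ℝ) (s : ℝ), χ f.leadingCoeff ≠ 0 → (f.map χ).eval s = 0 →
          SignType.sign ((p.map χ).eval s) =
            SignType.sign (((p.pseudoRem f).map χ).eval s) := by
        intro χ s h2 h3
        have h4 := congrArg (fun g => (g.map χ).eval s) e
        simp only [Polynomial.map_mul, Polynomial.map_add, eval_mul, eval_add, h3, mul_zero,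
          zero_add, Polynomial.map_C, eval_C] at h4
        rw [map_pow] at h4
        rw [← h4, sign_mul, sign_pos ((even_two_mul k).pow_pos h2 : 0 < χ f.leadingCoeff ^ (2 * k)),
          one_mul]
      rw [aux φ t hlc hft, aux ψ t' hlc' hft']
      exact htt' ⟨_, hp f hf hdeg⟩

end ElimClosed

/-- Elimination of one variable: the sign conditions realized along a line by a finite
`ElimClosed` family are determined by the signs of its constant members. -/
theorem ElimClosed.exists_sameSigns {A : Set R[X]} (hfin : A.Finite) (hA : ElimClosed A)
    {φ ψ : R →+* ℝ} (hc : ∀ c, C c ∈ A → SignType.sign (φ c) = SignType.sign (ψ c)) (t : ℝ) :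
    ∃ t', ∀ f ∈ A, SignType.sign ((f.map φ).eval t) = SignType.sign ((f.map ψ).eval t') := by
  induction hcard : A.ncard generalizing A φ ψ t with
  | zero =>
    rw [Set.ncard_eq_zero hfin] at hcard
    exact ⟨0, by simp [hcard]⟩
  | succ m ih =>
    have hne : A.Nonempty := by
      rw [← Set.ncard_pos hfin]
      omega
    obtain ⟨p, hpA, hmax⟩ := A.exists_max_image natDegree hfin hne
    by_cases hp0 : p.natDegree = 0
    · refine ⟨0, fun f hf => ?_⟩
      have h0 : f.natDegree = 0 := Nat.eq_zero_of_le_zero ((hmax f hf).trans hp0.le)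
      rw [eq_C_of_natDegree_eq_zero h0] at hf ⊢
      simpa using hc _ hf
    have hp0 : 0 < p.natDegree := Nat.pos_of_ne_zero hp0
    have hsub : ∀ q ∈ A, ∀ f ∈ A, 0 < f.natDegree → f.natDegree ≤ q.natDegree →
        elimOps q f ⊆ A \ {p} := fun q hq f hf h1 h2 r hr =>
      ⟨hA q hq f hf h1 h2 hr, fun h => by
        have h3 := natDegree_lt_of_mem_elimOps h1 hr
        have h4 := hmax f hf
        rw [mem_singleton_iff] at h
        subst h
        omega⟩
    have hB : ElimClosed (A \ {p}) := fun q hq f hf => hsub q hq.1 f hf.1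
    have hBfin : (A \ {p}).Finite := hfin.sdiff
    have hBcard : (A \ {p}).ncard = m := by
      rw [Set.ncard_sdiff_singleton_of_mem hpA, hcard]
      rfl
    have hpB := hsub p hpA p hpA hp0 le_rfl
    have hcB : ∀ c, C c ∈ A \ {p} → SignType.sign (φ c) = SignType.sign (ψ c) :=
      fun c h => hc c h.1
    have hprem : ∀ f ∈ A \ {p}, 0 < f.natDegree → p.pseudoRem f ∈ A \ {p} := fun f hf h =>
      hsub p hpA f hf.1 h (hmax f hf.1) (by simp [elimOps])
    have h1 : ∀ t, ∃ t', SameSigns (fun i : ↥(A \ {p}) => (i : R[X]).map φ)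
        (fun i : ↥(A \ {p}) => (i : R[X]).map ψ) t t' := fun t => by
      obtain ⟨t', h⟩ := ih hBfin hB hcB t hBcard
      exact ⟨t', fun i => h i i.2⟩
    have h2 : ∀ t', ∃ t, SameSigns (fun i : ↥(A \ {p}) => (i : R[X]).map φ)
        (fun i : ↥(A \ {p}) => (i : R[X]).map ψ) t t' := fun t' => by
      obtain ⟨t, h⟩ := ih hBfin hB (fun c h => (hcB c h).symm) t' hBcard
      exact ⟨t, fun i => (h i i.2).symm⟩
    suffices h : ∃ t', SameSigns (fun i : ↥(A \ {p}) => (i : R[X]).map φ)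
        (fun i : ↥(A \ {p}) => (i : R[X]).map ψ) t t' ∧
        SignType.sign ((p.map φ).eval t) = SignType.sign ((p.map ψ).eval t') by
      obtain ⟨t', ht', hp'⟩ := h
      refine ⟨t', fun f hf => ?_⟩
      by_cases hfp : f = p
      · rw [hfp, hp']
      · exact ht' ⟨f, hf, hfp⟩
    by_cases hlc : φ p.leadingCoeff = 0
    · have hlc' : ψ p.leadingCoeff = 0 := by
        simpa [hlc] using (hc _ (hpB (show C p.leadingCoeff ∈ _ by simp [elimOps])).1).symm
      obtain ⟨t', ht'⟩ := h1 t
      refine ⟨t', ht', ?_⟩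
      rw [map_eq_map_eraseLead hlc, map_eq_map_eraseLead hlc']
      exact ht' ⟨p.eraseLead, hpB (by simp [elimOps])⟩
    · have : Finite ↥(A \ {p}) := hBfin
      refine (hB.specPair hcB).exists_sameSigns_extend
        (d := ⟨derivative p, hpB (by simp [elimOps])⟩) (derivative_map _ _).symm
        (derivative_map _ _).symm ?_ h1 h2 ?_ t
      · simp only [← derivative_map]
        intro h
        have := derivative_eq_zero.1 h
        rw [natDegree_map_of_leadingCoeff_ne_zero _ hlc] at this
        omega
      · rintro t t' htt' ⟨f, hf⟩ hf0 hft
        exact hB.sign_eq_of_root hprem htt' hf hf0 hft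

end PseudoDivision

section NagataShear

open MvPolynomial

variable {n : ℕ}

/-- The triangular substitution `X_i ↦ X_i + c X_0 ^ (N ^ i)` for `i ≠ 0`, fixing `X_0`. -/
def nagataShear (N : ℕ) (c : ℝ) :
    MvPolynomial (Fin (n + 1)) ℝ →ₐ[ℝ] MvPolynomial (Fin (n + 1)) ℝ :=
  aeval fun i => if i = 0 then X 0 else X i + c • X 0 ^ N ^ i.1

theorem nagataShear_comp_neg (N : ℕ) (c : ℝ) :
    (nagataShear (n := n) N c).comp (nagataShear N (-c)) = AlgHom.id _ _ := by
  rw [nagataShear, nagataShear, comp_aeval, ← MvPolynomial.aeval_X_left]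
  ext i v
  cases i using Fin.cases <;> simp

/-- The substitution `nagataShear N 1` as an automorphism. -/
def nagataEquiv (N : ℕ) : MvPolynomial (Fin (n + 1)) ℝ ≃ₐ[ℝ] MvPolynomial (Fin (n + 1)) ℝ :=
  AlgEquiv.ofAlgHom (nagataShear N 1) (nagataShear N (-1)) (nagataShear_comp_neg N 1)
    (by simpa using nagataShear_comp_neg N (-1))

/-- The polynomial map underlying `nagataShear`. -/
def nagataMap (N : ℕ) (c : ℝ) (x : Fin (n + 1) → ℝ) : Fin (n + 1) → ℝ :=
  fun i => if i = 0 then x 0 else x i + c * x 0 ^ N ^ i.1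

theorem eval_nagataShear (N : ℕ) (c : ℝ) (x : Fin (n + 1) → ℝ)
    (p : MvPolynomial (Fin (n + 1)) ℝ) :
    eval x (nagataShear N c p) = eval (nagataMap N c x) p := by
  have : (aeval x : _ →ₐ[ℝ] ℝ).comp (nagataShear N c) = aeval (nagataMap N c x) := by
    ext i
    by_cases hi : i = 0 <;> simp [nagataShear, nagataMap, hi]
  simpa [coe_aeval_eq_eval] using congrArg (fun φ => φ p) this

theorem continuous_nagataMap (N : ℕ) (c : ℝ) : Continuous (nagataMap (n := n) N c) := by
  refine continuous_pi fun i => ?_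
  by_cases hi : i = 0
  · simpa [nagataMap, hi] using continuous_apply 0
  · simp only [nagataMap, hi, if_false]
    fun_prop

/-- `nagataMap` as a homeomorphism. -/
def nagataHomeomorph (N : ℕ) (c : ℝ) : (Fin (n + 1) → ℝ) ≃ₜ (Fin (n + 1) → ℝ) where
  toFun := nagataMap N c
  invFun := nagataMap N (-c)
  left_inv x := by
    ext i
    by_cases hi : i = 0 <;> simp [nagataMap, hi]
  right_inv x := by
    ext i
    by_cases hi : i = 0 <;> simp [nagataMap, hi]
  continuous_toFun := continuous_nagataMap N c
  continuous_invFun := continuous_nagataMap N (-c)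

variable (f : MvPolynomial (Fin (n + 1)) ℝ) (v w : Fin (n + 1) →₀ ℕ)

theorem sum_nagata_exponents_ne {N : ℕ} (hN : 1 < N) (vlt : ∀ i, v i < N) (wlt : ∀ i, w i < N)
    (ne : v ≠ w) :
    ∑ x : Fin (n + 1), N ^ x.1 * v x ≠ ∑ x : Fin (n + 1), N ^ x.1 * w x := by
  intro h
  refine ne <| Finsupp.ext <| congrFun <| List.ofFn_inj.mp ?_
  apply Nat.ofDigits_inj_of_len_eq hN (by simp) (by grind) (by grind)
  simpa only [Nat.ofDigits_eq_sum_mapIdx, List.mapIdx_eq_ofFn, List.get_ofFn, List.length_ofFn,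
    Fin.val_cast, mul_comm, List.sum_ofFn] using! h

theorem degreeOf_zero_nagataEquiv (N : ℕ) {a : ℝ} (ha : a ≠ 0) :
    (nagataEquiv N (monomial v a)).degreeOf 0 = ∑ i : Fin (n + 1), N ^ i.1 * v i := by
  rw [← natDegree_finSuccEquiv, monomial_eq, Finsupp.prod_pow v fun a => X a]
  simp only [nagataEquiv, nagataShear, Fin.prod_univ_succ, Fin.sum_univ_succ, map_mul, map_prod,
    map_pow, AlgEquiv.ofAlgHom_apply, MvPolynomial.aeval_C, MvPolynomial.aeval_X, if_pos,
    Fin.succ_ne_zero, ite_false, one_smul, map_add, finSuccEquiv_X_zero, finSuccEquiv_X_succ,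
    algebraMap_eq]
  have h (i : Fin n) :
      (Polynomial.C (X (R := ℝ) i) + Polynomial.X ^ N ^ i.succ.1) ^ v i.succ ≠ 0 := by
    refine pow_ne_zero (v i.succ) fun h0 => ?_
    have := congrArg (fun q => Polynomial.eval₂ (MvPolynomial.eval fun _ => (1 : ℝ)) 1 q) h0
    simp at this
  rw [Polynomial.natDegree_mul (by simp [ha]) (mul_ne_zero (by simp) (Finset.prod_ne_zero_iff.mpr
    (fun i _ => h i))), Polynomial.natDegree_mul (by simp) (Finset.prod_ne_zero_iff.mpr
    (fun i _ => h i)), Polynomial.natDegree_prod _ _ (fun i _ => h i), natDegree_finSuccEquiv,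
    degreeOf_C]
  simpa only [Polynomial.natDegree_pow, zero_add, Polynomial.natDegree_X, mul_one, Fin.val_zero,
    pow_zero, one_mul, add_right_inj] using Finset.sum_congr rfl (fun i _ => by
    rw [add_comm (Polynomial.C _), Polynomial.natDegree_X_pow_add_C, mul_comm])

theorem leadingCoeff_finSuccEquiv_nagataEquiv {N : ℕ} (hN : 0 < N) (a : ℝ) :
    (finSuccEquiv ℝ n (nagataEquiv N (monomial v a))).leadingCoeff = algebraMap ℝ _ a := by
  rw [monomial_eq, Finsupp.prod_fintype]
  · simp only [map_mul, map_prod, Polynomial.leadingCoeff_mul, Polynomial.leadingCoeff_prod]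
    have h1 : finSuccEquiv ℝ n (nagataEquiv N (C a)) = Polynomial.C (C a) := by
      rw [← algebraMap_eq, AlgEquiv.commutes, AlgEquiv.commutes]
      rfl
    have : ∀ j, ((finSuccEquiv ℝ n) (nagataEquiv N (X j))).leadingCoeff = 1 := fun j => by
      by_cases h : j = 0
      · simp [nagataEquiv, nagataShear, h, finSuccEquiv_X_zero]
      · obtain ⟨i, rfl⟩ := Fin.exists_succ_eq.mpr h
        have := Polynomial.leadingCoeff_X_pow_add_C (R := MvPolynomial (Fin n) ℝ)
          (n := N ^ i.succ.1) (pow_pos hN _) (r := X i)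
        simpa [nagataEquiv, nagataShear, finSuccEquiv_X_succ, finSuccEquiv_X_zero, add_comm]
          using this
    simp only [h1, map_pow, Polynomial.leadingCoeff_pow, this, one_pow, Finset.prod_const_one,
      mul_one, Polynomial.leadingCoeff_C, algebraMap_eq]
  · exact fun i => pow_zero _

/-- A nonzero polynomial becomes quasi-monic in the variable `X_0` after a triangular change of
coordinates. -/
theorem isUnit_leadingCoeff_nagataEquiv (fne : f ≠ 0) :
    IsUnit (finSuccEquiv ℝ n (nagataEquiv (2 + f.totalDegree) f)).leadingCoeff := by
  set N := 2 + f.totalDegree with hN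
  obtain ⟨v, vin, vs⟩ := Finset.exists_max_image f.support
    (fun v => (nagataEquiv N ((monomial v) (coeff v f))).degreeOf 0) (support_nonempty.mpr fne)
  set h := fun w => (MvPolynomial.monomial w) (coeff w f)
  simp only [← natDegree_finSuccEquiv] at vs
  have hlt : ∀ w ∈ f.support, ∀ i, w i < N := fun w hw i =>
    ((monomial_le_degreeOf i hw).trans (degreeOf_le_totalDegree f i)).trans_lt (by omega)
  replace vs : ∀ x ∈ f.support \ {v}, (finSuccEquiv ℝ n (nagataEquiv N (h x))).degree <
      (finSuccEquiv ℝ n (nagataEquiv N (h v))).degree := by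
    intro x hx
    obtain ⟨h1, h2⟩ := Finset.mem_sdiff.mp hx
    apply Polynomial.degree_lt_degree <| lt_of_le_of_ne (vs x h1) ?_
    rw [natDegree_finSuccEquiv, natDegree_finSuccEquiv,
      degreeOf_zero_nagataEquiv _ _ (mem_support_iff.mp h1),
      degreeOf_zero_nagataEquiv _ _ (mem_support_iff.mp vin)]
    exact sum_nagata_exponents_ne _ _ (by omega) (hlt x h1) (hlt v vin)
      (fun h => h2 (by simp [h]))
  have coeff : (finSuccEquiv ℝ n (nagataEquiv N (h v + ∑ x ∈ f.support \ {v}, h x))).leadingCoeff =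
      (finSuccEquiv ℝ n (nagataEquiv N (h v))).leadingCoeff := by
    simp only [map_add, map_sum]
    rw [add_comm]
    apply Polynomial.leadingCoeff_add_of_degree_lt <|
      (lt_of_le_of_lt <| Polynomial.degree_sum_le _ _) ?_
    have h2 : h v ≠ 0 := by simpa [h] using mem_support_iff.mp vin
    replace h2 : (finSuccEquiv ℝ n (nagataEquiv N (h v))) ≠ 0 := fun eq => h2 <|
      by simpa only [map_eq_zero_iff _ (AlgEquiv.injective _)] using eq
    exact (Finset.sup_lt_iff <| Ne.bot_lt (fun x => h2 <| Polynomial.degree_eq_bot.mp x)).mpr vs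
  nth_rw 1 [← f.support_sum_monomial_coeff]
  rw [Finset.sum_eq_add_sum_sdiff_singleton_of_mem vin h]
  rw [leadingCoeff_finSuccEquiv_nagataEquiv _ (by omega)] at coeff
  simpa only [coeff, algebraMap_eq] using (mem_support_iff.mp vin).isUnit.map MvPolynomial.C

end NagataShear

section Stratifying

open MvPolynomial Filter Topology SignType

theorem eventually_sign_eq_of_tendsto {α : Type*} {l : Filter α} {a : α → ℝ} {c : ℝ}
    (h : Tendsto a l (𝓝 c)) (hc : c ≠ 0) : ∀ᶠ k in l, sign (a k) = sign c :=
  ((continuousAt_sign_of_ne_zero hc).tendsto.comp h).eventually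
    ((isOpen_discrete {sign c}).mem_nhds rfl)

theorem signDegen_of_tendsto {α : Type*} {l : Filter α} [l.NeBot] {a : α → ℝ} {c : ℝ}
    {σ : SignType} (h : Tendsto a l (𝓝 c)) (hs : ∀ᶠ k in l, sign (a k) = σ) :
    SignDegen (sign c) σ := by
  by_cases hc : c = 0
  · exact Or.inl (by simp [hc])
  · obtain ⟨k, hk, hk'⟩ := ((eventually_sign_eq_of_tendsto h hc).and hs).exists
    exact Or.inr (hk.symm.trans hk')

variable {n : ℕ}

theorem continuous_eval_map_eval (f : Polynomial (MvPolynomial (Fin n) ℝ)) :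
    Continuous fun z : ℝ × (Fin n → ℝ) => (f.map (eval z.2)).eval z.1 := by
  simp only [Polynomial.eval_map, Polynomial.eval₂_eq_sum_range]
  refine continuous_finsetSum _ fun i _ => ?_
  exact ((MvPolynomial.continuous_eval _).comp continuous_snd).mul (continuous_fst.pow i)

theorem map_eval_ne_zero {f : Polynomial (MvPolynomial (Fin n) ℝ)} (hf : IsUnit f.leadingCoeff)
    (x : Fin n → ℝ) : f.map (eval x) ≠ 0 := fun h => (hf.map (eval x)).ne_zero <| by
  rw [Polynomial.leadingCoeff, ← Polynomial.coeff_map, h, Polynomial.coeff_zero]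

/-- The roots of a quasi-monic polynomial are locally uniformly bounded. -/
theorem exists_eventually_root_bound {f : Polynomial (MvPolynomial (Fin n) ℝ)}
    (hf : IsUnit f.leadingCoeff) (x₀ : Fin n → ℝ) :
    ∃ R : ℝ, ∀ᶠ x in 𝓝 x₀, ∀ t, (f.map (eval x)).eval t = 0 → |t| < R := by
  have hne : ∀ x, eval x f.leadingCoeff ≠ 0 := fun x => (hf.map (eval x)).ne_zero
  have hcont : Continuous fun x : Fin n → ℝ => (f.map (eval x)).cauchyBound := by
    simp only [Polynomial.cauchyBound, Polynomial.coeff_map,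
      Polynomial.leadingCoeff_map_of_leadingCoeff_ne_zero _ (hne _),
      Polynomial.natDegree_map_of_leadingCoeff_ne_zero _ (hne _)]
    refine Continuous.add (Continuous.div ?_ ?_ ?_) continuous_const
    · exact Continuous.finset_sup_apply fun i _ => (MvPolynomial.continuous_eval _).nnnorm
    · exact (MvPolynomial.continuous_eval _).nnnorm
    · exact fun x => nnnorm_ne_zero_iff.mpr (hne x)
  refine ⟨(f.map (eval x₀)).cauchyBound + 1, ?_⟩
  have := (hcont.tendsto x₀).eventually (gt_mem_nhds (lt_add_one _))
  filter_upwards [this] with x hx t ht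
  have h1 := Polynomial.IsRoot.norm_lt_cauchyBound (map_eval_ne_zero hf x) ht
  have h2 : ‖t‖₊ < (f.map (eval x₀)).cauchyBound + 1 := h1.trans hx
  exact_mod_cast h2

/-- Clamping a point to `[-R, R]` does not change the sign of a function without zeros outside. -/
theorem sign_clamp_eq {f : ℝ → ℝ} (hf : Continuous f) {R : ℝ} (hR : 0 ≤ R)
    (h : ∀ t, f t = 0 → |t| < R) (t : ℝ) : sign (f (max (-R) (min R t))) = sign (f t) := by
  have key : ∀ s, R ≤ |s| → f s ≠ 0 := fun s hs h0 => (h s h0).not_ge hs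
  rcases le_total t (-R) with h1 | h1
  · rw [min_eq_right (by linarith), max_eq_left h1]
    refine (sign_eq_of_ne_zero_on_Icc hf h1 fun s hs => key s ?_).symm
    rw [abs_of_nonpos (by linarith [hs.2])]
    linarith [hs.2]
  rcases le_total R t with h2 | h2
  · rw [min_eq_left h2, max_eq_right (by linarith)]
    refine sign_eq_of_ne_zero_on_Icc hf h2 fun s hs => key s ?_
    exact hs.1.trans (le_abs_self s)
  · rw [min_eq_right h2, max_eq_right h1]

/-- Weakening strict sign conditions from `H` to non-strict ones amounts to taking closures. -/
def IsStratifying (H : Set (MvPolynomial (Fin n) ℝ)) : Prop :=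
  ∀ x₀ x₁ : Fin n → ℝ, (∀ h ∈ H, SignDegen (sign (eval x₀ h)) (sign (eval x₁ h))) →
    x₀ ∈ closure {x | ∀ h ∈ H, sign (eval x h) = sign (eval x₁ h)}

theorem IsStratifying.mem_closure_cylinder {F : Set (Polynomial (MvPolynomial (Fin n) ℝ))}
    (hF : F.Finite) (hlc : ∀ f ∈ F, IsUnit f.leadingCoeff)
    (hder : ∀ f ∈ F, f.natDegree = 0 ∨ Polynomial.derivative f ∈ F)
    {G : Set (MvPolynomial (Fin n) ℝ)} (hG : IsStratifying G)
    (hdet : ∀ x x', (∀ g ∈ G, sign (eval x g) = sign (eval x' g)) → ∀ t, ∃ t', ∀ f ∈ F,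
      sign ((f.map (eval x)).eval t) = sign ((f.map (eval x')).eval t'))
    {x₀ x₁ : Fin n → ℝ} {t₀ t₁ : ℝ}
    (h0 : ∀ g ∈ G, SignDegen (sign (eval x₀ g)) (sign (eval x₁ g)))
    (hF0 : ∀ f ∈ F, SignDegen (sign ((f.map (eval x₀)).eval t₀))
      (sign ((f.map (eval x₁)).eval t₁))) :
    (t₀, x₀) ∈ closure {z : ℝ × (Fin n → ℝ) | (∀ g ∈ G, sign (eval z.2 g) = sign (eval x₁ g)) ∧
      ∀ f ∈ F, sign ((f.map (eval z.2)).eval z.1) = sign ((f.map (eval x₁)).eval t₁)} := by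
  obtain ⟨x, hx, hxlim⟩ := mem_closure_iff_seq_limit.mp (hG x₀ x₁ h0)
  choose t ht using fun k => hdet x₁ (x k) (fun g hg => (hx k g hg).symm) t₁
  choose! Rf hRf using fun f hf => exists_eventually_root_bound (hlc f hf) x₀
  obtain ⟨R, hR⟩ := (hF.image Rf).bddAbove
  have hbound : ∀ᶠ y in 𝓝 x₀, ∀ f ∈ F, ∀ s, (f.map (eval y)).eval s = 0 → |s| < max R 0 := by
    refine (eventually_all_finite hF).mpr fun f hf => (hRf f hf).mono fun y hy s hs => ?_
    exact (hy s hs).trans_le ((hR ⟨f, hf, rfl⟩).trans (le_max_left _ _))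
  set R' := max R 0
  have hR' : 0 ≤ R' := le_max_right _ _
  set u : ℕ → ℝ := fun k => max (-R') (min R' (t k))
  have hu : ∀ k, u k ∈ Icc (-R') R' := fun k =>
    ⟨le_max_left _ _, max_le (by linarith) (min_le_left _ _)⟩
  have hsgn : ∀ᶠ k in atTop, ∀ f ∈ F,
      sign ((f.map (eval (x k))).eval (u k)) = sign ((f.map (eval x₁)).eval t₁) := by
    filter_upwards [hxlim.eventually hbound] with k hk f hf
    rw [ht k f hf]
    exact sign_clamp_eq (f.map (eval (x k))).continuous hR' (hk f hf) (t k)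
  obtain ⟨b, -, θ, hθ, hb⟩ := isCompact_Icc.tendsto_subseq hu
  have hxθ := hxlim.comp hθ.tendsto_atTop
  have hsθ := hθ.tendsto_atTop.eventually hsgn
  have hlim : Tendsto (fun k => (u (θ k), x (θ k))) atTop (𝓝 (b, x₀)) := hb.prodMk_nhds hxθ
  have hbdeg : ∀ f ∈ F, SignDegen (sign ((f.map (eval x₀)).eval b))
      (sign ((f.map (eval x₁)).eval t₁)) := fun f hf =>
    signDegen_of_tendsto (((continuous_eval_map_eval f).tendsto (b, x₀)).comp hlim)
      (hsθ.mono fun k hk => hk f hf)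
  by_cases hbt : b = t₀
  · subst hbt
    exact mem_closure_of_tendsto hlim (hsθ.mono fun k hk => ⟨hx _, hk⟩)
  have hroots : (⋃ f ∈ F, {s | (f.map (eval x₀)).eval s = 0}).Finite :=
    hF.biUnion fun f hf => Polynomial.finite_setOfPred_isRoot (map_eval_ne_zero (hlc f hf) x₀)
  have hclosed : IsClosed {s : ℝ | (s, x₀) ∈ closure {z : ℝ × (Fin n → ℝ) |
      (∀ g ∈ G, sign (eval z.2 g) = sign (eval x₁ g)) ∧
      ∀ f ∈ F, sign ((f.map (eval z.2)).eval z.1) = sign ((f.map (eval x₁)).eval t₁)}} :=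
    isClosed_closure.preimage (by fun_prop)
  have hseg : t₀ ∈ closure (Ioo (min b t₀) (max b t₀) ∩
      (⋃ f ∈ F, {s | (f.map (eval x₀)).eval s = 0})ᶜ) := by
    have h1 := (hroots.countable.dense_compl ℝ).open_subset_closure_inter
      (isOpen_Ioo (a := min b t₀) (b := max b t₀))
    have h2 := closure_minimal h1 isClosed_closure
    refine h2 ?_
    rw [closure_Ioo (by simpa using hbt)]
    exact ⟨min_le_right _ _, le_max_right _ _⟩
  refine closure_minimal ?_ hclosed hseg
  rintro s ⟨hs, hsr⟩
  have hDC : DerivClosed fun f : F => f.1.map (eval x₀) := fun f =>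
    (hder f.1 f.2).imp (fun h => Nat.le_zero.mp (Polynomial.natDegree_map_le.trans h.le))
      fun h => ⟨⟨_, h⟩, (Polynomial.derivative_map _ _).symm⟩
  have hsd := fun f (hf : f ∈ F) => hDC.signDegen_of_mem_uIcc
    (σ := fun f : F => sign ((f.1.map (eval x₁)).eval t₁)) (fun f => hbdeg f.1 f.2)
    (fun f => hF0 f.1 f.2) ⟨f, hf⟩ s (Ioo_subset_Icc_self hs)
  have hne : ∀ f ∈ F, (f.map (eval x₀)).eval s ≠ 0 := fun f hf h =>
    hsr (mem_biUnion hf h)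
  have hev : ∀ᶠ k in atTop, ∀ f ∈ F,
      sign ((f.map (eval (x k))).eval s) = sign ((f.map (eval x₁)).eval t₁) := by
    refine (eventually_all_finite hF).mpr fun f hf => ?_
    have h1 : sign ((f.map (eval x₀)).eval s) = sign ((f.map (eval x₁)).eval t₁) :=
      (hsd f hf).resolve_left (fun h => hne f hf (sign_eq_zero_iff.mp h))
    rw [← h1]
    exact eventually_sign_eq_of_tendsto (((continuous_eval_map_eval f).tendsto (s, x₀)).comp
      (tendsto_const_nhds.prodMk_nhds hxlim)) (hne f hf)
  exact mem_closure_of_tendsto (tendsto_const_nhds.prodMk_nhds hxlim)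
    (hev.mono fun k hk => ⟨hx k, hk⟩)

theorem isStratifying_of_subsingleton [Subsingleton (Fin n → ℝ)]
    (H : Set (MvPolynomial (Fin n) ℝ)) : IsStratifying H := fun x₀ x₁ _ =>
  subset_closure fun _ _ => by rw [Subsingleton.elim x₀ x₁]

theorem IsStratifying.insert_zero {H : Set (MvPolynomial (Fin n) ℝ)} (hH : IsStratifying H) :
    IsStratifying (insert 0 H) := fun x₀ x₁ h => by
  simpa using hH x₀ x₁ fun g hg => h g (mem_insert_of_mem 0 hg)

theorem IsStratifying.image {H : Set (MvPolynomial (Fin n) ℝ)} (hH : IsStratifying H)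
    (e : MvPolynomial (Fin n) ℝ → MvPolynomial (Fin n) ℝ) (τ : (Fin n → ℝ) ≃ₜ (Fin n → ℝ))
    (hτ : ∀ x p, eval x (e p) = eval (τ x) p) : IsStratifying (e '' H) := by
  intro x₀ x₁ h
  simp only [forall_mem_image, hτ] at h ⊢
  have := hH (τ x₀) (τ x₁) h
  change x₀ ∈ closure (τ ⁻¹' {x | ∀ h ∈ H, sign (eval x h) = sign (eval (τ x₁) h)})
  rw [← τ.preimage_closure]
  exact this

theorem IsStratifying.cylinder {F : Set (Polynomial (MvPolynomial (Fin n) ℝ))}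
    (hF : F.Finite) (hlc : ∀ f ∈ F, IsUnit f.leadingCoeff)
    (hder : ∀ f ∈ F, f.natDegree = 0 ∨ Polynomial.derivative f ∈ F)
    {G : Set (MvPolynomial (Fin n) ℝ)} (hG : IsStratifying G)
    (hdet : ∀ x x', (∀ g ∈ G, sign (eval x g) = sign (eval x' g)) → ∀ t, ∃ t', ∀ f ∈ F,
      sign ((f.map (eval x)).eval t) = sign ((f.map (eval x')).eval t')) :
    IsStratifying ((finSuccEquiv ℝ n).symm '' F ∪ rename Fin.succ '' G) := by
  have h1 : ∀ (y : Fin (n + 1) → ℝ) f, eval y ((finSuccEquiv ℝ n).symm f) =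
      (f.map (eval (Fin.tail y))).eval (y 0) := fun y f => by
    rw [← Fin.cons_self_tail y, eval_eq_eval_mv_eval', AlgEquiv.apply_symm_apply]
    simp
  have h2 : ∀ (y : Fin (n + 1) → ℝ) g, eval y (rename Fin.succ g) = eval (Fin.tail y) g :=
    fun y g => eval_rename _ _ _
  intro y₀ y₁ h
  simp only [mem_union, or_imp, forall_and, forall_mem_image, h1, h2] at h ⊢
  have key := IsStratifying.mem_closure_cylinder hF hlc hder hG hdet h.2 h.1
  have hc : Continuous fun z : ℝ × (Fin n → ℝ) => (Fin.cons z.1 z.2 : Fin (n + 1) → ℝ) :=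
    Continuous.finCons (A := fun _ => ℝ) continuous_fst continuous_snd
  have := map_mem_closure hc key (t := {y : Fin (n + 1) → ℝ |
    (∀ f ∈ F, sign ((f.map (eval (Fin.tail y))).eval (y 0)) =
      sign ((f.map (eval (Fin.tail y₁))).eval (y₁ 0))) ∧
    ∀ g ∈ G, sign (eval (Fin.tail y) g) = sign (eval (Fin.tail y₁) g)}) fun z hz => by
      simpa using hz.symm
  simpa using this

theorem exists_finite_derivClosed {f : Polynomial (MvPolynomial (Fin n) ℝ)}
    (hf : IsUnit f.leadingCoeff) : ∃ F : Set (Polynomial (MvPolynomial (Fin n) ℝ)), F.Finite ∧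
      f ∈ F ∧ (∀ f ∈ F, IsUnit f.leadingCoeff) ∧
      ∀ f ∈ F, f.natDegree = 0 ∨ Polynomial.derivative f ∈ F := by
  induction hd : f.natDegree generalizing f with
  | zero => exact ⟨{f}, finite_singleton f, rfl, by simpa using hf, by simpa using Or.inl hd⟩
  | succ d ih =>
    have hdeg : (Polynomial.derivative f).natDegree = d := by
      rw [Polynomial.natDegree_derivative, hd, Nat.add_sub_cancel]
    have hlc : IsUnit (Polynomial.derivative f).leadingCoeff := by
      rw [Polynomial.leadingCoeff, hdeg, Polynomial.coeff_derivative, ← hd,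
        Polynomial.coeff_natDegree]
      refine hf.mul ?_
      have : ((d : MvPolynomial (Fin n) ℝ) + 1) = C ((d : ℝ) + 1) := by simp
      rw [this]
      exact (Nat.cast_add_one_ne_zero d).isUnit.map C
    obtain ⟨F, hF, hmem, hu, hder⟩ := ih hlc hdeg
    refine ⟨insert f F, hF.insert f, mem_insert _ _, ?_, ?_⟩
    · rintro g (rfl | hg)
      exacts [hf, hu g hg]
    · rintro g (rfl | hg)
      exacts [Or.inr (mem_insert_of_mem _ hmem), (hder g hg).imp_right (mem_insert_of_mem _)]

/-- Every finite family of polynomials extends to a finite stratifying family. -/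
theorem exists_finite_isStratifying (n : ℕ) (S : Set (MvPolynomial (Fin n) ℝ)) (hS : S.Finite) :
    ∃ H, S ⊆ H ∧ H.Finite ∧ IsStratifying H := by
  induction n with
  | zero => exact ⟨S, subset_rfl, hS, isStratifying_of_subsingleton S⟩
  | succ n ih =>
    have hS' : (S \ {0}).Finite := hS.sdiff
    set f₀ := ∏ f ∈ hS'.toFinset, f with hf₀
    have hne : f₀ ≠ 0 := Finset.prod_ne_zero_iff.mpr fun f hf => (hS'.mem_toFinset.mp hf).2
    set N := 2 + f₀.totalDegree with hN
    have hunit : ∀ f ∈ S \ {0}, IsUnit (finSuccEquiv ℝ n (nagataEquiv N f)).leadingCoeff := by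
      intro f hf
      refine isUnit_of_dvd_unit ?_ (isUnit_leadingCoeff_nagataEquiv f₀ hne)
      exact Polynomial.leadingCoeff_dvd_leadingCoeff
        (map_dvd _ (map_dvd _ (Finset.dvd_prod_of_mem _ (hS'.mem_toFinset.mpr hf))))
    choose! D hDfin hDmem hDlc hDder using
      fun f hf => exists_finite_derivClosed (hunit f hf)
    set F := ⋃ f ∈ S \ {0}, D f with hFdef
    have hF : F.Finite := hS'.biUnion hDfin
    have hlc : ∀ f ∈ F, IsUnit f.leadingCoeff := fun g hg => by
      obtain ⟨f, hf, hg⟩ := mem_iUnion₂.mp hg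
      exact hDlc f hf g hg
    have hder : ∀ f ∈ F, f.natDegree = 0 ∨ Polynomial.derivative f ∈ F := fun g hg => by
      obtain ⟨f, hf, hg⟩ := mem_iUnion₂.mp hg
      exact (hDder f hf g hg).imp_right (mem_biUnion hf)
    obtain ⟨A, hFA, hA, hAc⟩ := exists_finite_elimClosed hF
    obtain ⟨G, hAG, hGfin, hG⟩ :=
      ih (Polynomial.C ⁻¹' A) (hA.preimage Polynomial.C_injective.injOn)
    have hK := IsStratifying.cylinder hF hlc hder hG fun x x' hxx' t => by
      obtain ⟨t', ht'⟩ := hAc.exists_sameSigns hA (fun c hc => hxx' c (hAG hc)) t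
      exact ⟨t', fun f hf => ht' f (hFA hf)⟩
    have hH := (hK.image (nagataShear N (-1)) (nagataHomeomorph N (-1))
      fun x p => eval_nagataShear N (-1) x p).insert_zero
    refine ⟨_, fun f hf => ?_, ?_, hH⟩
    · by_cases h0 : f = 0
      · exact Or.inl h0
      refine Or.inr ⟨nagataEquiv N f, Or.inl ⟨finSuccEquiv ℝ n (nagataEquiv N f),
        mem_biUnion ⟨hf, h0⟩ (hDmem f ⟨hf, h0⟩), by simp⟩, ?_⟩
      exact (nagataEquiv N).symm_apply_apply f
    · exact (((hF.image _).union (hGfin.image _)).image _).insert 0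

end Stratifying

section Bilevel

open MvPolynomial SignType

variable {n : ℕ}

/-- A piecewise polynomial function has a polynomial majorant and is polynomial on the sign cells
of a finite family of polynomials. -/
theorem IsPiecewisePolynomial.exists_sign_cells {f : (Fin n → ℝ) → ℝ}
    (hf : IsPiecewisePolynomial f) :
    ∃ (S : Set (MvPolynomial (Fin n) ℝ)) (M : MvPolynomial (Fin n) ℝ), S.Finite ∧
      (∀ x, f x ≤ eval x M) ∧ ∀ x₁, ∃ p : MvPolynomial (Fin n) ℝ,
        ∀ x, (∀ h ∈ S, sign (eval x h) = sign (eval x₁ h)) → f x = eval x p := by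
  obtain ⟨N, S, p, hS, -, hcover, hfp⟩ := hf
  choose K T hT hST using hS
  choose g k q hTq using hT
  have hmem : ∀ x, ∃ i, x ∈ S i := fun x => mem_iUnion.mp (hcover ▸ mem_univ x)
  refine ⟨⋃ i, ⋃ j, insert (g i j) (range (q i j)), 1 + ∑ i, p i ^ 2,
    finite_iUnion fun i => finite_iUnion fun j => (finite_range _).insert _, fun x => ?_,
    fun x₁ => ?_⟩
  · obtain ⟨i, hi⟩ := hmem x
    have h1 := Finset.single_le_sum (f := fun i => eval x (p i) ^ 2)
      (fun i _ => sq_nonneg _) (Finset.mem_univ i)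
    rw [hfp i x hi]
    simp only [map_add, map_one, map_sum, map_pow]
    nlinarith [sq_nonneg (eval x (p i) - 1)]
  · obtain ⟨i, hi⟩ := hmem x₁
    refine ⟨p i, fun x hx => hfp i x ?_⟩
    rw [hST i] at hi ⊢
    obtain ⟨j, hj⟩ := mem_iUnion.mp hi
    refine mem_iUnion.mpr ⟨j, ?_⟩
    rw [hTq i j] at hj ⊢
    have hx' : ∀ h ∈ insert (g i j) (range (q i j)), sign (eval x h) = sign (eval x₁ h) :=
      fun h hh => hx h (mem_iUnion₂.mpr ⟨i, j, hh⟩)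
    refine ⟨sign_eq_zero_iff.mp ?_, fun l => sign_eq_one_iff.mp ?_⟩
    · rw [hx' _ (mem_insert _ _), hj.1, sign_zero]
    · rw [hx' _ (mem_insert_of_mem _ ⟨l, rfl⟩), sign_pos (hj.2 l)]

/-- A lower semicontinuous piecewise polynomial function is bounded above by polynomials attached to
the sign vectors compatible with a point, with equality for the sign vector of the point. -/
theorem IsPiecewisePolynomial.exists_sign_vectors {f : (Fin n → ℝ) → ℝ}
    (hf : IsPiecewisePolynomial f) (hlsc : LowerSemicontinuous f) :
    ∃ (m : ℕ) (k : Fin m → MvPolynomial (Fin n) ℝ)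
      (R : Finset (Fin m) → MvPolynomial (Fin n) ℝ),
      (∀ x, ∀ s : Finset (Fin m), (∀ i, i ∈ s ↔ 0 < eval x (k i)) → eval x (R s) = f x) ∧
      ∀ x, ∀ s : Finset (Fin m), (∀ i, 0 < eval x (k i) → i ∈ s) → f x ≤ eval x (R s) := by
  classical
  obtain ⟨S, M, hSfin, hM, hcell⟩ := hf.exists_sign_cells
  obtain ⟨H, hSH, hHfin, hH⟩ := exists_finite_isStratifying n S hSfin
  choose p hp using hcell
  replace hp : ∀ x₁ x, (∀ h ∈ H, sign (eval x h) = sign (eval x₁ h)) → f x = eval x (p x₁) :=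
    fun x₁ x hx => hp x₁ x fun h hh => hx h (hSH hh)
  have hfin : (H ∪ Neg.neg '' H).Finite := hHfin.union (hHfin.image _)
  obtain ⟨m, k, hk⟩ : ∃ m, ∃ k : Fin m → MvPolynomial (Fin n) ℝ, range k = H ∪ Neg.neg '' H :=
    let ⟨m, k, _, hk⟩ := hfin.fin_param
    ⟨m, k, hk⟩
  have hpos : ∀ h ∈ H, ∃ i, k i = h := fun h hh => by
    have : h ∈ range k := hk ▸ Or.inl hh
    exact this
  have hneg : ∀ h ∈ H, ∃ i, k i = -h := fun h hh => by
    have : -h ∈ range k := hk ▸ Or.inr ⟨h, hh, rfl⟩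
    exact this
  have hdeg : ∀ x x₁, (∀ i, 0 < eval x (k i) → 0 < eval x₁ (k i)) →
      ∀ h ∈ H, SignDegen (sign (eval x h)) (sign (eval x₁ h)) := by
    intro x x₁ hx h hh
    rcases lt_trichotomy (eval x h) 0 with h0 | h0 | h0
    · obtain ⟨i, hi⟩ := hneg h hh
      have := hx i (by simpa [hi] using h0)
      rw [hi, map_neg, neg_pos] at this
      exact Or.inr (by rw [sign_neg h0, sign_neg this])
    · exact Or.inl (by simp [h0])
    · obtain ⟨i, hi⟩ := hpos h hh
      have := hx i (by simpa [hi] using h0)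
      rw [hi] at this
      exact Or.inr (by rw [sign_pos h0, sign_pos this])
  have hle : ∀ x x₁, (∀ h ∈ H, SignDegen (sign (eval x h)) (sign (eval x₁ h))) →
      f x ≤ eval x (p x₁) := by
    intro x x₁ hx
    by_contra! hlt
    obtain ⟨c, hc1, hc2⟩ := exists_between hlt
    have hU := (hlsc x c hc2).and
      (((MvPolynomial.continuous_eval (p x₁)).tendsto x).eventually (gt_mem_nhds hc1))
    obtain ⟨y, ⟨hy1, hy2⟩, hy⟩ := mem_closure_iff_nhds.mp (hH x x₁ hx) _ hU
    rw [hp x₁ y hy] at hy1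
    exact lt_asymm hy1 hy2
  refine ⟨m, k, fun s => if h : ∃ x₁, ∀ i, i ∈ s ↔ 0 < eval x₁ (k i) then p h.choose else M,
    fun x s hs => ?_, fun x s h1 => ?_⟩
  · have h : ∃ x₁, ∀ i, i ∈ s ↔ 0 < eval x₁ (k i) := ⟨x, hs⟩
    simp only [dif_pos h]
    refine (hp _ x fun g hg => ?_).symm
    have hiff := fun i => (hs i).symm.trans (h.choose_spec i)
    rcases hdeg x _ (fun i => (hiff i).mp) g hg with h0 | h0
    · rcases hdeg _ x (fun i => (hiff i).mpr) g hg with h0' | h0'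
      · rw [h0, h0']
      · exact h0'.symm
    · exact h0
  · dsimp only
    split_ifs with h
    · exact hle x _ (hdeg x _ fun i hi => (h.choose_spec i).mp (h1 i hi))
    · exact hM x

variable {m : ℕ}

/-- The multilinear interpolation of `R : Finset (Fin m) → ℝ` on the unit cube. -/
def cubeInterp (R : Finset (Fin m) → ℝ) (y : Fin m → ℝ) : ℝ :=
  ∑ s : Finset (Fin m), R s * ((∏ i ∈ s, y i) * ∏ i ∈ Finset.univ \ s, (1 - y i))

theorem cubeInterp_ge {R : Finset (Fin m) → ℝ} {y : Fin m → ℝ} {c : ℝ}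
    (hy : ∀ i, y i ∈ Icc (0 : ℝ) 1)
    (hR : ∀ s : Finset (Fin m), (∀ i, y i = 1 → i ∈ s) → c ≤ R s) :
    c ≤ cubeInterp R y := by
  have hsum : ∑ s : Finset (Fin m), ((∏ i ∈ s, y i) * ∏ i ∈ Finset.univ \ s, (1 - y i)) = 1 := by
    have := Finset.prod_add y (fun i => 1 - y i) Finset.univ
    simpa using this.symm
  calc c = ∑ s : Finset (Fin m), c * ((∏ i ∈ s, y i) * ∏ i ∈ Finset.univ \ s, (1 - y i)) := by
        rw [← Finset.mul_sum, hsum, mul_one]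
    _ ≤ _ := Finset.sum_le_sum fun s _ => by
      by_cases h0 : (∏ i ∈ s, y i) * ∏ i ∈ Finset.univ \ s, (1 - y i) = 0
      · rw [h0, mul_zero, mul_zero]
      rw [mul_eq_zero, not_or] at h0
      refine mul_le_mul_of_nonneg_right (hR s fun i hi => ?_)
        (mul_nonneg (Finset.prod_nonneg fun i _ => (hy i).1)
          (Finset.prod_nonneg fun i _ => sub_nonneg.mpr (hy i).2))
      by_contra hs
      exact h0.2 (Finset.prod_eq_zero (i := i) (by simpa using hs) (by rw [hi, sub_self]))

theorem cubeInterp_indicator (R : Finset (Fin m) → ℝ) (s : Finset (Fin m)) :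
    cubeInterp R (fun i => if i ∈ s then 1 else 0) = R s := by
  rw [cubeInterp, Finset.sum_eq_single s]
  · rw [Finset.prod_eq_one fun i hi => if_pos hi, Finset.prod_eq_one fun i hi => ?_]
    · ring
    · rw [if_neg (by simpa using hi), sub_zero]
  · intro t _ hts
    obtain ⟨i, hi⟩ : ∃ i, ¬(i ∈ t ↔ i ∈ s) := by
      by_contra! h
      exact hts (Finset.ext h)
    by_cases hit : i ∈ t
    · rw [Finset.prod_eq_zero hit (if_neg (by tauto)), zero_mul, mul_zero]
    · rw [Finset.prod_eq_zero (s := Finset.univ \ t) (i := i) (by simpa using hit)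
        (by rw [if_pos (by tauto), sub_self]), mul_zero, mul_zero]
  · exact fun h => absurd (Finset.mem_univ s) h

/-- Minimizers of a linear form over the unit cube. -/
theorem mem_argminSet_linear_cube {K : (Fin n → ℝ) → Fin m → ℝ} {x : Fin n → ℝ}
    {y : Fin m → ℝ} :
    y ∈ argminSet (fun x y => -∑ i, y i * K x i) (boundedBox 0 1) x ↔
      (∀ i, y i ∈ Icc (0 : ℝ) 1) ∧ ∀ i, (0 < K x i → y i = 1) ∧ (K x i < 0 → y i = 0) := by
  classical
  constructor
  · rintro ⟨hy, hmin⟩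
    have key : ∀ i, ∀ c ∈ Icc (0 : ℝ) 1, (c - y i) * K x i ≤ 0 := by
      intro i c hc
      have h1 := hmin (Function.update y i c) fun j => by
        by_cases hj : j = i
        · subst hj
          simpa using hc
        · simpa [hj] using hy j
      have h2 : ∑ j, (Function.update y i c j - y j) * K x j = (c - y i) * K x i := by
        rw [Finset.sum_eq_single i (fun j _ hj => by simp [hj]) (by simp)]
        simp
      simp only [sub_mul, Finset.sum_sub_distrib] at h2
      linarith
    refine ⟨hy, fun i => ⟨fun hi => ?_, fun hi => ?_⟩⟩
    · have := key i 1 ⟨zero_le_one, le_rfl⟩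
      have h1 : y i ≤ 1 := (hy i).2
      nlinarith
    · have := key i 0 ⟨le_rfl, zero_le_one⟩
      have h1 : 0 ≤ y i := (hy i).1
      nlinarith
  · rintro ⟨hy, hyK⟩
    refine ⟨hy, fun y' hy' => neg_le_neg (Finset.sum_le_sum fun i _ => ?_)⟩
    have h0 : 0 ≤ y' i := (hy' i).1
    have h1 : y' i ≤ 1 := (hy' i).2
    rcases lt_trichotomy (K x i) 0 with h | h | h
    · rw [(hyK i).2 h]
      nlinarith
    · simp [h]
    · rw [(hyK i).1 h]
      nlinarith

theorem isPolyMap_cubeInterp (R : Finset (Fin m) → MvPolynomial (Fin n) ℝ) :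
    IsPolyMap fun (x : Fin n → ℝ) (y : Fin m → ℝ) => cubeInterp (fun s => eval x (R s)) y :=
  ⟨∑ s, rename Sum.inl (R s) *
    ((∏ i ∈ s, X (Sum.inr i)) * ∏ i ∈ Finset.univ \ s, (1 - X (Sum.inr i))), fun x y => by
    simp [cubeInterp, eval_rename]⟩

theorem isPolyMap_neg_linear (k : Fin m → MvPolynomial (Fin n) ℝ) :
    IsPolyMap fun (x : Fin n → ℝ) (y : Fin m → ℝ) => -∑ i, y i * eval x (k i) :=
  ⟨-∑ i, X (Sum.inr i) * rename Sum.inl (k i), fun x y => by simp [eval_rename]⟩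

theorem convexOn_neg_linear (c : Fin m → ℝ) :
    ConvexOn ℝ univ fun y : Fin m → ℝ => -∑ i, y i * c i := by
  refine ⟨convex_univ, fun y _ z _ a b _ _ _ => le_of_eq ?_⟩
  simp only [Pi.add_apply, Pi.smul_apply, smul_eq_mul, add_mul, Finset.sum_add_distrib, mul_neg,
    Finset.mul_sum, mul_assoc]
  ring

end Bilevel

/-- every lower semicontinuous piecewise polynomial function is the optimistic
value function of a polynomial bilevel problem with convex lower-level objective over a
bounded box. -/
theorem lsc_piecewise_poly_is_convex_bounded_optimistic_value (n : ℕ)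
    (f : (Fin n → ℝ) → ℝ)
    (hf : IsPiecewisePolynomial f) (hlsc : LowerSemicontinuous f) :
    ∃ (m : ℕ) (P Q : (Fin n → ℝ) → (Fin m → ℝ) → ℝ) (a b : Fin m → ℝ),
      IsPolyMap P ∧ IsPolyMap Q ∧ (∀ x, ConvexOn ℝ Set.univ (Q x)) ∧
      ∀ x, valOpt P Q (boundedBox a b) x = ((f x : ℝ) : EReal) := by
  classical
  obtain ⟨m, k, R, hR, hle⟩ := hf.exists_sign_vectors hlsc
  refine ⟨m, _, _, 0, 1, isPolyMap_cubeInterp R, isPolyMap_neg_linear k,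
    fun x => convexOn_neg_linear _, fun x => ?_⟩
  have hmem := fun y => mem_argminSet_linear_cube
    (K := fun x i => MvPolynomial.eval x (k i)) (x := x) (y := y)
  set s : Finset (Fin m) := {i | 0 < MvPolynomial.eval x (k i)} with hs
  refine le_antisymm ?_ (le_iInf₂ fun y hy => EReal.coe_le_coe_iff.mpr ?_)
  · refine (iInf₂_le (fun i => if i ∈ s then 1 else 0) ((hmem _).mpr ⟨fun i => ?_, fun i =>
      ⟨fun hi => ?_, fun hi => ?_⟩⟩)).trans (EReal.coe_le_coe_iff.mpr ?_)
    · split_ifs <;> simp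
    · exact if_pos (by simpa [hs] using hi)
    · exact if_neg (by simpa [hs] using hi.le)
    · exact ((cubeInterp_indicator _ s).trans (hR x s fun i => by simp [hs])).le
  · obtain ⟨hy01, hyk⟩ := (hmem y).mp hy
    exact cubeInterp_ge hy01 fun t ht =>
      hle x t fun i hi => ht i ((hyk i).1 hi)
end
end
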